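/- Let K be a PAC field of characteristic p, meaning: for every n ≥ 1 and every prime ideal P of the polynomial ring K[Y_1, ..., Y_n] such that the ideal generated by P in K̄[Y_1, ..., Y_n] is prime (K̄ an algebraic closure of K), there exists a point a ∈ K^n at which every element of P vanishes. Let f_1, ..., f_r ∈ K[T,X] be absolutely irreducible polynomials such that for each i, writing d_i for the total degree of f_i, one has d_i ≥ 2, p does not divide d_i(d_i − 1), and the projective plane curve defined by the homogenization of f_i is smooth. Suppose that for each i the field K possesses a Galois field extension L_i of degree d_i. Then the set B of pairs (a_1, a_2) ∈ K × K such that f_i(T, a_1·T + a_2) is irreducible in K[T] for every i = 1, ..., r is Zariski-dense in the affine plane; explicitly, for every nonzero polynomial h ∈ K[A_1, A_2] there exists (a_1, a_2) ∈ B with h(a_1, a_2) ≠ 0. -/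

import Mathlib

open MvPolynomial

/-- The univariate polynomial `f(T, a₁·T + a₂) ∈ K[T]` obtained from `f ∈ K[T,X]`
(variable `0` is `T`, variable `1` is `X`) by substituting `X := a₁·T + a₂`. -/
noncomputable def lineSub {K : Type*} [CommSemiring K] (f : MvPolynomial (Fin 2) K)
    (a₁ a₂ : K) : Polynomial K :=
  MvPolynomial.aeval ![Polynomial.X, Polynomial.C a₁ * Polynomial.X + Polynomial.C a₂] f

/-- `f ∈ K[T,X]` is absolutely irreducible: it is irreducible over an algebraic
closure of `K`. -/
def AbsolutelyIrreducible {K : Type*} [Field K] (f : MvPolynomial (Fin 2) K) : Prop :=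
  Irreducible (MvPolynomial.map (algebraMap K (AlgebraicClosure K)) f)

/-- `F ∈ K[X₀,X₁,X₂]` is the degree-`d` homogenization of `f ∈ K[T,X]`
(so `F` is homogeneous of degree `d` with `F(1,T,X) = f(T,X)`) and the projective
plane curve `F = 0` is smooth: `F` and its three partial derivatives have no common
zero `≠ (0,0,0)` with coordinates in an algebraic closure of `K`. -/
def IsSmoothHomogenization {K : Type*} [Field K] (F : MvPolynomial (Fin 3) K)
    (f : MvPolynomial (Fin 2) K) (d : ℕ) : Prop :=
  F.IsHomogeneous d ∧
  MvPolynomial.aeval ![1, MvPolynomial.X 0, MvPolynomial.X 1] F = f ∧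
  ∀ x : Fin 3 → AlgebraicClosure K, x ≠ 0 →
    MvPolynomial.eval x (F.map (algebraMap K (AlgebraicClosure K))) = 0 →
    ∃ j : Fin 3, MvPolynomial.eval x ((MvPolynomial.pderiv j F).map
      (algebraMap K (AlgebraicClosure K))) ≠ 0

/-- `K` is PAC: every prime ideal `P` of `K[Y₁,…,Y_n]` whose extension to
`K̄[Y₁,…,Y_n]` is prime has a common zero in `Kⁿ`. -/
def IsPAC (K : Type*) [Field K] : Prop :=
  ∀ (n : ℕ) (P : Ideal (MvPolynomial (Fin n) K)), P.IsPrime →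
    (Ideal.map (MvPolynomial.map (R := K) (S₁ := AlgebraicClosure K)
        (algebraMap K (AlgebraicClosure K)) :
      MvPolynomial (Fin n) K →+* MvPolynomial (Fin n) (AlgebraicClosure K)) P).IsPrime →
    ∃ a : Fin n → K, ∀ g ∈ P, MvPolynomial.eval a g = 0


section
theorem gen_ker {k Ω : Type*} [Field k] [Field Ω] [Algebra k Ω] {f : MvPolynomial (Fin 2) k}
    (hf : Irreducible f) (v : Fin 2 → Ω) (h0 : aeval v f = 0)
    (h : ¬ ∀ i, IsAlgebraic k (v i)) :
    RingHom.ker (aeval (R := k) v) = Ideal.span {f} := by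
  have hle : Ideal.span {f} ≤ RingHom.ker (aeval (R := k) v) := by
    rw [Ideal.span_singleton_le_iff_mem]; exact h0
  by_contra hne
  have hlt : Ideal.span {f} < RingHom.ker (aeval (R := k) v) := lt_of_le_of_ne hle (Ne.symm hne)
  have hp2 : (RingHom.ker (aeval (R := k) v)).IsPrime := RingHom.ker_isPrime _
  have hp1 : (Ideal.span {f}).IsPrime :=
    (Ideal.span_singleton_prime hf.ne_zero).2 hf.prime
  have hlt0 : (⊥ : Ideal (MvPolynomial (Fin 2) k)) < Ideal.span {f} := by
    rw [bot_lt_iff_ne_bot, Ne, Ideal.span_singleton_eq_bot]; exact hf.ne_zero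
  have hnm : ¬ (RingHom.ker (aeval (R := k) v)).IsMaximal := by
    intro hm
    apply h
    intro i
    let φ : MvPolynomial (Fin 2) k →ₐ[k] Ω := aeval v
    let Q := MvPolynomial (Fin 2) k ⧸ (RingHom.ker φ)
    have hm' : (RingHom.ker φ).IsMaximal := hm
    let fq : Field Q := Ideal.Quotient.field (RingHom.ker φ)
    let aq : Algebra k Q := Ideal.Quotient.algebra k
    have : Algebra.FiniteType k Q := inferInstance
    have hfin : Module.Finite k Q := finite_of_finite_type_of_isJacobsonRing k Q
    have : IsIntegral k (Ideal.Quotient.mk (RingHom.ker φ) (X i)) :=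
      Algebra.IsIntegral.isIntegral (R := k) (A := Q) _
    have h2 := this.map (Ideal.kerLiftAlg φ)
    have h3 : Ideal.kerLiftAlg φ (Ideal.Quotient.mk (RingHom.ker φ) (X i)) = v i := by
      erw [Ideal.kerLiftAlg_mk]; simp [φ]
    rw [h3] at h2
    exact h2.isAlgebraic
  obtain ⟨M, hM, hleM⟩ := Ideal.exists_le_maximal _ hp2.ne_top
  have hltM : RingHom.ker (aeval (R := k) v) < M := by
    refine lt_of_le_of_ne hleM ?_
    rintro rfl; exact hnm hM
  let s : LTSeries (PrimeSpectrum (MvPolynomial (Fin 2) k)) :=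
    { length := 3
      toFun := ![⟨⊥, Ideal.isPrime_bot⟩, ⟨_, hp1⟩, ⟨_, hp2⟩, ⟨M, hM.isPrime⟩]
      step := by
        intro i
        fin_cases i
        · exact hlt0
        · exact hlt
        · exact hltM }
  have h1 := Order.LTSeries.length_le_krullDim s
  have h2 : ringKrullDim (MvPolynomial (Fin 2) k) = 2 := by
    rw [MvPolynomial.ringKrullDim_of_isNoetherianRing]; simp
  rw [ringKrullDim] at h2
  rw [h2] at h1
  have : ((3:ℕ):WithBot ℕ∞) ≤ 2 := h1
  norm_cast at this

theorem exists_algHom_algClosed (k R : Type*) [Field k] [IsAlgClosed k] [CommRing R] [Nontrivial R]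
    [Algebra k R] [Algebra.FiniteType k R] : Nonempty (R →ₐ[k] k) := by
  obtain ⟨M, hM⟩ := Ideal.exists_maximal R
  let Q := R ⧸ M
  let fq : Field Q := Ideal.Quotient.field M
  let aq : Algebra k Q := Ideal.Quotient.algebra k
  have : Algebra.FiniteType k Q := inferInstance
  have hfin : Module.Finite k Q := finite_of_finite_type_of_isJacobsonRing k Q
  let ψ : Q →ₐ[k] k := IsAlgClosed.lift
  exact ⟨ψ.comp (Ideal.Quotient.mkₐ k M)⟩

theorem abs_irr {k E σ : Type*} [Field k] [IsAlgClosed k] [Field E] [Algebra k E]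
    {f : MvPolynomial σ k} (hf : Irreducible f) :
    Irreducible (map (algebraMap k E) f) := by
  have hnu : ∀ (A : Type _) [CommRing A] [IsDomain A] (g : MvPolynomial σ A), g ≠ 0 → ¬ IsUnit g →
      (∀ m, m ≠ 0 → coeff m g = 0) → ¬ IsUnit (coeff 0 g) := by
    intro A _ _ g hg hgu hm hu
    apply hgu
    rw [MvPolynomial.isUnit_iff]
    exact ⟨hu, fun i hi => by rw [hm i hi]; exact IsNilpotent.zero⟩
  have hnc : ∀ g : MvPolynomial σ E, g ≠ 0 → ¬ IsUnit g → ∃ m, m ≠ 0 ∧ coeff m g ≠ 0 := by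
    intro g hg hgu
    by_contra hcon
    push Not at hcon
    have := hnu E g hg hgu hcon
    apply this
    rw [isUnit_iff_ne_zero]
    intro h0
    apply hg
    ext m
    by_cases hm : m = 0
    · subst hm; simpa using h0
    · simpa using hcon m hm
  have hfm : map (algebraMap k E) f ≠ 0 := by
    rw [Ne, map_eq_zero_iff _ (MvPolynomial.map_injective _ (algebraMap k E).injective)]
    exact hf.ne_zero
  constructor
  · intro hu
    apply hf.not_isUnit
    rw [MvPolynomial.isUnit_iff] at hu ⊢
    refine ⟨?_, fun i hi => ?_⟩
    · have := hu.1
      rw [coeff_map, isUnit_iff_ne_zero] at this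
      rw [isUnit_iff_ne_zero]
      intro h; apply this; rw [h, map_zero]
    · have := hu.2 i hi
      rw [isNilpotent_iff_eq_zero, coeff_map, map_eq_zero] at this
      rw [this]; exact IsNilpotent.zero
  · intro g h hgh
    by_contra hcon
    push Not at hcon
    have hg0 : g ≠ 0 := by rintro rfl; apply hfm; rw [hgh, zero_mul]
    have hh0 : h ≠ 0 := by rintro rfl; apply hfm; rw [hgh, mul_zero]
    obtain ⟨m, hm0, hm⟩ := hnc g hg0 hcon.1
    obtain ⟨n, hn0, hn⟩ := hnc h hh0 hcon.2
    let S : Set E := (↑(g.coeffs) ∪ ↑(h.coeffs)) ∪ {(coeff m g)⁻¹, (coeff n h)⁻¹, 0}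
    have hSfin : S.Finite := by
      refine Set.Finite.union (Set.Finite.union ?_ ?_) (by simp)
      · exact Finset.finite_toSet _
      · exact Finset.finite_toSet _
    let R := Algebra.adjoin k S
    have hR : Algebra.FiniteType k R := by
      rw [← Subalgebra.fg_iff_finiteType]
      exact Subalgebra.fg_adjoin_finset hSfin.toFinset |> fun h => by simpa using h
    obtain ⟨φ⟩ := exists_algHom_algClosed k R
    have key : ∀ g : MvPolynomial σ E, (∀ m, coeff m g ∈ R) → ∃ g0 : MvPolynomial σ R,
        map (algebraMap R E) g0 = g := by
      intro g hg
      have : g ∈ Set.range (map (σ := σ) (algebraMap R E)) := by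
        rw [MvPolynomial.mem_range_map_iff_coeffs_subset]
        intro x hx
        rw [SetLike.mem_coe, MvPolynomial.mem_coeffs_iff] at hx
        obtain ⟨n, _, rfl⟩ := hx
        exact ⟨⟨_, hg n⟩, rfl⟩
      exact this
    have hgR : ∀ m, coeff m g ∈ R := by
      intro m
      by_cases h0 : coeff m g = 0
      · rw [h0]; exact zero_mem _
      · exact Algebra.subset_adjoin (Or.inl (Or.inl (MvPolynomial.coeff_mem_coeffs m h0)))
    have hhR : ∀ m, coeff m h ∈ R := by
      intro m
      by_cases h0 : coeff m h = 0
      · rw [h0]; exact zero_mem _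
      · exact Algebra.subset_adjoin (Or.inl (Or.inr (MvPolynomial.coeff_mem_coeffs m h0)))
    obtain ⟨g0, hg0'⟩ := key g hgR
    obtain ⟨h0, hh0'⟩ := key h hhR
    have hprod : map (algebraMap k R) f = g0 * h0 := by
      apply MvPolynomial.map_injective (algebraMap R E) Subtype.val_injective
      rw [map_mul, hg0', hh0', MvPolynomial.map_map, ← IsScalarTower.algebraMap_eq, hgh]
    have hf' : f = map φ.toRingHom g0 * map φ.toRingHom h0 := by
      rw [← map_mul, ← hprod, MvPolynomial.map_map]
      have : φ.toRingHom.comp (algebraMap k R) = RingHom.id k := by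
        ext x; simp
      rw [this, MvPolynomial.map_id]
    have hcu : ∀ (a : E) (ha : a ∈ R), a ≠ 0 → a⁻¹ ∈ R → φ ⟨a, ha⟩ ≠ 0 := by
      intro a ha hane hai h0
      have : φ (⟨a, ha⟩ * ⟨a⁻¹, hai⟩) = 0 := by rw [map_mul, h0, zero_mul]
      have h1 : (⟨a, ha⟩ * ⟨a⁻¹, hai⟩ : R) = 1 := by
        apply Subtype.ext; simp [hane]
      rw [h1, map_one] at this
      exact one_ne_zero this
    have fin : ∀ (g : MvPolynomial σ E) (g0 : MvPolynomial σ R) (m : σ →₀ ℕ),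
        map (algebraMap R E) g0 = g → m ≠ 0 → coeff m g ≠ 0 → (coeff m g)⁻¹ ∈ R →
        ¬ IsUnit (map φ.toRingHom g0) := by
      intro g g0 m hg hm0 hm hmi hu
      rw [MvPolynomial.isUnit_iff] at hu
      have h1 := hu.2 m hm0
      rw [isNilpotent_iff_eq_zero, coeff_map] at h1
      have h2 : ((coeff m g0 : R) : E) = coeff m g := by rw [← hg, coeff_map]; rfl
      have := hcu (coeff m g0 : R) (coeff m g0).2 (by rw [h2]; exact hm) (by rw [h2]; exact hmi)
      exact this h1
    rcases hf.isUnit_or_isUnit hf' with hu | hu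
    · exact fin g g0 m hg0' hm0 hm (Algebra.subset_adjoin (Or.inr (by simp))) hu
    · exact fin h h0 n hh0' hn0 hn (Algebra.subset_adjoin (Or.inr (by simp))) hu
end

section
open scoped Pointwise

theorem span_adjoin_singleton_le {R Q : Type*} [CommRing R] [CommRing Q] [Algebra R Q]
    (f : Polynomial R) (hf : f.Monic) (t : Q) (ht : Polynomial.aeval t f = 0) :
    (Algebra.adjoin R {t}).toSubmodule ≤
      Submodule.span R ((fun a : ℕ => t ^ a) '' (Set.Iio f.natDegree)) := by
  intro x hx
  rw [Subalgebra.mem_toSubmodule, Algebra.adjoin_singleton_eq_range_aeval] at hx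
  obtain ⟨p, rfl⟩ := hx
  have h1 : Polynomial.aeval t p = Polynomial.aeval t (p %ₘ f) := by
    conv_lhs => rw [← Polynomial.modByMonic_add_div p f]
    simp [ht]
  show Polynomial.aeval t p ∈ _
  rw [h1]
  rcases subsingleton_or_nontrivial R with hRs | hRs
  · rw [Subsingleton.elim (p %ₘ f) 0, map_zero]; exact zero_mem _
  by_cases hd : f.natDegree = 0
  · have : f = 1 := Polynomial.eq_one_of_monic_natDegree_zero hf hd
    subst this
    simp
  rw [Polynomial.aeval_eq_sum_range' (n := f.natDegree)]
  · refine Submodule.sum_mem _ fun a ha => Submodule.smul_mem _ _ (Submodule.subset_span ?_)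
    exact ⟨a, Finset.mem_range.1 ha, rfl⟩
  · exact Polynomial.natDegree_modByMonic_lt _ hf (by rintro rfl; simp at hd)

theorem span_roots.{u} (d : ℕ) : ∀ (R Q : Type u) [CommRing R] [CommRing Q] [Algebra R Q]
    (f : Polynomial R), f.Monic → f.natDegree = d → ∀ (t : Fin d → Q),
    (∀ j, Polynomial.aeval (t j) f = 0) → (∀ i j, i ≠ j → IsUnit (t i - t j)) →
    ∃ s : Finset Q, s.card ≤ d.factorial ∧
      (Algebra.adjoin R (Set.range t)).toSubmodule ≤ Submodule.span R (s : Set Q) := by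
  classical
  induction d with
  | zero =>
    intro R Q _ _ _ f hf hd t _ _
    refine ⟨{1}, by simp, ?_⟩
    have : Set.range t = ∅ := Set.range_eq_empty t
    rw [this, Algebra.adjoin_empty, Algebra.toSubmodule_bot]
    simp [Submodule.one_eq_span]
  | succ d ih =>
    intro R Q _ _ _ f hf hd t ht hu
    let R' := Algebra.adjoin R {t 0}
    let t0 : R' := ⟨t 0, Algebra.subset_adjoin rfl⟩
    let fR := f.map (algebraMap R R')
    have hfR : fR.Monic := hf.map _
    by_cases hQ : Subsingleton Q
    · refine ⟨∅, by simp, ?_⟩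
      intro x _
      rw [Subsingleton.elim x 0]; exact zero_mem _
    rw [not_subsingleton_iff_nontrivial] at hQ
    have hroot : fR.IsRoot t0 := by
      rw [Polynomial.IsRoot.def]
      apply Subtype.val_injective
      have h1 := ht 0
      rw [Polynomial.eval_map_algebraMap]
      have h2 := Polynomial.aeval_algebraMap_apply (R := R) (A := R') Q t0 f
      have h3 : algebraMap R' Q t0 = t 0 := rfl
      rw [h3, h1] at h2
      exact h2.symm
    let f' := fR /ₘ (Polynomial.X - Polynomial.C t0)
    have hff : (Polynomial.X - Polynomial.C t0) * f' = fR :=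
      Polynomial.mul_divByMonic_eq_iff_isRoot.2 hroot
    have hf' : f'.Monic := by
      have := Polynomial.monic_X_sub_C t0
      refine this.of_mul_monic_left ?_
      rw [hff]; exact hfR
    have hdeg : f'.natDegree = d := by
      show (fR /ₘ (Polynomial.X - Polynomial.C t0)).natDegree = d
      rw [Polynomial.natDegree_divByMonic _ (Polynomial.monic_X_sub_C t0),
        Polynomial.natDegree_X_sub_C, hf.natDegree_map, hd]; rfl
    obtain ⟨s, hsc, hs⟩ := ih R' Q f' hf' hdeg (fun j => t j.succ) (by
      intro j
      have h1 := ht j.succ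
      have h2 : Polynomial.aeval (t j.succ) fR = 0 := by
        rw [Polynomial.aeval_map_algebraMap]; exact h1
      rw [← hff, map_mul] at h2
      have h3 : IsUnit (Polynomial.aeval (t j.succ) (Polynomial.X - Polynomial.C t0)) := by
        simpa [t0] using hu j.succ 0 (Fin.succ_ne_zero j)
      exact (h3.mul_right_eq_zero).1 h2) (by
      intro i j hij
      exact hu _ _ (fun h => hij (Fin.succ_injective _ h)))
    let s0 : Finset Q := (Finset.range (d+1)).image (fun a => t 0 ^ a)
    refine ⟨s0 * s, ?_, ?_⟩
    · refine (Finset.card_mul_le).trans ?_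
      rw [Nat.factorial_succ]
      exact Nat.mul_le_mul (Finset.card_image_le.trans (by simp)) hsc
    · have hR's : R'.toSubmodule ≤ Submodule.span R (s0 : Set Q) := by
        refine (span_adjoin_singleton_le f hf (t 0) (ht 0)).trans (Submodule.span_mono ?_)
        rintro _ ⟨a, ha, rfl⟩
        simp only [Finset.coe_image, s0]
        refine ⟨a, ?_, rfl⟩
        rw [hd] at ha
        simpa using ha
      have ht0 : t 0 ∈ Algebra.adjoin R' (Set.range (fun j : Fin d => t j.succ)) := by
        have h5 := (Algebra.adjoin R' (Set.range (fun j : Fin d => t j.succ))).algebraMap_mem t0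
        have h6 : algebraMap R' Q t0 = t 0 := rfl
        rwa [h6] at h5
      have hle : Algebra.adjoin R (Set.range t) ≤
          (Algebra.adjoin R' (Set.range (fun j : Fin d => t j.succ))).restrictScalars R := by
        rw [Algebra.adjoin_le_iff]
        rintro _ ⟨j, rfl⟩
        rw [SetLike.mem_coe, Subalgebra.mem_restrictScalars]
        rcases Fin.eq_zero_or_eq_succ j with rfl | ⟨j, rfl⟩
        · exact ht0
        · exact Algebra.subset_adjoin ⟨j, rfl⟩
      intro x hx
      have hx2 : x ∈ Submodule.span R' (s : Set Q) := hs (hle hx)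
      rw [Finset.coe_mul, ← Submodule.span_mul_span]
      clear hx
      induction hx2 using Submodule.span_induction with
      | mem x hx => 
        have := Submodule.mul_mem_mul (hR's (one_mem R')) (Submodule.subset_span (R := R) hx)
        simpa using this
      | zero => exact zero_mem _
      | add x y _ _ hx hy => exact add_mem hx hy
      | smul a x hx' hx =>
        have ha := hR's a.2
        have h1 := Submodule.mul_mem_mul ha hx
        rw [← mul_assoc] at h1
        have h2 : Submodule.span R (s0 : Set Q) * Submodule.span R (s0 : Set Q) ≤
            Submodule.span R (s0 : Set Q) := by
          have h3 : Submodule.span R (s0 : Set Q) ≤ R'.toSubmodule := by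
            rw [Submodule.span_le]
            intro y hy
            simp only [Finset.coe_image, s0] at hy
            obtain ⟨a, _, rfl⟩ := hy
            exact pow_mem t0.2 a
          refine (Submodule.mul_le.2 ?_)
          intro m hm n hn
          exact hR's (R'.mul_mem (h3 hm) (h3 hn))
        exact (mul_le_mul_left h2 _) h1

theorem span_roots_family.{u} {ι : Type*} (I : Finset ι) (d : ι → ℕ) (R Q : Type u)
    [CommRing R] [CommRing Q] [Algebra R Q]
    (f : ι → Polynomial R) (hf : ∀ i, (f i).Monic) (hd : ∀ i, (f i).natDegree = d i)
    (t : ∀ i, Fin (d i) → Q) (ht : ∀ i j, Polynomial.aeval (t i j) (f i) = 0)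
    (hu : ∀ i j j', j ≠ j' → IsUnit (t i j - t i j')) :
    ∃ s : Finset Q, s.card ≤ ∏ i ∈ I, (d i).factorial ∧
      (Algebra.adjoin R (⋃ i ∈ I, Set.range (t i))).toSubmodule ≤
        Submodule.span R (s : Set Q) := by
  classical
  induction I using Finset.induction_on with
  | empty =>
    refine ⟨{1}, by simp, ?_⟩
    have : (⋃ i ∈ (∅ : Finset ι), Set.range (t i)) = ∅ := by simp
    rw [this, Algebra.adjoin_empty, Algebra.toSubmodule_bot]
    simp [Submodule.one_eq_span]
  | insert a I ha ih =>
    obtain ⟨s, hsc, hs⟩ := ih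
    obtain ⟨s', hsc', hs'⟩ := span_roots (d a) R Q (f a) (hf a) (hd a) (t a) (ht a) (hu a)
    refine ⟨s' * s, ?_, ?_⟩
    · rw [Finset.prod_insert ha]
      exact (Finset.card_mul_le).trans (Nat.mul_le_mul hsc' hsc)
    · rw [Finset.set_biUnion_insert, Algebra.adjoin_union_coe_submodule, Finset.coe_mul,
        ← Submodule.span_mul_span]
      exact mul_le_mul' hs' hs

theorem span_inj.{u} {ι : Type*} [Fintype ι] (d : ι → ℕ) (R Q : Type u) (Ω : Type*)
    [CommRing R] [CommRing Q] [Algebra R Q] [Field Ω]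
    (f : ι → Polynomial R) (hf : ∀ i, (f i).Monic) (hd : ∀ i, (f i).natDegree = d i)
    (t : ∀ i, Fin (d i) → Q) (ht : ∀ i j, Polynomial.aeval (t i j) (f i) = 0)
    (hu : ∀ i j j', j ≠ j' → IsUnit (t i j - t i j'))
    (χ : Q →+* Ω) (hχ : Function.Injective (χ.comp (algebraMap R Q)))
    (σ : (∀ i, Equiv.Perm (Fin (d i))) → (Ω →+* Ω))
    (hσR : ∀ π r, σ π (χ (algebraMap R Q r)) = χ (algebraMap R Q r))
    (hσt : ∀ π i j, σ π (χ (t i j)) = χ (t i (π i j)))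
    (q : Q) (hq : q ∈ Algebra.adjoin R (⋃ i, Set.range (t i))) (hq0 : χ q = 0) : q = 0 := by
  classical
  obtain ⟨s, hsc, hs⟩ := span_roots_family Finset.univ d R Q f hf hd t ht hu
  let G := ∀ i, Equiv.Perm (Fin (d i))
  have hG : Fintype.card G = ∏ i, (d i).factorial := by
    simp [G, Fintype.card_pi, Fintype.card_perm]
  have hcard : Fintype.card s ≤ Fintype.card G := by
    rw [hG, Fintype.card_coe]; exact hsc
  obtain ⟨e⟩ : Nonempty (s ↪ G) := Function.Embedding.nonempty_of_card_le hcard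
  let v : G → Q := fun g => if h : ∃ x : s, e x = g then (h.choose : Q) else 0
  have hv : (s : Set Q) ⊆ Set.range v := by
    intro x hx
    refine ⟨e ⟨x, hx⟩, ?_⟩
    have h : ∃ y : s, e y = e ⟨x, hx⟩ := ⟨_, rfl⟩
    simp only [v, dif_pos h]
    rw [e.injective h.choose_spec]
  have hs2 : ∀ x ∈ Algebra.adjoin R (⋃ i, Set.range (t i)), ∃ c : G → R, ∑ g, c g • v g = x := by
    intro x hx
    have : x ∈ Submodule.span R (Set.range v) := by
      apply Submodule.span_mono hv
      apply hs
      simpa using hx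
    rwa [Submodule.mem_span_range_iff_exists_fun] at this
  let S := Algebra.adjoin R (⋃ i, Set.range (t i))
  let ψ : G → (S →* Ω) := fun π => (((σ π).comp χ).comp (S.val : S →+* Q)).toMonoidHom
  have hψ : Function.Injective ψ := by
    intro π π' h
    funext i
    ext1 j
    by_contra hne
    have hmem : t i j ∈ S := Algebra.subset_adjoin (Set.mem_iUnion.2 ⟨i, j, rfl⟩)
    have h1 := DFunLike.congr_fun h ⟨t i j, hmem⟩
    have h2 : σ π (χ (t i j)) = σ π' (χ (t i j)) := h1
    rw [hσt, hσt, ← sub_eq_zero, ← map_sub] at h2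
    exact ((hu i _ _ hne).map χ).ne_zero h2
  have hind : LinearIndependent Ω (fun π : G => (ψ π : S → Ω)) :=
    (linearIndependent_monoidHom S Ω).comp ψ hψ
  let M : Matrix G G Ω := Matrix.of fun π g => σ π (χ (v g))
  -- rows independent
  have hM : IsUnit M := by
    rw [← Matrix.linearIndependent_rows_iff_isUnit]
    rw [Fintype.linearIndependent_iff]
    intro c hc
    rw [Fintype.linearIndependent_iff] at hind
    apply hind c
    funext x
    obtain ⟨b, hb⟩ := hs2 x.1 x.2
    have hc2 : ∀ g, ∑ π, c π * σ π (χ (v g)) = 0 := by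
      intro g
      have := congrFun hc g
      simpa [M, Finset.sum_apply] using this
    have : ∀ π, ψ π x = ∑ g, χ (algebraMap R Q (b g)) * σ π (χ (v g)) := by
      intro π
      show σ π (χ x.1) = _
      rw [← hb, map_sum, map_sum]
      refine Finset.sum_congr rfl fun g _ => ?_
      rw [Algebra.smul_def, map_mul, map_mul, hσR]
    simp only [Finset.sum_apply, Pi.smul_apply, smul_eq_mul, Pi.zero_apply, this, Finset.mul_sum]
    rw [Finset.sum_comm]
    refine Finset.sum_eq_zero fun g _ => ?_
    have := congrArg (fun y => χ (algebraMap R Q (b g)) * y) (hc2 g)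
    simp only [Finset.mul_sum, mul_zero] at this
    rw [← this]
    refine Finset.sum_congr rfl fun π _ => by ring
  obtain ⟨b, hb⟩ := hs2 q hq
  have hz : M.mulVec (fun g => χ (algebraMap R Q (b g))) = 0 := by
    funext π
    have : σ π (χ q) = 0 := by rw [hq0, map_zero]
    rw [← hb, map_sum, map_sum] at this
    simp only [Matrix.mulVec, dotProduct, Matrix.of_apply, M, Pi.zero_apply]
    rw [← this]
    refine Finset.sum_congr rfl fun g _ => ?_
    rw [Algebra.smul_def, map_mul, map_mul, hσR, mul_comm]
  have hz2 := Matrix.mulVec_injective_of_isUnit hM (hz.trans (Matrix.mulVec_zero M).symm)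
  rw [← hb]
  refine Finset.sum_eq_zero fun g _ => ?_
  have h1 := congrFun hz2 g
  have h2 : (χ.comp (algebraMap R Q)) (b g) = (χ.comp (algebraMap R Q)) 0 := by
    rw [map_zero]; exact h1
  rw [hχ h2, zero_smul]
end

section
theorem dvd_of_roots_sep {K Ω : Type*} [Field K] [Field Ω] [IsAlgClosed Ω] [Algebra K Ω]
    (m : Polynomial K) (hm : m.Separable) (p : Polynomial Ω)
    (h : ∀ θ : Ω, Polynomial.aeval θ m = 0 → p.eval θ = 0) : m.map (algebraMap K Ω) ∣ p := by
  by_cases hp : p = 0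
  · rw [hp]; exact dvd_zero _
  have hm' : (m.map (algebraMap K Ω)).Separable := hm.map
  apply (IsAlgClosed.splits (m.map (algebraMap K Ω))).dvd_of_roots_le_roots hm'.ne_zero
  rw [Multiset.le_iff_subset (Polynomial.nodup_roots hm')]
  intro θ hθ
  rw [Polynomial.mem_roots hm'.ne_zero, Polynomial.IsRoot.def, Polynomial.eval_map_algebraMap] at hθ
  rw [Polynomial.mem_roots hp]
  exact h θ hθ

/-- The conditions imposed on a point `b` of the auxiliary variety. -/
def PacCond {K : Type*} [Field K] {N : Type*} {r : ℕ} {d : Fin r → ℕ}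
    (G : Fin r → Polynomial (MvPolynomial (Fin 2) K)) (m : Fin r → Polynomial K)
    (iA : Fin 2 → N) (iC iB : ∀ i, Fin (d i) → N) {B : Type*} [CommRing B] [Algebra K B]
    (b : N → B) : Prop :=
  ∀ i, ∀ θ : B, Polynomial.aeval θ (m i) = 0 →
    ((G i).map (aeval (R := K) (b ∘ iA)).toRingHom).eval (∑ l, b (iC i l) * θ ^ (l : ℕ)) = 0 ∧
    ∑ l, b (iB i l) * (∑ l, b (iC i l) * θ ^ (l : ℕ)) ^ (l : ℕ) = θ

theorem pac_transfer.{u} {K : Type*} [Field K] {N : Type*} {r : ℕ} {d : Fin r → ℕ}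
    (G : Fin r → Polynomial (MvPolynomial (Fin 2) K)) (m : Fin r → Polynomial K)
    (hmm : ∀ i, (m i).Monic) (hms : ∀ i, (m i).Separable)
    (iA : Fin 2 → N) (iC iB : ∀ i, Fin (d i) → N)
    {Ω : Type u} [Field Ω] [IsAlgClosed Ω] [Algebra K Ω] (y : N → Ω)
    (hy : PacCond G m iA iC iB y)
    {B : Type u} [CommRing B] [Algebra K B] (b : N → B)
    (hb : ∀ p : MvPolynomial N K, aeval y p = 0 → aeval b p = 0) :
    PacCond G m iA iC iB b := by
  intro i θ hθ
  let cU : Polynomial (MvPolynomial N K) := ∑ l, Polynomial.C (X (iC i l)) * Polynomial.X ^ (l : ℕ)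
  let bU : Polynomial (MvPolynomial N K) := ∑ l, Polynomial.C (X (iB i l)) * Polynomial.X ^ (l : ℕ)
  let gU : Polynomial (MvPolynomial N K) :=
    (G i).map (aeval (R := K) (fun j => (X (iA j) : MvPolynomial N K))).toRingHom
  -- for evaluation
  have ev1 : ∀ {B : Type u} [CommRing B] [Algebra K B] (b : N → B) (θ : B),
      ((gU.comp cU).map (aeval (R := K) b).toRingHom).eval θ =
      ((G i).map (aeval (R := K) (b ∘ iA)).toRingHom).eval (∑ l, b (iC i l) * θ ^ (l : ℕ)) := by
    intro B _ _ b θ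
    rw [Polynomial.map_comp, Polynomial.eval_comp]
    congr 1
    · simp [cU, Polynomial.eval_finsetSum, Polynomial.map_sum]
    · simp only [gU, Polynomial.map_map]
      congr 1
      apply MvPolynomial.ringHom_ext
      · intro x; simp
      · intro x; simp
  have ev2 : ∀ {B : Type u} [CommRing B] [Algebra K B] (b : N → B) (θ : B),
      ((bU.comp cU).map (aeval (R := K) b).toRingHom).eval θ =
      ∑ l, b (iB i l) * (∑ l, b (iC i l) * θ ^ (l : ℕ)) ^ (l : ℕ) := by
    intro B _ _ b θ
    simp [cU, bU, Polynomial.eval_finsetSum, Polynomial.map_sum, Polynomial.map_comp]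
  have key : ∀ pU : Polynomial (MvPolynomial N K),
      (∀ θ : Ω, Polynomial.aeval θ (m i) = 0 → (pU.map (aeval (R := K) y).toRingHom).eval θ = 0) →
      (pU.map (aeval (R := K) b).toRingHom).eval θ = 0 := by
    intro pU hpU
    have hd := dvd_of_roots_sep (m i) (hms i) _ hpU
    let mU := (m i).map (algebraMap K (MvPolynomial N K))
    have hmU : mU.Monic := (hmm i).map _
    have hmap : ∀ {B : Type u} [CommRing B] [Algebra K B] (b : N → B),
        mU.map (aeval (R := K) b).toRingHom = (m i).map (algebraMap K B) := by
      intro B _ _ b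
      simp only [mU, Polynomial.map_map]
      congr 1
      ext x; simp
    have h0 : (pU %ₘ mU).map (aeval (R := K) y).toRingHom = 0 := by
      rw [Polynomial.map_modByMonic _ hmU, hmap, Polynomial.modByMonic_eq_zero_iff_dvd ((hmm i).map _)]
      exact hd
    have h1 : (pU %ₘ mU).map (aeval (R := K) b).toRingHom = 0 := by
      ext n
      have := congrArg (fun q => Polynomial.coeff q n) h0
      simp only [Polynomial.coeff_map, Polynomial.coeff_zero] at this ⊢
      exact hb _ this
    have hmap' : mU.map (aeval (R := K) b).toRingHom = (m i).map (algebraMap K B) := by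
      simp only [mU, Polynomial.map_map]
      congr 1
      ext x; simp
    rw [Polynomial.map_modByMonic _ hmU, hmap', Polynomial.modByMonic_eq_zero_iff_dvd ((hmm i).map _)] at h1
    obtain ⟨q, hq⟩ := h1
    rw [hq, Polynomial.eval_mul, Polynomial.eval_map_algebraMap, hθ, zero_mul]
  constructor
  · rw [← ev1]
    apply key
    intro θ hθ
    rw [ev1]
    exact (hy i θ hθ).1
  · have : ((bU.comp cU - Polynomial.X).map (aeval (R := K) b).toRingHom).eval θ = 0 := by
      apply key
      intro θ hθ
      rw [Polynomial.map_sub, Polynomial.eval_sub, ev2]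
      simp [(hy i θ hθ).2]
    rw [Polynomial.map_sub, Polynomial.eval_sub, ev2] at this
    simpa [sub_eq_zero] using this
end

section
theorem pac_irr {K : Type*} [Field K] {k : Type*} [Field k] [Algebra K k] [IsAlgClosed k]
    {d : ℕ} (hd : 1 ≤ d) (g : Polynomial K) (hg0 : g ≠ 0) (hgd : g.natDegree ≤ d)
    (m : Polynomial K) (hm : Irreducible m) (hmd : m.natDegree = d)
    (c b : Fin d → K) (h : ∀ θ : k, Polynomial.aeval θ m = 0 →
      Polynomial.aeval (∑ l, algebraMap K k (c l) * θ ^ (l : ℕ)) g = 0 ∧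
      ∑ l, algebraMap K k (b l) * (∑ l, algebraMap K k (c l) * θ ^ (l : ℕ)) ^ (l : ℕ) = θ) :
    Irreducible g := by
  obtain ⟨θ, hθ⟩ := IsAlgClosed.exists_aeval_eq_zero k m (by
    rw [Polynomial.degree_eq_natDegree hm.ne_zero, hmd]; exact_mod_cast (by omega : d ≠ 0))
  obtain ⟨h1, h2⟩ := h θ hθ
  set τ := ∑ l, algebraMap K k (c l) * θ ^ (l : ℕ) with hτ
  have hθi : IsIntegral K θ := IsAlgebraic.isIntegral ⟨m, hm.ne_zero, hθ⟩
  have hτi : IsIntegral K τ := IsAlgebraic.isIntegral ⟨g, hg0, h1⟩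
  have hle : IntermediateField.adjoin K {θ} ≤ IntermediateField.adjoin K {τ} := by
    rw [IntermediateField.adjoin_simple_le_iff]
    rw [← h2]
    refine sum_mem fun l _ => mul_mem (IntermediateField.algebraMap_mem _ _) (pow_mem ?_ _)
    exact IntermediateField.mem_adjoin_simple_self K τ
  have hfd : FiniteDimensional K (IntermediateField.adjoin K {τ}) :=
    IntermediateField.adjoin.finiteDimensional hτi
  have hfr := IntermediateField.finrank_le_of_le_right hle
  rw [IntermediateField.adjoin.finrank hθi, IntermediateField.adjoin.finrank hτi] at hfr
  have hmp : Associated (minpoly K θ) m :=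
    (minpoly.irreducible hθi).associated_of_dvd hm (minpoly.dvd K θ hθ)
  have hmd2 : (minpoly K θ).natDegree = d := by
    rw [← hmd]; exact Polynomial.natDegree_eq_of_degree_eq (Polynomial.degree_eq_degree_of_associated hmp)
  obtain ⟨q, hq⟩ := minpoly.dvd K τ h1
  have hq0 : q ≠ 0 := by rintro rfl; simp at hq; exact hg0 hq
  have hdeg : g.natDegree = (minpoly K τ).natDegree + q.natDegree := by
    rw [hq, Polynomial.natDegree_mul (minpoly.ne_zero hτi) hq0]
  have hqd : q.natDegree = 0 := by omega
  have hqu : IsUnit q := by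
    rw [Polynomial.isUnit_iff_degree_eq_zero, Polynomial.degree_eq_natDegree hq0, hqd]; rfl
  rw [hq]
  exact (irreducible_mul_isUnit hqu).2 (minpoly.irreducible hτi)

theorem pac_inj.{u} {K : Type*} [Field K] {N : Type*} {r : ℕ} {d : Fin r → ℕ}
    (G : Fin r → Polynomial (MvPolynomial (Fin 2) K)) (hGd : ∀ i, (G i).natDegree = d i)
    (w : MvPolynomial (Fin 2) K) (hw : ∀ i, (G i).leadingCoeff ∣ w)
    (m : Fin r → Polynomial K)
    (iA : Fin 2 → N) (iC iB : ∀ i, Fin (d i) → N) (iz : N)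
    (hcov : ∀ n : N, (∃ l, n = iA l) ∨ (∃ i l, n = iC i l) ∨ (∃ i l, n = iB i l) ∨ n = iz)
    {k : Type*} [Field k] [Algebra K k] {Q : Type u} [CommRing Q] [Algebra k Q] [Algebra K Q]
    [IsScalarTower K k Q] {Ω : Type*} [Field Ω] [Algebra k Ω]
    (b : N → Q) (hgen : Algebra.adjoin k (Set.range b) = ⊤)
    (hb : PacCond G m iA iC iB b) (hz : b iz * aeval (b ∘ iA) w = 1)
    (χ : Q →ₐ[k] Ω) (hA : AlgebraicIndependent k (fun l => χ (b (iA l))))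
    (θ : ∀ i, Fin (d i) → k) (hθi : ∀ i, Function.Injective (θ i))
    (hθ : ∀ i j, Polynomial.aeval (θ i j) (m i) = 0)
    (hσ : ∀ π : (∀ i, Equiv.Perm (Fin (d i))), ∃ s : Ω →ₐ[k] Ω,
      (∀ l, s (χ (b (iA l))) = χ (b (iA l))) ∧
      ∀ i j, s (χ (∑ l, b (iC i l) * (algebraMap k Q (θ i j)) ^ (l : ℕ))) =
        χ (∑ l, b (iC i l) * (algebraMap k Q (θ i (π i j))) ^ (l : ℕ))) :
    Function.Injective χ := by
  classical
  set t : ∀ i, Fin (d i) → Q :=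
    fun i j => ∑ l, b (iC i l) * (algebraMap k Q (θ i j)) ^ (l : ℕ) with ht
  have hθQ : ∀ i j, Polynomial.aeval (algebraMap k Q (θ i j)) (m i) = 0 := by
    intro i j
    rw [Polynomial.aeval_algebraMap_apply, hθ, map_zero]
  have hroot : ∀ i j, ((G i).map (aeval (R := K) (b ∘ iA)).toRingHom).eval (t i j) = 0 :=
    fun i j => (hb i _ (hθQ i j)).1
  have hinv : ∀ i j, ∑ l, b (iB i l) * (t i j) ^ (l : ℕ) = algebraMap k Q (θ i j) :=
    fun i j => (hb i _ (hθQ i j)).2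
  have hu : ∀ i j j', j ≠ j' → IsUnit (t i j - t i j') := by
    intro i j j' hjj
    have h1 : IsUnit (algebraMap k Q (θ i j - θ i j')) := by
      apply IsUnit.map
      rw [isUnit_iff_ne_zero, sub_ne_zero]
      exact fun h => hjj (hθi i h)
    refine isUnit_of_dvd_unit (x := t i j - t i j') ?_ h1
    have h2 : t i j - t i j' ∣
        ∑ l, (b (iB i l) * (t i j) ^ (l : ℕ) - b (iB i l) * (t i j') ^ (l : ℕ)) := by
      refine Finset.dvd_sum fun l _ => ?_
      rw [← mul_sub]
      exact Dvd.dvd.mul_left (sub_dvd_pow_sub_pow (t i j) (t i j') (l : ℕ)) _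
    rw [Finset.sum_sub_distrib, hinv, hinv, ← map_sub] at h2
    exact h2
  -- base ring
  let R0 : Subalgebra k Q := Algebra.adjoin k (insert (b iz) (Set.range (b ∘ iA)))
  have hAR : ∀ l, b (iA l) ∈ R0 := fun l => Algebra.subset_adjoin (Or.inr ⟨l, rfl⟩)
  have hzR : b iz ∈ R0 := Algebra.subset_adjoin (Or.inl rfl)
  have hpR : ∀ p : MvPolynomial (Fin 2) K, aeval (b ∘ iA) p ∈ R0 := by
    intro p
    induction p using MvPolynomial.induction_on with
    | C a => 
      rw [aeval_C, IsScalarTower.algebraMap_apply K k Q]; exact R0.algebraMap_mem _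
    | add p q hp hq => rw [map_add]; exact add_mem hp hq
    | mul_X p n hp => rw [map_mul, aeval_X]; exact mul_mem hp (hAR n)
  set W : Q := aeval (b ∘ iA) w with hW
  have hWu : IsUnit W := IsUnit.of_mul_eq_one (b iz) (by rw [mul_comm]; exact hz)
  have hR0 : ∀ q ∈ R0, ∃ n : ℕ, ∃ p : MvPolynomial (Fin 2) k, W ^ n * q = aeval (b ∘ iA) p := by
    have hWp : W = aeval (b ∘ iA) (map (algebraMap K k) w) := by
      rw [hW, aeval_map_algebraMap]
    intro q hq
    induction hq using Algebra.adjoin_induction with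
    | mem x hx =>
      rcases hx with rfl | ⟨l, rfl⟩
      · exact ⟨1, 1, by rw [pow_one, mul_comm, hz, map_one]⟩
      · exact ⟨0, X l, by simp⟩
    | algebraMap a => exact ⟨0, C a, by simp⟩
    | add x y _ _ hx hy =>
      obtain ⟨n, p, h1⟩ := hx
      obtain ⟨n', p', h2⟩ := hy
      refine ⟨n + n', (map (algebraMap K k) w) ^ n' * p + (map (algebraMap K k) w) ^ n * p', ?_⟩
      rw [map_add, map_mul, map_mul, map_pow, map_pow, ← h1, ← h2, ← hWp]; ring
    | mul x y _ _ hx hy =>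
      obtain ⟨n, p, h1⟩ := hx
      obtain ⟨n', p', h2⟩ := hy
      refine ⟨n + n', p * p', ?_⟩
      rw [map_mul, ← h1, ← h2]; ring
  have hχR0 : Function.Injective (χ.toRingHom.comp (algebraMap R0 Q)) := by
    rw [injective_iff_map_eq_zero]
    intro q hq
    obtain ⟨n, p, hp⟩ := hR0 q.1 q.2
    have h1 : χ (aeval (b ∘ iA) p) = 0 := by
      rw [← hp, map_mul]
      have : χ q.1 = 0 := hq
      rw [this, mul_zero]
    rw [← AlgHom.comp_apply, comp_aeval] at h1
    have hp0 : p = 0 := by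
      have hA' := (algebraicIndependent_iff_injective_aeval.1 hA)
      apply hA'
      rw [map_zero]
      exact h1
    rw [hp0, map_zero] at hp
    apply Subtype.ext
    exact ((hWu.pow n).mul_right_eq_zero).1 hp
  -- monic polynomials over R0
  let φ : MvPolynomial (Fin 2) K →+* R0 :=
    (aeval (R := K) (b ∘ iA)).toRingHom.codRestrict R0 hpR
  have hφ : (algebraMap R0 Q).comp φ = (aeval (R := K) (b ∘ iA)).toRingHom := by
    ext x <;> rfl
  have hlc : ∀ i, ∃ v : R0, v * φ (G i).leadingCoeff = 1 := by
    intro i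
    obtain ⟨e, he⟩ := hw i
    refine ⟨⟨b iz, hzR⟩ * φ e, ?_⟩
    apply Subtype.ext
    show (b iz * aeval (b ∘ iA) e) * aeval (b ∘ iA) (G i).leadingCoeff = 1
    rw [← hz, hW, he, map_mul]; ring
  choose v hv using hlc
  let f : Fin r → Polynomial R0 := fun i => Polynomial.C (v i) * (G i).map φ
  have hQ : Nontrivial R0 := by
    by_contra hcon
    rw [not_nontrivial_iff_subsingleton] at hcon
    have : (1 : Ω) = 0 := by
      rw [← map_one χ]
      have : (1 : Q) = 0 := congrArg Subtype.val (Subsingleton.elim (1 : R0) 0)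
      rw [this, map_zero]
    exact one_ne_zero this
  have hfmd : ∀ i, (f i).natDegree ≤ d i ∧ (f i).coeff (d i) = 1 := by
    intro i
    constructor
    · refine (Polynomial.natDegree_C_mul_le _ _).trans ?_
      rw [← hGd]; exact Polynomial.natDegree_map_le
    · simp only [f]
      rw [Polynomial.coeff_C_mul, Polynomial.coeff_map, ← hGd]
      exact hv i
  have hfm : ∀ i, (f i).Monic := fun i =>
    Polynomial.monic_of_natDegree_le_of_coeff_eq_one _ (hfmd i).1 (hfmd i).2
  have hfd : ∀ i, (f i).natDegree = d i := by
    intro i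
    refine le_antisymm (hfmd i).1 (Polynomial.le_natDegree_of_ne_zero ?_)
    rw [(hfmd i).2]; exact one_ne_zero
  have hft : ∀ i j, Polynomial.aeval (t i j) (f i) = 0 := by
    intro i j
    simp only [f]
    rw [map_mul, ← Polynomial.eval_map_algebraMap ((G i).map φ), Polynomial.map_map, hφ, hroot,
      mul_zero]
  choose s hsA hst using hσ
  have hsz : ∀ π, s π (χ (b iz)) = χ (b iz) := by
    intro π
    have hWA : s π (χ W) = χ W := by
      have : W = aeval (b ∘ iA) (map (algebraMap K k) w) := by
        rw [hW, aeval_map_algebraMap]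
      rw [this, ← AlgHom.comp_apply, ← AlgHom.comp_apply, comp_aeval,
        ← AlgHom.comp_apply, comp_aeval]
      congr 2
      funext l
      exact hsA π l
    have h1 : χ (b iz) * χ W = 1 := by rw [← map_mul, hz, map_one]
    have h2 : s π (χ (b iz)) * χ W = 1 := by rw [← hWA, ← map_mul, h1, map_one]
    have hne : χ W ≠ 0 := fun h => by rw [h, mul_zero] at h1; exact zero_ne_one h1
    exact mul_right_cancel₀ hne (h2.trans h1.symm)
  have hsR : ∀ π (q : R0), s π (χ q.1) = χ q.1 := by
    intro π q
    have : Set.EqOn ((s π).comp χ) χ R0 := by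
      apply AlgHom.eqOn_adjoin_iff.2
      rintro x (rfl | ⟨l, rfl⟩)
      · exact hsz π
      · exact hsA π l
    exact this q.2
  let S := Algebra.adjoin R0 (⋃ i, Set.range (t i))
  have hSinj : ∀ q ∈ S, χ q = 0 → q = 0 := by
    intro q hq hq0
    exact span_inj d R0 Q Ω f hfm hfd t hft hu χ.toRingHom hχR0 (fun π => (s π).toRingHom)
      hsR hst q hq hq0
  -- now the full ring
  have htS : ∀ i j, t i j ∈ S := fun i j =>
    Algebra.subset_adjoin (Set.mem_iUnion.2 ⟨i, j, rfl⟩)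
  have hR0S : ∀ q ∈ R0, q ∈ S := fun q hq => S.algebraMap_mem (⟨q, hq⟩ : R0)
  have hkS : ∀ a : k, algebraMap k Q a ∈ S := fun a => hR0S _ (R0.algebraMap_mem a)
  have hcS : ∀ i l, b (iC i l) ∈ S := by
    intro i l
    let Vm := Matrix.vandermonde (θ i)
    have hdet : IsUnit Vm.det := by
      rw [isUnit_iff_ne_zero, Matrix.det_vandermonde_ne_zero_iff]; exact hθi i
    have hmul : (Vm⁻¹.map (algebraMap k Q)).mulVec (t i) = fun l => b (iC i l) := by
      have h1 : t i = (Vm.map (algebraMap k Q)).mulVec (fun l => b (iC i l)) := by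
        funext j
        simp [ht, Matrix.mulVec, dotProduct, Vm, Matrix.vandermonde_apply, mul_comm]
      rw [h1, Matrix.mulVec_mulVec, ← Matrix.map_mul, Matrix.nonsing_inv_mul _ hdet]
      simp
    have : _ = b (iC i l) := congrFun hmul l
    rw [← this]
    rw [Matrix.mulVec, dotProduct]
    exact sum_mem fun j _ => mul_mem (hkS _) (htS i j)
  let V : Fin r → Q := fun i => (Matrix.vandermonde (t i)).det
  have hVS : ∀ i, V i ∈ S := by
    intro i
    simp only [V]
    rw [Matrix.det_vandermonde]
    exact prod_mem fun a _ => prod_mem fun b _ => sub_mem (htS _ _) (htS _ _)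
  have hVu : ∀ i, IsUnit (V i) := by
    intro i
    simp only [V]
    rw [Matrix.det_vandermonde]
    rw [IsUnit.prod_iff]
    intro a _
    rw [IsUnit.prod_iff]
    intro b hb
    exact hu i _ _ (Finset.mem_Ioi.1 hb).ne'
  have hbS : ∀ i l, V i * b (iB i l) ∈ S := by
    intro i l
    let Vm := Matrix.vandermonde (t i)
    have h1 : Vm.mulVec (fun l => b (iB i l)) = fun j => algebraMap k Q (θ i j) := by
      funext j
      rw [← hinv]
      simp [Matrix.mulVec, dotProduct, Vm, Matrix.vandermonde_apply, mul_comm]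
    have h2 : Vm.adjugate.mulVec (fun j => algebraMap k Q (θ i j)) = fun l => V i * b (iB i l) := by
      rw [← h1, Matrix.mulVec_mulVec, Matrix.adjugate_mul]
      funext l
      simp [Matrix.smul_mulVec, V, Vm]
    have : _ = V i * b (iB i l) := congrFun h2 l
    rw [← this]
    rw [Matrix.mulVec, dotProduct]
    refine sum_mem fun j _ => mul_mem ?_ (hkS _)
    rw [Matrix.adjugate_apply, Matrix.det_apply]
    refine sum_mem fun τ _ => ?_
    have : ∀ (u : ℤˣ) (x : Q), x ∈ S → u • x ∈ S := by
      intro u x hx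
      rcases Int.units_eq_one_or u with rfl | rfl
      · simpa using hx
      · simpa using neg_mem hx
    apply this
    refine prod_mem fun a _ => ?_
    rw [Matrix.updateRow_apply]
    split_ifs
    · rw [Pi.single_apply]; split_ifs
      · exact one_mem _
      · exact zero_mem _
    · exact pow_mem (htS _ _) _
  let VV := ∏ i, V i
  have hVVS : VV ∈ S := prod_mem fun i _ => hVS i
  have hVVu : IsUnit VV := by
    simp only [VV]
    rw [IsUnit.prod_iff]; exact fun i _ => hVu i
  have hall : ∀ q : Q, ∃ n : ℕ, VV ^ n * q ∈ S := by
    intro q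
    have hq : q ∈ Algebra.adjoin k (Set.range b) := by rw [hgen]; trivial
    induction hq using Algebra.adjoin_induction with
    | mem x hx =>
      obtain ⟨n, rfl⟩ := hx
      rcases hcov n with ⟨l, rfl⟩ | ⟨i, l, rfl⟩ | ⟨i, l, rfl⟩ | rfl
      · exact ⟨0, by simpa using hR0S _ (hAR l)⟩
      · exact ⟨0, by simpa using hcS i l⟩
      · refine ⟨1, ?_⟩
        have : VV ^ 1 * b (iB i l) = (∏ j ∈ Finset.univ.erase i, V j) * (V i * b (iB i l)) := by
          rw [pow_one, ← mul_assoc, Finset.prod_erase_mul _ _ (Finset.mem_univ i)]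
        rw [this]
        exact mul_mem (prod_mem fun j _ => hVS j) (hbS i l)
      · exact ⟨0, by simpa using hR0S _ hzR⟩
    | algebraMap a => exact ⟨0, by simpa using hkS a⟩
    | add x y _ _ hx hy =>
      obtain ⟨n, h1⟩ := hx
      obtain ⟨n', h2⟩ := hy
      refine ⟨n + n', ?_⟩
      have : VV ^ (n + n') * (x + y) = VV ^ n' * (VV ^ n * x) + VV ^ n * (VV ^ n' * y) := by ring
      rw [this]
      exact add_mem (mul_mem (pow_mem hVVS _) h1) (mul_mem (pow_mem hVVS _) h2)
    | mul x y _ _ hx hy =>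
      obtain ⟨n, h1⟩ := hx
      obtain ⟨n', h2⟩ := hy
      refine ⟨n + n', ?_⟩
      have : VV ^ (n + n') * (x * y) = (VV ^ n * x) * (VV ^ n' * y) := by ring
      rw [this]
      exact mul_mem h1 h2
  rw [injective_iff_map_eq_zero]
  intro q hq
  obtain ⟨n, hn⟩ := hall q
  have := hSinj _ hn (by rw [map_mul, hq, mul_zero])
  exact ((hVVu.pow n).mul_right_eq_zero).1 this
end

section
theorem exists_root_enum {K k : Type*} [Field K] [Field k] [IsAlgClosed k] [Algebra K k]
    (m : Polynomial K) (hms : m.Separable) {d : ℕ} (hmd : m.natDegree = d) :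
    ∃ θ : Fin d → k, Function.Injective θ ∧ (∀ j, Polynomial.aeval (θ j) m = 0) ∧
      ∀ x : k, Polynomial.aeval x m = 0 → ∃ j, θ j = x := by
  classical
  have hsep : (m.map (algebraMap K k)).Separable := hms.map
  let s := (m.map (algebraMap K k)).roots.toFinset
  have hs : s.card = d := by
    rw [Multiset.toFinset_card_of_nodup (Polynomial.nodup_roots hsep),
      ← (IsAlgClosed.splits (m.map (algebraMap K k))).natDegree_eq_card_roots,
      Polynomial.natDegree_map, hmd]
  let e := s.equivFinOfCardEq hs
  have hmem : ∀ x, x ∈ s ↔ Polynomial.aeval x m = 0 := by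
    intro x
    rw [Multiset.mem_toFinset, Polynomial.mem_roots hsep.ne_zero, Polynomial.IsRoot.def,
      Polynomial.eval_map_algebraMap]
  refine ⟨fun j => (e.symm j : k), ?_, ?_, ?_⟩
  · intro a b hab
    exact e.symm.injective (Subtype.ext hab)
  · intro j
    exact (hmem _).1 (e.symm j).2
  · intro x hx
    exact ⟨e ⟨x, (hmem x).2 hx⟩, by simp⟩

theorem interp {Ω : Type*} [Field Ω] {d : ℕ} (x y : Fin d → Ω) (hx : Function.Injective x) :
    ∃ c : Fin d → Ω, ∀ j, ∑ l, c l * x j ^ (l : ℕ) = y j := by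
  let M := Matrix.vandermonde x
  have hdet : IsUnit M.det := by
    rw [isUnit_iff_ne_zero, Matrix.det_vandermonde_ne_zero_iff]; exact hx
  refine ⟨M⁻¹.mulVec y, fun j => ?_⟩
  have h1 : M.mulVec (M⁻¹.mulVec y) = y := by
    rw [Matrix.mulVec_mulVec, Matrix.mul_nonsing_inv _ hdet, Matrix.one_mulVec]
  have h2 := congrFun h1 j
  rw [← h2]
  conv_rhs => rw [Matrix.mulVec, dotProduct]
  refine Finset.sum_congr rfl fun l _ => ?_
  simp only [M, Matrix.vandermonde_apply]
  rw [mul_comm]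

theorem pac_step.{u} (K : Type u) [Field K] (hPAC : IsPAC K) {r : ℕ} {d : Fin r → ℕ}
    (hd : ∀ i, 1 ≤ d i)
    (G : Fin r → Polynomial (MvPolynomial (Fin 2) K)) (hGd : ∀ i, (G i).natDegree = d i)
    (m : Fin r → Polynomial K) (hmm : ∀ i, (m i).Monic) (hms : ∀ i, (m i).Separable)
    (hmi : ∀ i, Irreducible (m i)) (hmd : ∀ i, (m i).natDegree = d i)
    (h : MvPolynomial (Fin 2) K) (hh : h ≠ 0)
    (Ω : Type u) [Field Ω] [IsAlgClosed Ω] [Algebra (AlgebraicClosure K) Ω] [Algebra K Ω]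
    [IsScalarTower K (AlgebraicClosure K) Ω] (A : Fin 2 → Ω)
    (hA : AlgebraicIndependent (AlgebraicClosure K) A)
    (t : ∀ i, Fin (d i) → Ω) (hti : ∀ i, Function.Injective (t i))
    (htr : ∀ i j, ((G i).map (aeval (R := K) A).toRingHom).eval (t i j) = 0)
    (hσ : ∀ π : (∀ i, Equiv.Perm (Fin (d i))), ∃ s : Ω →ₐ[AlgebraicClosure K] Ω,
      (∀ l, s (A l) = A l) ∧ ∀ i j, s (t i j) = t i (π i j)) :
    ∃ a : Fin 2 → K, eval a h ≠ 0 ∧ ∀ i, Irreducible ((G i).map (eval a)) := by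
  classical
  let k := AlgebraicClosure K
  have hG0 : ∀ i, G i ≠ 0 := by
    intro i h0
    have := hGd i
    rw [h0, Polynomial.natDegree_zero] at this
    have := hd i
    omega
  choose θ hθi hθr hθs using fun i => exists_root_enum (k := k) (m i) (hms i) (hmd i)
  let V := Fin 2 ⊕ (Σ i, Fin (d i)) ⊕ (Σ i, Fin (d i)) ⊕ Unit
  let n := Fintype.card V
  let e : V ≃ Fin n := Fintype.equivFin V
  let iA : Fin 2 → Fin n := fun l => e (Sum.inl l)
  let iC : ∀ i, Fin (d i) → Fin n := fun i l => e (Sum.inr (Sum.inl ⟨i, l⟩))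
  let iB : ∀ i, Fin (d i) → Fin n := fun i l => e (Sum.inr (Sum.inr (Sum.inl ⟨i, l⟩)))
  let iz : Fin n := e (Sum.inr (Sum.inr (Sum.inr ())))
  have hcov : ∀ n, (∃ l, n = iA l) ∨ (∃ i l, n = iC i l) ∨ (∃ i l, n = iB i l) ∨ n = iz := by
    intro v
    obtain ⟨v, rfl⟩ := e.surjective v
    rcases v with l | ⟨i, l⟩ | ⟨i, l⟩ | _
    · exact Or.inl ⟨l, rfl⟩
    · exact Or.inr (Or.inl ⟨i, l, rfl⟩)
    · exact Or.inr (Or.inr (Or.inl ⟨i, l, rfl⟩))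
    · exact Or.inr (Or.inr (Or.inr rfl))
  let w : MvPolynomial (Fin 2) K := h * ∏ i, (G i).leadingCoeff
  have hw0 : w ≠ 0 := mul_ne_zero hh (Finset.prod_ne_zero_iff.2 fun i _ =>
    Polynomial.leadingCoeff_ne_zero.2 (hG0 i))
  have hwG : ∀ i, (G i).leadingCoeff ∣ w := fun i =>
    Dvd.dvd.mul_left (Finset.dvd_prod_of_mem _ (Finset.mem_univ i)) _
  have hθΩ : ∀ i, Function.Injective (fun j => algebraMap k Ω (θ i j)) := fun i =>
    (algebraMap k Ω).injective.comp (hθi i)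
  choose c hc using fun i => interp (fun j => algebraMap k Ω (θ i j)) (t i) (hθΩ i)
  choose b hb using fun i => interp (t i) (fun j => algebraMap k Ω (θ i j)) (hti i)
  let y0 : V → Ω := Sum.elim A (Sum.elim (fun x => c x.1 x.2)
    (Sum.elim (fun x => b x.1 x.2) (fun _ => (aeval A w)⁻¹)))
  let y : Fin n → Ω := y0 ∘ e.symm
  have hyA : ∀ l, y (iA l) = A l := by intro l; simp [y, iA, y0]
  have hyA' : y ∘ iA = A := funext hyA
  have hyC : ∀ i l, y (iC i l) = c i l := by intro i l; simp [y, iC, y0]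
  have hyB : ∀ i l, y (iB i l) = b i l := by intro i l; simp [y, iB, y0]
  have hyz : y iz = (aeval A w)⁻¹ := by simp [y, iz, y0]
  have hAw : aeval A w ≠ 0 := by
    have hA' := algebraicIndependent_iff_injective_aeval.1 hA
    intro h0
    apply hw0
    have h1 : aeval A (map (algebraMap K k) w) = 0 := by
      rw [aeval_map_algebraMap]; exact h0
    have h2 := hA' (h1.trans (map_zero _).symm)
    exact MvPolynomial.map_injective _ (algebraMap K k).injective (h2.trans (map_zero _).symm)
  have hycond : PacCond G m iA iC iB y := by
    intro i x hx
    have : ∃ j, algebraMap k Ω (θ i j) = x := by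
      have hdv := dvd_of_roots_sep (m i) (hms i) (∏ j, (Polynomial.X - Polynomial.C (θ i j))) (by
        intro z hz
        obtain ⟨j, rfl⟩ := hθs i z hz
        rw [Polynomial.eval_prod]
        exact Finset.prod_eq_zero (Finset.mem_univ j) (by simp))
      obtain ⟨q, hq⟩ := hdv
      have h1 : ((∏ j, (Polynomial.X - Polynomial.C (θ i j))).map (algebraMap k Ω)).eval x = 0 := by
        rw [hq, Polynomial.map_mul, Polynomial.eval_mul, Polynomial.map_map,
          ← IsScalarTower.algebraMap_eq, Polynomial.eval_map_algebraMap, hx, zero_mul]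
      rw [Polynomial.map_prod, Polynomial.eval_prod, Finset.prod_eq_zero_iff] at h1
      obtain ⟨j, _, hj⟩ := h1
      refine ⟨j, ?_⟩
      simp only [Polynomial.map_sub, Polynomial.map_X, Polynomial.map_C, Polynomial.eval_sub,
        Polynomial.eval_X, Polynomial.eval_C] at hj
      exact (sub_eq_zero.1 hj).symm
    obtain ⟨j, rfl⟩ := this
    simp only [hyC, hyB, hc, hb, hyA']
    exact ⟨htr i j, trivial⟩
  let P : Ideal (MvPolynomial (Fin n) K) := RingHom.ker (aeval (R := K) y)
  have hP : P.IsPrime := RingHom.ker_isPrime _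
  let mp : MvPolynomial (Fin n) K →+* MvPolynomial (Fin n) k := map (algebraMap K k)
  let I : Ideal (MvPolynomial (Fin n) k) := Ideal.map mp P
  let Q := MvPolynomial (Fin n) k ⧸ I
  let bq : Fin n → Q := fun v => Ideal.Quotient.mk I (X v)
  have hI : ∀ p ∈ I, aeval (R := k) y p = 0 := by
    have : I ≤ RingHom.ker (aeval (R := k) y) := by
      rw [Ideal.map_le_iff_le_comap]
      intro p hp
      rw [Ideal.mem_comap, RingHom.mem_ker]
      show aeval y (map (algebraMap K k) p) = 0
      rw [aeval_map_algebraMap]; exact hp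
    exact fun p hp => this hp
  let χ : Q →ₐ[k] Ω := Ideal.Quotient.liftₐ I (aeval (R := k) y) hI
  have hχb : ∀ v, χ (bq v) = y v := by
    intro v
    show aeval (R := k) y (X v) = y v
    simp
  have hker : ∀ p : MvPolynomial (Fin n) K, aeval y p = 0 → aeval bq p = 0 := by
    intro p hp
    have h1 : aeval bq p = Ideal.Quotient.mkₐ k I (mp p) := by
      have : aeval (R := k) bq = Ideal.Quotient.mkₐ k I := by
        ext v; rw [aeval_X]; rfl
      rw [← this]
      show _ = aeval bq (map (algebraMap K k) p)
      rw [aeval_map_algebraMap]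
    rw [h1]
    exact Ideal.Quotient.eq_zero_iff_mem.2 (Ideal.mem_map_of_mem mp hp)
  have hbqcond : PacCond G m iA iC iB bq :=
    pac_transfer G m hmm hms iA iC iB y hycond bq hker
  let zrel : MvPolynomial (Fin n) K := X iz * rename iA w - 1
  have hzrel : aeval y zrel = 0 := by
    simp only [zrel, map_sub, map_mul, aeval_X, aeval_rename, map_one, hyA', hyz]
    rw [inv_mul_cancel₀ hAw, sub_self]
  have hz : bq iz * aeval (bq ∘ iA) w = 1 := by
    have := hker zrel hzrel
    simp only [zrel, map_sub, map_mul, aeval_X, aeval_rename, map_one] at this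
    exact sub_eq_zero.1 this
  have hgen : Algebra.adjoin k (Set.range bq) = ⊤ := by
    rw [eq_top_iff]
    rintro q -
    obtain ⟨p, rfl⟩ := Ideal.Quotient.mk_surjective q
    rw [Algebra.adjoin_range_eq_range_aeval]
    refine ⟨p, ?_⟩
    have : aeval (R := k) bq = Ideal.Quotient.mkₐ k I := by
      ext v; rw [aeval_X]; rfl
    show aeval (R := k) bq p = _
    rw [this]; rfl
  have hinj : Function.Injective χ := by
    refine pac_inj G hGd w hwG m iA iC iB iz hcov bq hgen hbqcond hz χ ?_ θ hθi hθr ?_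
    · simpa only [hχb, hyA] using hA
    · intro π
      obtain ⟨s, hs1, hs2⟩ := hσ π
      have hχt : ∀ i j, χ (∑ l, bq (iC i l) * (algebraMap k Q (θ i j)) ^ (l : ℕ)) = t i j := by
        intro i j
        rw [map_sum, ← hc i j]
        refine Finset.sum_congr rfl fun l _ => ?_
        rw [map_mul, map_pow, hχb, hyC, AlgHom.commutes]
      refine ⟨s, ?_, ?_⟩
      · intro l; rw [hχb, hyA, hs1]
      · intro i j; rw [hχt, hχt, hs2]
  have hIprime : I.IsPrime := by
    have : I = RingHom.ker (aeval (R := k) y) := by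
      apply le_antisymm
      · exact fun p hp => hI p hp
      · intro p hp
        have h1 : χ (Ideal.Quotient.mk I p) = 0 := hp
        exact Ideal.Quotient.eq_zero_iff_mem.1 (hinj (h1.trans (map_zero χ).symm))
    rw [this]
    exact RingHom.ker_isPrime _
  obtain ⟨a, ha⟩ := hPAC n P hP hIprime
  have hacond : PacCond G m iA iC iB (fun v => algebraMap K k (a v)) := by
    refine pac_transfer G m hmm hms iA iC iB y hycond _ ?_
    intro p hp
    have h1 := ha p hp
    have : aeval (fun v => algebraMap K k (a v)) p = algebraMap K k (eval a p) := by
      have h2 := MvPolynomial.aeval_algebraMap_apply (R := K) (A := K) k a p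
      rw [← MvPolynomial.coe_aeval_eq_eval]
      exact h2
    rw [this, h1, map_zero]
  have haz : a iz * eval (a ∘ iA) w = 1 := by
    have := ha zrel hzrel
    simp only [zrel, map_sub, map_mul, eval_X, eval_rename, map_one] at this
    exact sub_eq_zero.1 this
  have hwa : eval (a ∘ iA) w ≠ 0 := fun h0 => by rw [h0, mul_zero] at haz; exact zero_ne_one haz
  refine ⟨a ∘ iA, ?_, ?_⟩
  · intro h0
    apply hwa
    simp only [w, map_mul, h0, zero_mul]
  · intro i
    have hlc : eval (a ∘ iA) (G i).leadingCoeff ≠ 0 := by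
      intro h0
      obtain ⟨q, hq⟩ := hwG i
      apply hwa
      rw [hq, map_mul, h0, zero_mul]
    refine pac_irr (k := k) (hd i) _ ?_ ?_ (m i) (hmi i) (hmd i) (fun l => a (iC i l))
      (fun l => a (iB i l)) ?_
    · intro h0
      apply hlc
      have := congrArg (fun p => Polynomial.coeff p (G i).natDegree) h0
      simpa [Polynomial.coeff_map] using this
    · rw [← hGd i]; exact Polynomial.natDegree_map_le
    · intro x hx
      obtain ⟨h1, h2⟩ := hacond i x hx
      refine ⟨?_, h2⟩
      rw [← Polynomial.eval_map_algebraMap, Polynomial.map_map]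
      have hcomp : (algebraMap K k).comp (eval (a ∘ iA)) =
          (aeval (R := K) ((fun v => algebraMap K k (a v)) ∘ iA)).toRingHom := by
        apply MvPolynomial.ringHom_ext
        · intro x; simp
        · intro x; simp
      rw [hcomp]
      exact h1
end

section
theorem lineSub_map {R S : Type*} [CommRing R] [CommRing S] (φ : R →+* S)
    (f : MvPolynomial (Fin 2) R) (a b : R) :
    (lineSub f a b).map φ = lineSub (map φ f) (φ a) (φ b) := by
  unfold lineSub
  induction f using MvPolynomial.induction_on with
  | C a => simp [Polynomial.algebraMap_eq]
  | add p q hp hq => simp only [map_add, Polynomial.map_add, hp, hq]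
  | mul_X p n hp =>
    rw [map_mul, Polynomial.map_mul, hp, map_mul, map_mul]
    congr 1
    fin_cases n <;> simp

theorem lineSub_eval {R : Type*} [CommRing R] (f : MvPolynomial (Fin 2) R) (a b τ : R) :
    (lineSub f a b).eval τ = eval ![τ, a * τ + b] f := by
  unfold lineSub
  induction f using MvPolynomial.induction_on with
  | C a => simp [Polynomial.algebraMap_eq]
  | add p q hp hq => simp only [map_add, Polynomial.eval_add, hp, hq]
  | mul_X p n hp =>
    rw [map_mul, Polynomial.eval_mul, hp, map_mul]
    congr 1
    fin_cases n <;> simp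

theorem lineSub_derivative {R : Type*} [CommRing R] (f : MvPolynomial (Fin 2) R) (a b : R) :
    (lineSub f a b).derivative =
      lineSub (pderiv 0 f) a b + Polynomial.C a * lineSub (pderiv 1 f) a b := by
  unfold lineSub
  induction f using MvPolynomial.induction_on with
  | C a => simp [Polynomial.algebraMap_eq]
  | add p q hp hq => simp only [map_add, hp, hq]; ring
  | mul_X p n hp =>
    rw [map_mul, Polynomial.derivative_mul, hp]
    fin_cases n
    · simp [pderiv_X]; ring
    · simp [pderiv_X]; ring

/-- The polynomial `∑ j, f_{d-j,j} Y^j`, the top homogeneous part of `f` at `(1, Y)`. -/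
noncomputable def topPoly {R : Type*} [CommRing R] (f : MvPolynomial (Fin 2) R) (d : ℕ) :
    Polynomial R :=
  ∑ j ∈ Finset.range (d + 1),
    Polynomial.monomial j (coeff (Finsupp.single 0 (d - j) + Finsupp.single 1 j) f)

theorem topPoly_ne_zero {R : Type*} [CommRing R] (f : MvPolynomial (Fin 2) R) (d : ℕ)
    (hf : f ≠ 0) (hd : f.totalDegree = d) : topPoly f d ≠ 0 := by
  intro h0
  have hne : f.support.Nonempty := by
    rw [Finset.nonempty_iff_ne_empty]
    intro h
    exact hf (support_eq_empty.1 h)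
  obtain ⟨m, hm, hmd⟩ := Finset.exists_mem_eq_sup f.support hne (fun s => s.sum fun _ e => e)
  have hmd' : m 0 + m 1 = d := by
    have h1 : f.totalDegree = m.sum fun _ e => e := hmd
    rw [Finsupp.sum_fintype _ _ (by simp), Fin.sum_univ_two] at h1
    omega
  have h2 : (topPoly f d).coeff (m 1) = coeff m f := by
    unfold topPoly
    rw [Polynomial.finsetSum_coeff]
    rw [Finset.sum_eq_single (m 1)]
    · rw [Polynomial.coeff_monomial, if_pos rfl]
      congr 1
      ext i
      fin_cases i
      · simp; omega
      · simp
    · intro j _ hj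
      rw [Polynomial.coeff_monomial, if_neg hj]
    · intro hn
      exfalso; apply hn
      rw [Finset.mem_range]; omega
  rw [h0, Polynomial.coeff_zero] at h2
  exact (mem_support_iff.1 hm) h2.symm

theorem coeff_top_aux {R : Type*} [CommRing R] (a b : R) (j : ℕ) :
    ((Polynomial.C a * Polynomial.X + Polynomial.C b) ^ j).natDegree ≤ j ∧
    ((Polynomial.C a * Polynomial.X + Polynomial.C b) ^ j).coeff j = a ^ j := by
  have h1 : (Polynomial.C a * Polynomial.X + Polynomial.C b).natDegree ≤ 1 :=
    Polynomial.natDegree_linear_le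
  constructor
  · simpa using Polynomial.natDegree_pow_le_of_le j h1
  · have := Polynomial.coeff_pow_of_natDegree_le (m := j) h1
    rw [mul_one] at this
    rw [this]; simp

theorem lineSub_natDegree_le {R : Type*} [CommRing R] (f : MvPolynomial (Fin 2) R) (a b : R)
    (d : ℕ) (hd : f.totalDegree ≤ d) : (lineSub f a b).natDegree ≤ d := by
  unfold lineSub
  rw [aeval_def, eval₂_eq']
  refine Polynomial.natDegree_sum_le_of_forall_le _ _ fun m hm => ?_
  rw [Polynomial.algebraMap_eq]
  refine (Polynomial.natDegree_C_mul_le _ _).trans ?_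
  rw [Fin.prod_univ_two]
  have h1 : m 0 + m 1 ≤ d := by
    have := (le_totalDegree hm).trans hd
    rwa [Finsupp.sum_fintype _ _ (by simp), Fin.sum_univ_two] at this
  refine Polynomial.natDegree_mul_le.trans (le_trans ?_ h1)
  refine add_le_add ?_ ?_
  · simpa using Polynomial.natDegree_X_pow_le (R := R) (m 0)
  · simpa using (coeff_top_aux a b (m 1)).1

theorem lineSub_coeff {R : Type*} [CommRing R] (f : MvPolynomial (Fin 2) R) (a b : R)
    (d : ℕ) (hd : f.totalDegree ≤ d) : (lineSub f a b).coeff d = (topPoly f d).eval a := by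
  classical
  unfold lineSub
  rw [aeval_def, eval₂_eq', Polynomial.finsetSum_coeff, topPoly, Polynomial.eval_finsetSum]
  have h1 : ∀ m ∈ f.support, (((algebraMap R (Polynomial R)) (coeff m f)) *
      ∏ i, (![Polynomial.X, Polynomial.C a * Polynomial.X + Polynomial.C b] i) ^ (m i)).coeff d =
      if m 0 + m 1 = d then coeff m f * a ^ (m 1) else 0 := by
    intro m hm
    have h1 : m 0 + m 1 ≤ d := by
      have := (le_totalDegree hm).trans hd
      rwa [Finsupp.sum_fintype _ _ (by simp), Fin.sum_univ_two] at this
    rw [Polynomial.algebraMap_eq, Polynomial.coeff_C_mul, Fin.prod_univ_two]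
    simp only [Matrix.cons_val_zero, Matrix.cons_val_one]
    have h2 := (coeff_top_aux a b (m 1))
    rw [Polynomial.coeff_X_pow_mul']
    rw [if_pos (by omega)]
    split_ifs with h
    · have : d - m 0 = m 1 := by omega
      rw [this, h2.2]
    · rw [Polynomial.coeff_eq_zero_of_natDegree_lt, mul_zero]
      have := h2.1
      omega
  rw [Finset.sum_congr rfl h1, ← Finset.sum_filter]
  simp only [Polynomial.eval_monomial]
  symm
  rw [← Finset.sum_filter_of_ne (p := fun j =>
    coeff (Finsupp.single 0 (d - j) + Finsupp.single 1 j) f ≠ 0)]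
  swap
  · intro j _ h hc
    exact h (by rw [hc, zero_mul])
  refine Finset.sum_bij (fun j _ => Finsupp.single 0 (d - j) + Finsupp.single 1 j) ?_ ?_ ?_ ?_
  · intro j hj
    rw [Finset.mem_filter, Finset.mem_range] at hj
    rw [Finset.mem_filter, mem_support_iff]
    refine ⟨hj.2, ?_⟩
    simp; omega
  · intro j _ j' _ h
    have := DFunLike.congr_fun h 1
    simpa using this
  · intro m hm
    rw [Finset.mem_filter, mem_support_iff] at hm
    have he : (Finsupp.single 0 (d - m 1) + Finsupp.single 1 (m 1) : Fin 2 →₀ ℕ) = m := by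
      ext i
      fin_cases i
      · simp; omega
      · simp
    refine ⟨m 1, ?_, he⟩
    rw [Finset.mem_filter, Finset.mem_range, he]
    exact ⟨by omega, hm.1⟩
  · intro j _
    simp

theorem topPoly_map {R S : Type*} [CommRing R] [CommRing S] (φ : R →+* S)
    (f : MvPolynomial (Fin 2) R) (d : ℕ) : topPoly (map φ f) d = (topPoly f d).map φ := by
  simp [topPoly, Polynomial.map_sum, coeff_map]

theorem lineSub_natDegree {K B : Type*} [Field K] [CommRing B] [Algebra K B]
    (f : MvPolynomial (Fin 2) K) (hf : f ≠ 0) {d : ℕ} (hd : f.totalDegree = d) (a b : B)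
    (ha : Transcendental K a) :
    (lineSub (map (algebraMap K B) f) a b).natDegree = d := by
  have h1 : (map (algebraMap K B) f).totalDegree ≤ d := hd ▸ Finset.sup_mono (support_map_subset _ _)
  refine le_antisymm (lineSub_natDegree_le _ _ _ _ h1) (Polynomial.le_natDegree_of_ne_zero ?_)
  rw [lineSub_coeff _ _ _ _ h1, topPoly_map, Polynomial.eval_map_algebraMap]
  intro h0
  exact topPoly_ne_zero f d hf hd ((transcendental_iff.1 ha) _ h0)
end

section
theorem hom_coeff_top {k B σ : Type*} [Fintype σ] [CommRing k] [CommRing B] [Algebra k B]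
    (G : MvPolynomial σ k) {e : ℕ} (hG : G.IsHomogeneous e) (w : σ → Polynomial B)
    (hw : ∀ i, (w i).natDegree ≤ 1) :
    (aeval w G).natDegree ≤ e ∧ (aeval w G).coeff e = aeval (fun i => (w i).coeff 1) G := by
  have key : ∀ m : σ →₀ ℕ, ∀ s : Finset σ,
      (∏ i ∈ s, w i ^ m i).natDegree ≤ ∑ i ∈ s, m i ∧
      (∏ i ∈ s, w i ^ m i).coeff (∑ i ∈ s, m i) = ∏ i ∈ s, (w i).coeff 1 ^ m i := by
    classical
    intro m s
    induction s using Finset.induction_on with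
    | empty => simp
    | insert a s ha ih =>
      rw [Finset.prod_insert ha, Finset.prod_insert ha, Finset.sum_insert ha]
      have h1 : (w a ^ m a).natDegree ≤ m a := by
        simpa using Polynomial.natDegree_pow_le_of_le (m a) (hw a)
      have h2 : (w a ^ m a).coeff (m a) = (w a).coeff 1 ^ m a := by
        have := Polynomial.coeff_pow_of_natDegree_le (m := m a) (hw a)
        rwa [mul_one] at this
      refine ⟨Polynomial.natDegree_mul_le_of_le h1 ih.1, ?_⟩
      rw [Polynomial.coeff_mul_add_eq_of_natDegree_le h1 ih.1, h2, ih.2]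
  have hm : ∀ m ∈ G.support, ∑ i, m i = e := by
    intro m hm
    have := hG (mem_support_iff.1 hm)
    rw [← this, Finsupp.weight_apply, Finsupp.sum_fintype _ _ (by simp)]
    simp
  rw [aeval_def, eval₂_eq', aeval_def, eval₂_eq']
  constructor
  · refine Polynomial.natDegree_sum_le_of_forall_le _ _ fun m h => ?_
    rw [IsScalarTower.algebraMap_apply k B (Polynomial B), Polynomial.algebraMap_eq]
    refine (Polynomial.natDegree_C_mul_le _ _).trans ?_
    exact (key m Finset.univ).1.trans (hm m h).le
  · rw [Polynomial.finsetSum_coeff]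
    refine Finset.sum_congr rfl fun m h => ?_
    rw [IsScalarTower.algebraMap_apply k B (Polynomial B), Polynomial.algebraMap_eq,
      Polynomial.coeff_C_mul]
    have := (key m Finset.univ).2
    rw [hm m h] at this
    rw [this]

section PP
variable {k : Type*} [Field k] (α : k)

/-- `G(s, t + α X, X)` as a polynomial in `X`. -/
noncomputable def PP (G : MvPolynomial (Fin 3) k) {B : Type*} [CommRing B] [Algebra k B]
    (s t : B) : Polynomial B :=
  aeval ![Polynomial.C s, Polynomial.C t + Polynomial.C (algebraMap k B α) * Polynomial.X,
    Polynomial.X] G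

theorem PP_eval (G : MvPolynomial (Fin 3) k) {B : Type*} [CommRing B] [Algebra k B] (s t ξ : B) :
    (PP α G s t).eval ξ = aeval ![s, t + algebraMap k B α * ξ, ξ] G := by
  unfold PP
  rw [← Polynomial.coe_evalRingHom, aeval_def, hom_eval₂, aeval_def]
  congr 1
  · ext x; simp [IsScalarTower.algebraMap_apply k B (Polynomial B)]
  · ext i; fin_cases i <;> simp

theorem PP_map (G : MvPolynomial (Fin 3) k) {B B' : Type*} [CommRing B] [Algebra k B]
    [CommRing B'] [Algebra k B'] (φ : B →ₐ[k] B') (s t : B) :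
    (PP α G s t).map (φ : B →+* B') = PP α G (φ s) (φ t) := by
  unfold PP
  rw [← Polynomial.coe_mapRingHom, aeval_def, hom_eval₂, aeval_def]
  congr 1
  · ext x
    simp [IsScalarTower.algebraMap_apply k B (Polynomial B),
      IsScalarTower.algebraMap_apply k B' (Polynomial B')]
  · ext i; fin_cases i <;> simp

theorem PP_coeff (G : MvPolynomial (Fin 3) k) {e : ℕ} (hG : G.IsHomogeneous e)
    {B : Type*} [CommRing B] [Algebra k B] (s t : B) :
    (PP α G s t).natDegree ≤ e ∧
      (PP α G s t).coeff e = algebraMap k B (eval ![0, α, 1] G) := by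
  have h := hom_coeff_top (B := B) G hG ![Polynomial.C s, Polynomial.C t +
    Polynomial.C (algebraMap k B α) * Polynomial.X, Polynomial.X] (by
      intro i
      fin_cases i
      · simp
      · simp only [Fin.mk_one, Matrix.cons_val_one, Matrix.cons_val_zero]
        rw [add_comm]
        exact Polynomial.natDegree_linear_le
      · simpa using Polynomial.natDegree_X_le)
  refine ⟨h.1, ?_⟩
  unfold PP
  have h3 := aeval_algebraMap_apply (R := k) (A := k) B ![0, α, 1] G
  rw [aeval_eq_eval] at h3
  refine h.2.trans (Eq.trans ?_ h3)
  congr 2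
  ext i
  fin_cases i <;> simp [Polynomial.coeff_C]

/-- The resultant of `F(s, t + α X, X)` and `G(s, t + α X, X)` with respect to `X`. -/
noncomputable def RR (F G : MvPolynomial (Fin 3) k) (d e : ℕ) {B : Type*} [CommRing B]
    [Algebra k B] (s t : B) : B :=
  Polynomial.resultant (PP α F s t) (PP α G s t) d e

theorem RR_map (F G : MvPolynomial (Fin 3) k) (d e : ℕ) {B B' : Type*} [CommRing B] [Algebra k B]
    [CommRing B'] [Algebra k B'] (φ : B →ₐ[k] B') (s t : B) :
    φ (RR α F G d e s t) = RR α F G d e (φ s) (φ t) := by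
  unfold RR
  rw [← PP_map, ← PP_map, Polynomial.resultant_map_map]
  rfl

theorem PP_natDegree (F : MvPolynomial (Fin 3) k) {d : ℕ} (hF : F.IsHomogeneous d)
    (hu : eval ![0, α, 1] F ≠ 0) {B : Type*} [Field B] [Algebra k B] (s t : B) :
    (PP α F s t).natDegree = d ∧ (PP α F s t).leadingCoeff = algebraMap k B (eval ![0, α, 1] F) := by
  have h := PP_coeff α F hF s t
  have h1 : (PP α F s t).natDegree = d := by
    refine le_antisymm h.1 (Polynomial.le_natDegree_of_ne_zero ?_)
    rw [h.2]
    simpa using hu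
  refine ⟨h1, ?_⟩
  rw [Polynomial.leadingCoeff, h1, h.2]

theorem RR_eq_prod (F G : MvPolynomial (Fin 3) k) {d e : ℕ} (hF : F.IsHomogeneous d)
    (hG : G.IsHomogeneous e) (hu : eval ![0, α, 1] F ≠ 0) {B : Type*} [Field B] [Algebra k B]
    (s t : B) (hs : (PP α F s t).Splits) :
    RR α F G d e s t = algebraMap k B (eval ![0, α, 1] F) ^ e *
      ((PP α F s t).roots.map fun ξ => aeval ![s, t + algebraMap k B α * ξ, ξ] G).prod := by
  have h := PP_natDegree α F hF hu s t
  unfold RR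
  rw [← h.2]
  conv_lhs => rw [← h.1]
  rw [Polynomial.resultant_eq_prod_eval _ _ _ (PP_coeff α G hG s t).1 hs]
  congr 3
  ext ξ
  rw [PP_eval]

theorem hom_scale {k B : Type*} [CommRing k] [CommRing B] [Algebra k B]
    (G : MvPolynomial (Fin 3) k) {e : ℕ} (hG : G.IsHomogeneous e) (l a b c : B) :
    aeval ![l * a, l * b, l * c] G = l ^ e * aeval ![a, b, c] G := by
  have hm : ∀ m ∈ G.support, ∑ i, m i = e := by
    intro m hm
    have := hG (mem_support_iff.1 hm)
    rw [← this, Finsupp.weight_apply, Finsupp.sum_fintype _ _ (by simp)]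
    simp
  rw [aeval_def, eval₂_eq', aeval_def, eval₂_eq', Finset.mul_sum]
  refine Finset.sum_congr rfl fun m h => ?_
  rw [← hm m h]
  simp only [Fin.prod_univ_three, Fin.sum_univ_three]
  simp
  ring

theorem RR_scale (F G : MvPolynomial (Fin 3) k) {d e : ℕ} (hF : F.IsHomogeneous d)
    (hG : G.IsHomogeneous e) (hu : eval ![0, α, 1] F ≠ 0) {B : Type*} [Field B] [IsAlgClosed B]
    [Algebra k B] (s t l : B) (hl : l ≠ 0) :
    RR α F G d e (l * s) (l * t) = l ^ (d * e) * RR α F G d e s t := by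
  have h1 : PP α F (l * s) (l * t) = (PP α F s t).scaleRoots l := by
    apply Polynomial.funext
    intro ξ
    obtain ⟨η, rfl⟩ : ∃ η, ξ = l * η := ⟨l⁻¹ * ξ, by field_simp⟩
    rw [Polynomial.scaleRoots_eval_mul, PP_eval, PP_eval, (PP_natDegree α F hF hu s t).1,
      ← hom_scale F hF]
    congr 3
    ring_nf
  rw [RR_eq_prod α F G hF hG hu _ _ (IsAlgClosed.splits _),
    RR_eq_prod α F G hF hG hu _ _ (IsAlgClosed.splits _), h1,
    Polynomial.roots_scaleRoots _ (isUnit_iff_ne_zero.2 hl), Multiset.map_map]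
  have h2 : ∀ ξ : B, aeval ![l * s, l * t + algebraMap k B α * (l * ξ), l * ξ] G =
      l ^ e * aeval ![s, t + algebraMap k B α * ξ, ξ] G := by
    intro ξ
    rw [← hom_scale G hG]
    congr 3
    ring_nf
  simp only [Function.comp_def, h2, Multiset.prod_map_mul, Multiset.map_const',
    Multiset.prod_replicate]
  rw [← (IsAlgClosed.splits (PP α F s t)).natDegree_eq_card_roots, (PP_natDegree α F hF hu s t).1]
  ring

theorem RR_zero_iff (F G : MvPolynomial (Fin 3) k) {d e : ℕ} (hF : F.IsHomogeneous d)
    (hG : G.IsHomogeneous e) (hu : eval ![0, α, 1] F ≠ 0) {B : Type*} [Field B] [Algebra k B]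
    (s t : B) (hs : (PP α F s t).Splits) : RR α F G d e s t = 0 ↔ ∃ ξ,
      aeval ![s, t + algebraMap k B α * ξ, ξ] F = 0 ∧
      aeval ![s, t + algebraMap k B α * ξ, ξ] G = 0 := by
  rw [RR_eq_prod α F G hF hG hu s t hs, mul_eq_zero, or_iff_right, Multiset.prod_eq_zero_iff,
    Multiset.mem_map]
  · have h0 : PP α F s t ≠ 0 := by
      intro h
      have := (PP_natDegree α F hF hu s t).2
      rw [h, Polynomial.leadingCoeff_zero] at this
      exact hu ((map_eq_zero (algebraMap k B)).1 this.symm)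
    constructor
    · rintro ⟨ξ, h1, h2⟩
      refine ⟨ξ, ?_, h2⟩
      rw [Polynomial.mem_roots h0, Polynomial.IsRoot, PP_eval] at h1
      exact h1
    · rintro ⟨ξ, h1, h2⟩
      refine ⟨ξ, ?_, h2⟩
      rw [Polynomial.mem_roots h0, Polynomial.IsRoot, PP_eval]
      exact h1
  · apply pow_ne_zero
    simpa using hu

theorem deg_of_rev {k M : Type*} [Field k] [Field M] [Algebra k M] (T : M)
    (hT : Transcendental k T) (R S : Polynomial k) (n : ℕ) (hS0 : S.coeff 0 ≠ 0)
    (hRS : Polynomial.aeval T R = T ^ n * Polynomial.aeval T⁻¹ S) : R.natDegree = n := by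
  have hι : Function.Injective (Polynomial.aeval (R := k) T) :=
    transcendental_iff_injective.1 hT
  have hT0 : T ≠ 0 := by
    rintro rfl
    exact hT isAlgebraic_zero
  have hSn : S ≠ 0 := by rintro h; rw [h] at hS0; simp at hS0
  have hrev : Polynomial.aeval T⁻¹ S * T ^ S.natDegree = Polynomial.aeval T S.reverse := by
    letI : Invertible T⁻¹ := ⟨T, mul_inv_cancel₀ hT0, inv_mul_cancel₀ hT0⟩
    have h2 := Polynomial.eval₂_reverse_mul_pow (algebraMap k M) T⁻¹ S
    have h3 : ⅟(T⁻¹) = T := rfl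
    rw [h3] at h2
    rw [Polynomial.aeval_def, ← h2, mul_assoc, ← mul_pow, inv_mul_cancel₀ hT0, one_pow, mul_one,
      Polynomial.aeval_def]
  have hfin : R * Polynomial.X ^ S.natDegree = Polynomial.X ^ n * S.reverse := by
    apply hι
    rw [map_mul, map_mul, map_pow, map_pow, Polynomial.aeval_X, ← hrev, hRS]
    ring
  have hdeg : S.reverse.natDegree = S.natDegree := by
    rw [Polynomial.reverse_natDegree, Polynomial.natTrailingDegree_eq_zero.2 (Or.inr hS0)]
    simp
  have hR0 : R ≠ 0 := by
    rintro h
    rw [h, zero_mul] at hfin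
    symm at hfin
    rw [mul_eq_zero, Polynomial.reverse_eq_zero] at hfin
    rcases hfin with h | h
    · exact pow_ne_zero _ Polynomial.X_ne_zero h
    · exact hSn h
  have := congrArg Polynomial.natDegree hfin
  rw [Polynomial.natDegree_mul hR0 (pow_ne_zero _ Polynomial.X_ne_zero),
    Polynomial.natDegree_mul (pow_ne_zero _ Polynomial.X_ne_zero)
      (by rwa [Ne, Polynomial.reverse_eq_zero]), Polynomial.natDegree_X_pow,
      Polynomial.natDegree_X_pow, hdeg] at this
  omega

/-- Degree of the resultant when no common zeros at infinity. -/
theorem RR_natDegree [IsAlgClosed k] (F G : MvPolynomial (Fin 3) k) {d e : ℕ}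
    (hF : F.IsHomogeneous d)
    (hG : G.IsHomogeneous e) (hu : eval ![0, α, 1] F ≠ 0)
    (hinf : ∀ ξ : k, eval ![0, 1 + α * ξ, ξ] F = 0 → eval ![0, 1 + α * ξ, ξ] G ≠ 0) :
    (RR α F G d e (1 : Polynomial k) Polynomial.X).natDegree = d * e := by
  set R := RR α F G d e (1 : Polynomial k) Polynomial.X with hR
  set S := RR α F G d e (Polynomial.X : Polynomial k) 1 with hS
  let M := AlgebraicClosure (RatFunc k)
  let ι : Polynomial k →ₐ[k] M := IsScalarTower.toAlgHom k (Polynomial k) M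
  have hι : Function.Injective ι := by
    have h1 : Function.Injective (algebraMap (RatFunc k) M) := RingHom.injective _
    have h2 : Function.Injective (algebraMap (Polynomial k) (RatFunc k)) :=
      IsFractionRing.injective _ _
    have : (algebraMap (Polynomial k) M) = (algebraMap (RatFunc k) M).comp
      (algebraMap (Polynomial k) (RatFunc k)) := IsScalarTower.algebraMap_eq _ _ _
    show Function.Injective (algebraMap (Polynomial k) M)
    rw [this]
    exact h1.comp h2
  set T : M := ι Polynomial.X with hT
  have hT0 : T ≠ 0 := by
    rw [hT, map_ne_zero_iff ι hι]; exact Polynomial.X_ne_zero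
  have hS0 : S.coeff 0 ≠ 0 := by
    have h1 : S.coeff 0 = RR α F G d e (0 : k) 1 := by
      have := RR_map α F G d e (Polynomial.aeval (R := k) (0 : k)) Polynomial.X 1
      rw [map_one, Polynomial.aeval_X] at this
      rw [← this, Polynomial.coeff_zero_eq_aeval_zero]
    rw [h1]
    intro h2
    rw [RR_zero_iff α F G hF hG hu _ _ (IsAlgClosed.splits _)] at h2
    obtain ⟨ξ, h3, h4⟩ := h2
    exact hinf ξ (by simpa [aeval_eq_eval] using h3) (by simpa [aeval_eq_eval] using h4)
  have hRS : ι R = T ^ (d * e) * Polynomial.aeval T⁻¹ S := by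
    rw [hR, RR_map, map_one, hS]
    have h1 := RR_map α F G d e (Polynomial.aeval (R := k) (T⁻¹)) Polynomial.X 1
    rw [map_one, Polynomial.aeval_X] at h1
    rw [h1, ← RR_scale α F G hF hG hu _ _ _ hT0, mul_inv_cancel₀ hT0, mul_one]
  have hTt : Transcendental k T := by
    rw [transcendental_iff_injective]
    convert hι
    ext p
    simp [hT]
  exact deg_of_rev T hTt R S (d * e) hS0 (by
    rw [← hRS, hT]
    congr 1
    ext p
    simp)
end PP
end

section
theorem extend_deriv (k P N : Type*) [CommRing k] [CommRing P] [CommRing N] [Algebra k P]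
    [Algebra k N] [Algebra P N] [IsScalarTower k P N] [Algebra.FormallyEtale P N]
    (D0 : Derivation k P N) : ∃ D : Derivation k N N, ∀ p, D (algebraMap P N p) = D0 p := by
  let l : TensorProduct P N (Ω[P⁄k]) →ₗ[N] N :=
    LinearMap.liftBaseChange N D0.liftKaehlerDifferential
  let D : Derivation k N N := ((l ∘ₗ
    (KaehlerDifferential.tensorKaehlerEquivOfFormallyEtale k P N).symm.toLinearMap).compDer
      (KaehlerDifferential.D k N))
  refine ⟨D, fun p => ?_⟩
  show l ((KaehlerDifferential.tensorKaehlerEquivOfFormallyEtale k P N).symm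
      (KaehlerDifferential.D k N (algebraMap P N p))) = _
  rw [KaehlerDifferential.tensorKaehlerEquivOfFormallyEtale_symm_D_algebraMap]
  simp [l]

theorem exists_deriv_aux (k F N : Type*) [Field k] [Field F] [Field N] [Algebra k F]
    [Algebra (Polynomial k) F] [IsScalarTower k (Polynomial k) F] [IsFractionRing (Polynomial k) F]
    [Algebra F N] [Algebra.IsSeparable F N] [Algebra k N] [IsScalarTower k F N] :
    ∃ (T : N) (D : Derivation k N N), Transcendental k T ∧ D T = 1 := by
  let algN : Algebra (Polynomial k) N :=
    ((algebraMap F N).comp (algebraMap (Polynomial k) F)).toAlgebra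
  have tow1 : IsScalarTower (Polynomial k) F N := IsScalarTower.of_algebraMap_eq fun _ => rfl
  have tow2 : IsScalarTower k (Polynomial k) N := by
    apply IsScalarTower.of_algebraMap_eq
    intro x
    show _ = algebraMap F N (algebraMap (Polynomial k) F (algebraMap k _ x))
    rw [← IsScalarTower.algebraMap_apply k (Polynomial k) F, ← IsScalarTower.algebraMap_apply]
  have et1 : Algebra.FormallyEtale (Polynomial k) F :=
    Algebra.FormallyEtale.of_isLocalization (nonZeroDivisors (Polynomial k))
  have et2 : Algebra.FormallyEtale F N := Algebra.FormallyEtale.of_isSeparable _ _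
  have et : Algebra.FormallyEtale (Polynomial k) N := Algebra.FormallyEtale.comp (Polynomial k) F N
  obtain ⟨D, hD⟩ := extend_deriv k (Polynomial k) N (Polynomial.mkDerivation k (1 : N))
  refine ⟨algebraMap (Polynomial k) N Polynomial.X, D, ?_, ?_⟩
  · rw [transcendental_iff_injective]
    have : (Polynomial.aeval (R := k) (algebraMap (Polynomial k) N Polynomial.X)) =
      IsScalarTower.toAlgHom k (Polynomial k) N := by ext; simp
    rw [this]
    show Function.Injective ((algebraMap F N).comp (algebraMap (Polynomial k) F))
    exact (RingHom.injective (algebraMap F N)).comp (IsFractionRing.injective _ _)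
  · rw [hD]; simp

/-- A separably closed field extension of `k(T)` with an extension of `d/dT`. -/
theorem exists_deriv_field.{u} (k : Type u) [Field k] :
    ∃ (N : Type u) (_ : Field N) (_ : Algebra k N) (_ : IsSepClosed N) (T : N)
      (D : Derivation k N N), Transcendental k T ∧ D T = 1 := by
  obtain ⟨T, D, h1, h2⟩ := exists_deriv_aux k (RatFunc k) (SeparableClosure (RatFunc k))
  exact ⟨SeparableClosure (RatFunc k), inferInstance, inferInstance, inferInstance, T, D, h1, h2⟩

theorem pderiv_pderiv_comm {σ k : Type*} [CommRing k] (i j : σ) (F : MvPolynomial σ k) :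
    pderiv i (pderiv j F) = pderiv j (pderiv i F) := by
  classical
  have : ⁅(pderiv i : Derivation k (MvPolynomial σ k) (MvPolynomial σ k)),
      (pderiv j : Derivation k (MvPolynomial σ k) (MvPolynomial σ k))⁆ = 0 := by
    apply MvPolynomial.derivation_ext
    intro l
    rw [Derivation.commutator_apply]
    simp [pderiv_X, Pi.single_apply]
    split_ifs <;> simp
  have h := congrArg (fun D => D F) this
  simp only [Derivation.commutator_apply, Derivation.zero_apply] at h
  exact sub_eq_zero.1 h

theorem deriv_aeval {k N : Type*} {σ : Type*} [Fintype σ] [CommRing k] [CommRing N] [Algebra k N]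
    (D : Derivation k N N) (v : σ → N) (G : MvPolynomial σ k) :
    D (aeval v G) = ∑ i, aeval v (pderiv i G) * D (v i) := by
  classical
  induction G using MvPolynomial.induction_on with
  | C a => simp
  | add p q hp hq => simp only [map_add, hp, hq, add_mul, Finset.sum_add_distrib]
  | mul_X p n hp =>
    simp only [map_mul, Derivation.leibniz, hp, aeval_X, smul_eq_mul, map_add, pderiv_X, add_mul,
      Finset.sum_add_distrib, Finset.mul_sum]
    congr 1
    · rw [Finset.sum_eq_single n]
      · simp
      · intro b _ hb
        rw [Pi.single_eq_of_ne (Ne.symm hb)]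
        simp
      · simp
    · refine Finset.sum_congr rfl fun i _ => by ring

/-- Smooth plane curve data over an algebraically closed field. -/
structure Good {k : Type*} [Field k] (f : MvPolynomial (Fin 2) k) (F : MvPolynomial (Fin 3) k)
    (d : ℕ) : Prop where
  irr : Irreducible f
  tdeg : f.totalDegree = d
  hom : F.IsHomogeneous d
  deh : aeval ![1, X 0, X 1] F = f
  smooth : ∀ x : Fin 3 → k, x ≠ 0 → eval x F = 0 → ∃ j, eval x (pderiv j F) ≠ 0
  two_le : 2 ≤ d
  dk : (d : k) ≠ 0
  dk1 : ((d - 1 : ℕ) : k) ≠ 0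

namespace Good
variable {k : Type*} [Field k] {f : MvPolynomial (Fin 2) k} {F : MvPolynomial (Fin 3) k} {d : ℕ}

theorem pt (G : MvPolynomial (Fin 3) k) {B : Type*} [CommRing B] [Algebra k B] (t x : B) :
    aeval ![1, t, x] G = aeval ![t, x] (aeval ![1, X 0, X 1] G : MvPolynomial (Fin 2) k) := by
  rw [← AlgHom.comp_apply]
  congr 1
  ext i
  fin_cases i <;> simp

theorem deh_pderiv1 (G : MvPolynomial (Fin 3) k) :
    (aeval ![1, X 0, X 1] (pderiv 1 G) : MvPolynomial (Fin 2) k) =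
      pderiv 0 (aeval ![1, X 0, X 1] G) := by
  have := deriv_aeval (pderiv (R := k) (0 : Fin 2)) ![1, X 0, X 1] G
  rw [this, Fin.sum_univ_three]
  simp [pderiv_X]

theorem deh_pderiv2 (G : MvPolynomial (Fin 3) k) :
    (aeval ![1, X 0, X 1] (pderiv 2 G) : MvPolynomial (Fin 2) k) =
      pderiv 1 (aeval ![1, X 0, X 1] G) := by
  have := deriv_aeval (pderiv (R := k) (1 : Fin 2)) ![1, X 0, X 1] G
  rw [this, Fin.sum_univ_three]
  simp [pderiv_X]

theorem deh_inj [Infinite k] (G : MvPolynomial (Fin 3) k) {e : ℕ} (hG : G.IsHomogeneous e)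
    (h : (aeval ![1, X 0, X 1] G : MvPolynomial (Fin 2) k) = 0) : G = 0 := by
  have h1 : X 0 * G = 0 := by
    apply MvPolynomial.funext
    intro x
    rw [map_mul, eval_X, map_zero]
    by_cases hx : x 0 = 0
    · rw [hx, zero_mul]
    · have h2 := hom_scale (B := k) G hG (x 0) 1 (x 1 / x 0) (x 2 / x 0)
      rw [pt, h, map_zero, mul_zero, aeval_eq_eval] at h2
      have h3 : (![x 0 * 1, x 0 * (x 1 / x 0), x 0 * (x 2 / x 0)] : Fin 3 → k) = x := by
        ext i
        fin_cases i
        · simp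
        · simp; field_simp
        · simp; field_simp
      rw [h3] at h2
      rw [h2, mul_zero]
  rcases mul_eq_zero.1 h1 with h | h
  · exact absurd h (X_ne_zero _)
  · exact h

theorem F1 (g : Good f F d) {B : Type*} [CommRing B] [Algebra k B] (t x : B) :
    aeval ![1, t, x] (pderiv 1 F) = aeval ![t, x] (pderiv 0 f) := by
  rw [pt, deh_pderiv1, g.deh]

theorem F2 (g : Good f F d) {B : Type*} [CommRing B] [Algebra k B] (t x : B) :
    aeval ![1, t, x] (pderiv 2 F) = aeval ![t, x] (pderiv 1 f) := by
  rw [pt, deh_pderiv2, g.deh]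

theorem Ff (g : Good f F d) {B : Type*} [CommRing B] [Algebra k B] (t x : B) :
    aeval ![1, t, x] F = aeval ![t, x] f := by
  rw [pt, g.deh]

theorem euler (g : Good f F d) {B : Type*} [CommRing B] [Algebra k B] (y : Fin 3 → B) :
    y 0 * aeval y (pderiv 0 F) + y 1 * aeval y (pderiv 1 F) + y 2 * aeval y (pderiv 2 F) =
      (d : B) * aeval y F := by
  have := congrArg (aeval y) g.hom.sum_X_mul_pderiv
  simpa [Fin.sum_univ_three] using this

theorem polar_ne_zero (g : Good f F d) (q : Fin 3 → k) (hq : q ≠ 0) :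
    ∑ i, C (q i) * pderiv i F ≠ 0 := by
  intro h0
  have hFq : eval q F = 0 := by
    have h1 := congrArg (eval q) g.hom.sum_X_mul_pderiv
    have h2 := congrArg (eval q) h0
    simp only [map_sum, map_mul, eval_X, eval_C, map_zero, map_nsmul] at h1 h2
    rw [h2] at h1
    rw [nsmul_eq_mul] at h1
    exact (mul_eq_zero.1 h1.symm).resolve_left g.dk
  obtain ⟨j, hj⟩ := g.smooth q hq hFq
  apply hj
  have h1 := congrArg (eval q) (g.hom.pderiv (i := j)).sum_X_mul_pderiv
  have h2 := congrArg (fun p => eval q (pderiv j p)) h0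
  simp only [map_sum, map_mul, eval_X, eval_C, map_zero, map_nsmul, Derivation.leibniz, pderiv_C,
    smul_eq_mul, mul_zero, add_zero] at h1 h2
  have h3 : ∀ i, pderiv i (pderiv j F) = pderiv j (pderiv i F) := fun i => by
    exact pderiv_pderiv_comm _ _ _
  simp only [h3] at h1
  rw [h2, nsmul_eq_mul] at h1
  exact (mul_eq_zero.1 h1.symm).resolve_left g.dk1

theorem totalDegree_pderiv_lt (f : MvPolynomial (Fin 2) k) (h : f.totalDegree ≠ 0) (i : Fin 2) :
    (pderiv i f).totalDegree < f.totalDegree := by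
  rw [totalDegree, Finset.sup_lt_iff (Nat.pos_of_ne_zero h)]
  intro m hm
  rw [mem_support_iff, coeff_pderiv] at hm
  have h1 := le_totalDegree (mem_support_iff.2 (left_ne_zero_of_mul hm))
  refine lt_of_lt_of_le ?_ h1
  rw [Finsupp.sum_fintype _ _ (by simp), Finsupp.sum_fintype _ _ (by simp), Fin.sum_univ_two,
    Fin.sum_univ_two]
  fin_cases i <;> simp

/-- `α f_t + β f_x` is not divisible by `f`. -/
theorem not_dvd_polar [Infinite k] (g : Good f F d) (α β : k) (h : α ≠ 0 ∨ β ≠ 0) :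
    ¬ f ∣ C α * pderiv 0 f + C β * pderiv 1 f := by
  intro hdvd
  have hlt : (C α * pderiv 0 f + C β * pderiv 1 f).totalDegree < f.totalDegree := by
    have h0 : f.totalDegree ≠ 0 := by rw [g.tdeg]; have := g.two_le; omega
    refine (totalDegree_add _ _).trans_lt (max_lt ?_ ?_)
    · refine (totalDegree_mul _ _).trans_lt ?_
      rw [totalDegree_C, zero_add]
      exact totalDegree_pderiv_lt _ h0 _
    · refine (totalDegree_mul _ _).trans_lt ?_
      rw [totalDegree_C, zero_add]
      exact totalDegree_pderiv_lt _ h0 _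
  have hz : C α * pderiv 0 f + C β * pderiv 1 f = 0 := by
    by_contra hne
    obtain ⟨q, hq⟩ := hdvd
    have hq0 : q ≠ 0 := by rintro rfl; exact hne (by rw [hq, mul_zero])
    rw [hq, totalDegree_mul_of_isDomain g.irr.ne_zero hq0] at hlt
    omega
  apply g.polar_ne_zero ![0, α, β]
  · intro h'
    have h1 := congrFun h' 1
    have h2 := congrFun h' 2
    simp at h1 h2
    rcases h with h | h
    · exact h h1
    · exact h h2
  · apply deh_inj (e := d - 1)
    · apply IsHomogeneous.sum
      intro i _
      have := (isHomogeneous_C (Fin 3) ((![0, α, β] : Fin 3 → k) i)).mul (g.hom.pderiv (i := i))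
      rwa [zero_add] at this
    · rw [Fin.sum_univ_three]
      rw [map_add, map_add, map_mul, map_mul, map_mul, deh_pderiv1, deh_pderiv2, g.deh]
      simpa [C_mul'] using hz

end Good
end

section
/-- The bordered Hessian of `f`. -/
noncomputable def hess {k : Type*} [Field k] (f : MvPolynomial (Fin 2) k) : MvPolynomial (Fin 2) k :=
  pderiv 0 (pderiv 0 f) * (pderiv 1 f) ^ 2
    - 2 * pderiv 1 (pderiv 0 f) * pderiv 0 f * pderiv 1 f
    + pderiv 1 (pderiv 1 f) * (pderiv 0 f) ^ 2

theorem PP_derivative {k : Type*} [Field k] (α : k) (G : MvPolynomial (Fin 3) k) {B : Type*}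
    [CommRing B] [Algebra k B] (s t : B) :
    (PP α G s t).derivative =
      PP α (pderiv 2 G) s t + Polynomial.C (algebraMap k B α) * PP α (pderiv 1 G) s t := by
  unfold PP
  have := deriv_aeval ((Polynomial.derivative' (R := B)).restrictScalars k)
    ![Polynomial.C s, Polynomial.C t + Polynomial.C (algebraMap k B α) * Polynomial.X,
    Polynomial.X] G
  simp only [Derivation.restrictScalars_apply, Polynomial.derivative'_apply] at this
  rw [this, Fin.sum_univ_three]
  simp
  ring

theorem exists_c {k : Type*} [Field k] [Infinite k] {W : Set (Fin 3 → k)} (hW : W.Finite)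
    (h0 : ∀ w ∈ W, w ≠ 0) : ∃ c : Fin 3 → k, ∀ w ∈ W, ∑ i, c i * w i ≠ 0 := by
  have : Finite W := hW
  let φ : W → Module.Dual k (Fin 3 → k) := fun w =>
    ∑ i, (w : Fin 3 → k) i • (LinearMap.proj i : (Fin 3 → k) →ₗ[k] k)
  obtain ⟨c, hc⟩ := Module.Dual.exists_forall_ne_zero_of_forall_exists φ (by
    intro w
    obtain ⟨i, hi⟩ := Function.ne_iff.1 (h0 w w.2)
    refine ⟨Pi.single i 1, ?_⟩
    simpa [φ, Pi.single_apply] using hi)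
  refine ⟨c, fun w hw => ?_⟩
  have := hc ⟨w, hw⟩
  simp only [φ, LinearMap.sum_apply, LinearMap.smul_apply, LinearMap.proj_apply, smul_eq_mul] at this
  simpa only [mul_comm] using this

theorem Good.exists_alpha {k : Type*} [Field k] [Infinite k] {f : MvPolynomial (Fin 2) k}
    {F : MvPolynomial (Fin 3) k} {d : ℕ} (g : Good f F d) : ∃ α : k, eval ![0, α, 1] F ≠ 0 := by
  have h1 : ∀ a : k, eval ![0, 1, a] F = (topPoly f d).eval a := by
    intro a
    rw [← lineSub_coeff f a 0 d g.tdeg.le]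
    have h := (hom_coeff_top (B := k) F g.hom ![1, Polynomial.X,
      Polynomial.C a * Polynomial.X + Polynomial.C 0] (by
        intro i
        fin_cases i
        · simp
        · simpa using Polynomial.natDegree_X_le
        · exact Polynomial.natDegree_linear_le)).2
    rw [g.Ff] at h
    unfold lineSub
    rw [h, aeval_eq_eval]
    congr 2
    ext i
    fin_cases i <;> simp [Polynomial.coeff_one]
  have h2 : topPoly f d * Polynomial.X ≠ 0 :=
    mul_ne_zero (topPoly_ne_zero f d g.irr.ne_zero g.tdeg) Polynomial.X_ne_zero
  obtain ⟨a, ha⟩ : ∃ a, (topPoly f d * Polynomial.X).eval a ≠ 0 := by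
    by_contra hcon
    push Not at hcon
    exact h2 (Polynomial.funext fun a => by rw [hcon a, Polynomial.eval_zero])
  rw [Polynomial.eval_mul, Polynomial.eval_X] at ha
  have ha0 := right_ne_zero_of_mul ha
  refine ⟨a⁻¹, ?_⟩
  have h3 := hom_scale (B := k) F g.hom a⁻¹ 0 1 a
  rw [aeval_eq_eval, aeval_eq_eval, mul_zero, mul_one, inv_mul_cancel₀ ha0, h1] at h3
  rw [h3]
  exact mul_ne_zero (pow_ne_zero _ (inv_ne_zero ha0)) (left_ne_zero_of_mul ha)

theorem multiset_logder {k N ι : Type*} [CommRing k] [CommRing N] [Algebra k N]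
    (D : Derivation k N N) (s : Multiset ι) (a b : ι → N)
    (h : ∀ i ∈ s, D (a i) * b i = a i * D (b i)) :
    D (s.map a).prod * (s.map b).prod = (s.map a).prod * D (s.map b).prod := by
  induction s using Multiset.induction_on with
  | empty => simp
  | cons x s ih =>
    have h1 := h x (Multiset.mem_cons_self x s)
    have h2 := ih fun i hi => h i (Multiset.mem_cons_of_mem hi)
    simp only [Multiset.map_cons, Multiset.prod_cons, Derivation.leibniz, smul_eq_mul]
    linear_combination (s.map a).prod * (s.map b).prod * h1 + a x * b x * h2

/-- nonzero polynomials not divisible by `f` do not vanish at generic points. -/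
theorem gen_ne_zero {k Ω : Type*} [Field k] [Field Ω] [Algebra k Ω] {f : MvPolynomial (Fin 2) k}
    (hf : Irreducible f) (v : Fin 2 → Ω) (h0 : aeval v f = 0)
    (h : ¬ ∀ i, IsAlgebraic k (v i)) {q : MvPolynomial (Fin 2) k} (hq : ¬ f ∣ q) :
    aeval v q ≠ 0 := by
  intro h1
  have h2 : q ∈ RingHom.ker (aeval (R := k) v) := h1
  rw [gen_ker hf v h0 h, Ideal.mem_span_singleton] at h2
  exact hq h2

theorem flat_deriv {k N : Type*} [Field k] [Field N] [Algebra k N] {f : MvPolynomial (Fin 2) k}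
    {F : MvPolynomial (Fin 3) k} {d : ℕ} (g : Good f F d) (D : Derivation k N N) (t x : N)
    (h0 : aeval ![t, x] f = 0) (hH : aeval ![t, x] (hess f) = 0)
    (hx : aeval ![t, x] (pderiv 1 f) ≠ 0) (c c' : Fin 3 → k) :
    D (aeval ![1, t, x] (∑ i, C (c i) * pderiv i F)) * aeval ![1, t, x] (∑ i, C (c' i) * pderiv i F)
      = aeval ![1, t, x] (∑ i, C (c i) * pderiv i F) *
        D (aeval ![1, t, x] (∑ i, C (c' i) * pderiv i F)) := by
  set a := aeval ![t, x] (pderiv 0 f) with ha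
  set b := aeval ![t, x] (pderiv 1 f) with hb
  have hF1 : aeval ![1, t, x] (pderiv 1 F) = a := g.F1 t x
  have hF2 : aeval ![1, t, x] (pderiv 2 F) = b := g.F2 t x
  have hF0 : aeval ![1, t, x] (pderiv 0 F) = -(t * a + x * b) := by
    have := g.euler ![1, t, x]
    rw [g.Ff, h0] at this
    simp [hF1, hF2] at this
    linear_combination this
  have e1 : a * D t + b * D x = 0 := by
    have := deriv_aeval D ![t, x] f
    rw [h0, map_zero, Fin.sum_univ_two] at this
    simpa using this.symm
  have e2 : D a = aeval ![t, x] (pderiv 0 (pderiv 0 f)) * D t +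
      aeval ![t, x] (pderiv 1 (pderiv 0 f)) * D x := by
    rw [ha, deriv_aeval, Fin.sum_univ_two]; simp
  have e3 : D b = aeval ![t, x] (pderiv 1 (pderiv 0 f)) * D t +
      aeval ![t, x] (pderiv 1 (pderiv 1 f)) * D x := by
    rw [hb, deriv_aeval, Fin.sum_univ_two, pderiv_pderiv_comm 1 0]; simp
  have e4 : aeval ![t, x] (pderiv 0 (pderiv 0 f)) * b ^ 2 -
      2 * aeval ![t, x] (pderiv 1 (pderiv 0 f)) * a * b +
      aeval ![t, x] (pderiv 1 (pderiv 1 f)) * a ^ 2 = 0 := by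
    have := hH
    unfold hess at this
    simpa [map_add, map_sub, map_mul, map_pow] using this
  have e5 : D a * b = a * D b := by
    apply mul_right_cancel₀ hx
    rw [e2, e3]
    linear_combination D t * e4 + (aeval ![t, x] (pderiv 1 (pderiv 0 f)) * b -
      a * aeval ![t, x] (pderiv 1 (pderiv 1 f))) * e1
  have e6 : D (-(t * a + x * b)) * b = -(t * a + x * b) * D b := by
    simp only [map_neg, map_add, Derivation.leibniz, smul_eq_mul]
    linear_combination - b * e1 - t * e5
  have key : ∀ c : Fin 3 → k, D (aeval ![1, t, x] (∑ i, C (c i) * pderiv i F)) * b =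
      aeval ![1, t, x] (∑ i, C (c i) * pderiv i F) * D b := by
    intro c
    simp only [Fin.sum_univ_three, map_add, map_mul, hF0, hF1, hF2, algHom_C, Derivation.leibniz,
      Derivation.map_algebraMap, smul_eq_mul, mul_zero, add_zero]
    linear_combination algebraMap k N (c 0) * e6 + algebraMap k N (c 1) * e5
  apply mul_right_cancel₀ hx
  linear_combination aeval ![1, t, x] (∑ i, C (c' i) * pderiv i F) * key c -
    aeval ![1, t, x] (∑ i, C (c i) * pderiv i F) * key c'
end

section
/-- the polar of `F` with respect to `c` -/
noncomputable def polar {k : Type*} [Field k] (F : MvPolynomial (Fin 3) k) (c : Fin 3 → k) :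
    MvPolynomial (Fin 3) k := ∑ i, C (c i) * pderiv i F

theorem polar_hom {k : Type*} [Field k] {F : MvPolynomial (Fin 3) k} {d : ℕ}
    (hF : F.IsHomogeneous d) (c : Fin 3 → k) : (polar F c).IsHomogeneous (d - 1) := by
  apply IsHomogeneous.sum
  intro i _
  simpa using (isHomogeneous_C (Fin 3) (c i)).mul (hF.pderiv (i := i))

theorem polar_eval {k : Type*} [Field k] (F : MvPolynomial (Fin 3) k)
    (c x : Fin 3 → k) : eval x (polar F c) = ∑ i, c i * eval x (pderiv i F) := by
  simp [polar]

theorem PP_finite {k : Type*} [Field k] (α : k) {F : MvPolynomial (Fin 3) k} {d : ℕ}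
    (hF : F.IsHomogeneous d) (hu : eval ![0, α, 1] F ≠ 0) (s t : k) :
    {ξ : k | eval ![s, t + α * ξ, ξ] F = 0}.Finite := by
  have h0 : PP α F s t ≠ 0 := by
    intro h
    have := (PP_natDegree α F hF hu s t).2
    rw [h, Polynomial.leadingCoeff_zero] at this
    exact hu (by simpa using this.symm)
  refine (Polynomial.finite_setOfPred_isRoot h0).subset ?_
  intro ξ hξ
  show (PP α F s t).eval ξ = 0
  rw [PP_eval]
  simpa [aeval_eq_eval] using hξ

/-- existence of a polar avoiding a finite set of points -/
theorem Good.exists_polar {k : Type*} [Field k] [Infinite k] {f : MvPolynomial (Fin 2) k}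
    {F : MvPolynomial (Fin 3) k} {d : ℕ} (g : Good f F d) {Z : Set (Fin 3 → k)} (hZ : Z.Finite)
    (h0 : ∀ z ∈ Z, z ≠ 0) : ∃ c, ∀ z ∈ Z, eval z F = 0 → eval z (polar F c) ≠ 0 := by
  let W : Set (Fin 3 → k) := (fun z => fun i => eval z (pderiv i F)) '' {z ∈ Z | eval z F = 0}
  obtain ⟨c, hc⟩ := exists_c (W := W) ((hZ.subset fun z hz => hz.1).image _) (by
    rintro w ⟨z, ⟨hz, hz1⟩, rfl⟩ hw
    obtain ⟨j, hj⟩ := g.smooth z (h0 z hz) hz1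
    exact hj (congrFun hw j))
  refine ⟨c, fun z hz hz1 => ?_⟩
  rw [polar_eval]
  exact hc _ ⟨z, ⟨hz, hz1⟩, rfl⟩

theorem Good.exists_cc {k : Type*} [Field k] [IsAlgClosed k] {f : MvPolynomial (Fin 2) k}
    {F : MvPolynomial (Fin 3) k} {d : ℕ} (g : Good f F d) (α : k) (hu : eval ![0, α, 1] F ≠ 0) :
    ∃ c c' : Fin 3 → k,
      (RR α F (polar F c) d (d - 1) (1 : Polynomial k) Polynomial.X).natDegree = d * (d - 1) ∧
      IsCoprime (RR α F (polar F c) d (d - 1) (1 : Polynomial k) Polynomial.X)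
        (RR α F (polar F c') d (d - 1) (1 : Polynomial k) Polynomial.X) := by
  have hinf : Infinite k := IsAlgClosed.instInfinite
  obtain ⟨c, hc⟩ := g.exists_polar (Z := (fun ξ => ![0, 1 + α * ξ, ξ]) ''
      {ξ : k | eval ![0, 1 + α * ξ, ξ] F = 0}) ((PP_finite α g.hom hu 0 1).image _) (by
    rintro z ⟨ξ, hξ, rfl⟩ h
    have h1 := congrFun h 1
    have h2 := congrFun h 2
    simp at h1 h2
    rw [h2] at h1
    simp at h1)
  have hdeg := RR_natDegree α F (polar F c) g.hom (polar_hom g.hom c) hu (by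
    intro ξ hξ
    exact hc _ ⟨ξ, hξ, rfl⟩ hξ)
  set R := RR α F (polar F c) d (d - 1) (1 : Polynomial k) Polynomial.X with hR
  have hR0 : R ≠ 0 := by
    intro h
    rw [h, Polynomial.natDegree_zero] at hdeg
    have := g.two_le
    have h1 : 0 < d * (d - 1) := Nat.mul_pos (by omega) (by omega)
    omega
  obtain ⟨c', hc'⟩ := g.exists_polar (Z := ⋃ T ∈ {T : k | R.IsRoot T}, (fun ξ => ![1, T + α * ξ, ξ]) ''
      {ξ : k | eval ![1, T + α * ξ, ξ] F = 0}) ((Polynomial.finite_setOfPred_isRoot hR0).biUnion fun T _ => (PP_finite α g.hom hu 1 T).image _) (by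
    intro z hz h
    simp only [Set.mem_iUnion] at hz
    obtain ⟨T, hT, ξ, hξ, rfl⟩ := hz
    have h1 := congrFun h 0
    simp at h1)
  refine ⟨c, c', hdeg, ?_⟩
  rw [Polynomial.isCoprime_iff_aeval_ne_zero_of_isAlgClosed k k]
  intro T
  by_contra hcon
  push Not at hcon
  have h1 := hcon.1
  have h2 := hcon.2
  have hT : R.IsRoot T := by simpa [Polynomial.aeval_def] using h1
  rw [RR_map, RR_zero_iff α F _ g.hom (polar_hom g.hom _) hu _ _ (IsAlgClosed.splits _)] at h2
  obtain ⟨ξ, h3, h4⟩ := h2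
  simp only [map_one, Polynomial.aeval_X, Algebra.algebraMap_self, RingHom.id_apply,
    aeval_eq_eval] at h3 h4
  refine hc' ![1, T + α * ξ, ξ] ?_ h3 h4
  simp only [Set.mem_iUnion]
  exact ⟨T, hT, ξ, h3, rfl⟩

theorem gen_of_sub {k B : Type*} [Field k] [Field B] [Algebra k B] (α : k) {T ξ : B}
    (hT : Transcendental k T) : ¬ ∀ i, IsAlgebraic k (![T + algebraMap k B α * ξ, ξ] i) := by
  intro h
  apply hT
  have h0 := h 0
  have h1 := h 1
  simp at h0 h1
  have := h0.sub ((isAlgebraic_algebraMap (R := k) (A := B) α).mul h1)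
  simpa using this

theorem PP_sep {k B : Type*} [Field k] [Infinite k] [Field B] [Algebra k B]
    {f : MvPolynomial (Fin 2) k}
    {F : MvPolynomial (Fin 3) k} {d : ℕ} (g : Good f F d) (α : k)
    {T : B} (hT : Transcendental k T) : (PP α F (1 : B) T).Separable := by
  rw [Polynomial.Separable, PP_derivative,
    Polynomial.isCoprime_iff_aeval_ne_zero_of_isAlgClosed B (AlgebraicClosure B)]
  intro ξ
  by_contra hcon
  push Not at hcon
  obtain ⟨h1, h2⟩ := hcon
  let φ : B →ₐ[k] AlgebraicClosure B := IsScalarTower.toAlgHom k B (AlgebraicClosure B)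
  have hφ : (φ : B →+* AlgebraicClosure B) = algebraMap _ _ := rfl
  have hev : ∀ G : MvPolynomial (Fin 3) k, Polynomial.aeval ξ (PP α G (1 : B) T) =
      aeval ![1, φ T + algebraMap k _ α * ξ, ξ] G := by
    intro G
    rw [Polynomial.aeval_def, ← Polynomial.eval_map, ← hφ, PP_map, PP_eval, map_one]
  have hT' : Transcendental k (φ T) := by
    rwa [Transcendental, isAlgebraic_algHom_iff φ φ.injective]
  rw [map_add, map_mul, hev, hev, Polynomial.aeval_C, ← hφ, RingHom.coe_coe, AlgHom.commutes] at h2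
  rw [hev, g.Ff] at h1
  rw [g.F1, g.F2] at h2
  have := gen_ne_zero g.irr _ h1 (gen_of_sub α hT') (g.not_dvd_polar α 1 (Or.inr one_ne_zero))
  apply this
  rw [map_add, map_mul, map_mul, algHom_C, algHom_C, map_one]
  linear_combination h2

theorem Good.not_dvd_hess.{u} {k : Type u} [Field k] [IsAlgClosed k] {f : MvPolynomial (Fin 2) k}
    {F : MvPolynomial (Fin 3) k} {d : ℕ} (g : Good f F d) : ¬ f ∣ hess f := by
  intro hdvd
  have hinf : Infinite k := IsAlgClosed.instInfinite
  obtain ⟨α, hu⟩ := g.exists_alpha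
  obtain ⟨c, c', hdeg, hcop⟩ := g.exists_cc α hu
  obtain ⟨N, _, _, _, T, D, hT, hDT⟩ := exists_deriv_field k
  have hsplit : (PP α F (1 : N) T).Splits := IsSepClosed.splits_of_separable _ (PP_sep g α hT)
  set R := RR α F (polar F c) d (d - 1) (1 : Polynomial k) Polynomial.X with hR
  set R' := RR α F (polar F c') d (d - 1) (1 : Polynomial k) Polynomial.X with hR'
  have e1 : ∀ c, Polynomial.aeval T (RR α F (polar F c) d (d - 1) (1 : Polynomial k) Polynomial.X)
      = algebraMap k N (eval ![0, α, 1] F) ^ (d - 1) * ((PP α F 1 T).roots.map fun ξ =>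
        aeval ![1, T + algebraMap k N α * ξ, ξ] (polar F c)).prod := by
    intro c
    rw [RR_map, ← RR_eq_prod α F _ g.hom (polar_hom g.hom _) hu _ _ hsplit, map_one,
      Polynomial.aeval_X]
  have e2 := multiset_logder D (PP α F 1 T).roots
    (fun ξ => aeval ![1, T + algebraMap k N α * ξ, ξ] (polar F c))
    (fun ξ => aeval ![1, T + algebraMap k N α * ξ, ξ] (polar F c')) (by
      intro ξ hξ
      have h0 := Polynomial.isRoot_of_mem_roots hξ
      rw [Polynomial.IsRoot, PP_eval, g.Ff] at h0
      obtain ⟨q, hq⟩ := hdvd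
      refine flat_deriv g D _ _ h0 (by rw [hq, map_mul, h0, zero_mul]) ?_ c c'
      have := gen_ne_zero g.irr _ h0 (gen_of_sub α hT) (g.not_dvd_polar 0 1 (Or.inr one_ne_zero))
      simpa using this)
  have hD : ∀ p : Polynomial k, D (Polynomial.aeval T p) = Polynomial.aeval T p.derivative := by
    intro p
    rw [Derivation.map_aeval, hDT, smul_eq_mul, mul_one]
  have e3 : D (Polynomial.aeval T R) * Polynomial.aeval T R' =
      Polynomial.aeval T R * D (Polynomial.aeval T R') := by
    rw [hR, hR', e1, e1]
    have hc : D (algebraMap k N (eval ![0, α, 1] F) ^ (d - 1)) = 0 := by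
      rw [← map_pow, Derivation.map_algebraMap]
    simp only [Derivation.leibniz, hc, smul_eq_mul, mul_zero, add_zero]
    linear_combination (algebraMap k N (eval ![0, α, 1] F) ^ (d - 1)) ^ 2 * e2
  rw [hD, hD, ← map_mul, ← map_mul] at e3
  have e4 := transcendental_iff_injective.1 hT e3
  have hd : R ∣ R.derivative := hcop.dvd_of_dvd_mul_right ⟨_, e4⟩
  have hpos : 0 < d * (d - 1) := by
    have := g.two_le
    exact Nat.mul_pos (by omega) (by omega)
  have hz : R.derivative = 0 := by
    by_contra hne
    have := Polynomial.natDegree_le_of_dvd hd hne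
    have := Polynomial.natDegree_derivative_lt (p := R) (by omega)
    omega
  have hco := congrArg (fun p => Polynomial.coeff p (d * (d - 1) - 1)) hz
  simp only [Polynomial.coeff_derivative, Polynomial.coeff_zero] at hco
  have h1 : d * (d - 1) - 1 + 1 = d * (d - 1) := by omega
  rw [h1] at hco
  have h2 : R.coeff (d * (d - 1)) ≠ 0 := by
    rw [← hdeg]
    intro h
    have h3 := Polynomial.leadingCoeff_eq_zero.1 h
    rw [h3, Polynomial.natDegree_zero] at hdeg
    omega
  have h3 := (mul_eq_zero.1 hco).resolve_left h2
  have h4 : ((d * (d - 1) : ℕ) : k) = 0 := by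
    rw [← h1]; push_cast; exact_mod_cast h3
  push_cast at h4
  exact (mul_ne_zero g.dk g.dk1) h4
end

section
theorem exch {k Ω : Type*} [Field k] [Field Ω] [Algebra k Ω] {v a : Fin 2 → Ω}
    (ha : AlgebraicIndependent k a)
    (h : ∀ i, IsAlgebraic (Algebra.adjoin k (Set.range v)) (a i)) : AlgebraicIndependent k v := by
  let M := AlgebraicIndependent.matroid k Ω
  have hM : M.Indep (Set.range a) := AlgebraicIndependent.coe_range ha
  have e2 : ∀ {w : Fin 2 → Ω}, (Set.range w).encard ≤ 2 := by
    intro w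
    have := Set.encard_image_le w Set.univ
    rw [Set.image_univ, Set.encard_univ] at this
    simpa using this
  have h1 : (Set.range a).encard = 2 := by
    rw [← Set.image_univ, ha.injective.encard_image, Set.encard_univ]
    simp
  have h2 : (2 : ℕ∞) ≤ M.eRk (Set.range v) := by
    rw [← h1, ← hM.eRk_eq_encard, ← M.eRk_closure_eq (Set.range v)]
    apply M.eRk_mono
    rintro _ ⟨i, rfl⟩
    rw [show M.closure (Set.range v) = _ from AlgebraicIndependent.matroid_closure_eq]
    exact (h i)
  have h3 : (Set.range v).encard = 2 := le_antisymm e2 (h2.trans (M.eRk_le_encard _))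
  have h4 : M.Indep (Set.range v) := by
    rw [Matroid.indep_iff_eRk_eq_encard_of_finite (Set.finite_range v)]
    exact le_antisymm (M.eRk_le_encard _) (h3 ▸ h2)
  have hinj : Function.Injective v := by
    have : (v '' Set.univ).encard = (Set.univ : Set (Fin 2)).encard := by
      rw [Set.image_univ, h3, Set.encard_univ]; simp
    have := Set.finite_univ.injOn_of_encard_image_eq this
    exact Set.injOn_univ.1 this
  have h5 : AlgebraicIndependent k ((↑) : Set.range v → Ω) := h4
  exact AlgebraicIndependent.of_subtype_range hinj h5 

theorem alg_elt {k Ω : Type*} [Field k] [IsAlgClosed k] [Field Ω] [Algebra k Ω] {x : Ω}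
    (h : IsAlgebraic k x) : ∃ c : k, algebraMap k Ω c = x := by
  have hi := h.isIntegral
  exact minpoly.mem_range_of_degree_eq_one k x
    (IsAlgClosed.degree_eq_one_of_irreducible k (minpoly.irreducible hi))

theorem exists_FF.{u} {k : Type u} [Field k] {f : MvPolynomial (Fin 2) k} (hf : Irreducible f) :
    ∃ (E : Type u) (_ : Field E) (_ : Algebra k E) (v : Fin 2 → E), aeval v f = 0 ∧
      (∀ e : E, ∃ p q : MvPolynomial (Fin 2) k, e = aeval v p / aeval v q) ∧
      ∀ (Ω : Type u) [Field Ω] [Algebra k Ω] (w : Fin 2 → Ω), aeval w f = 0 →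
        (¬ ∀ i, IsAlgebraic k (w i)) → ∃ φ : E →ₐ[k] Ω, ∀ i, φ (v i) = w i := by
  have hp : (Ideal.span {f}).IsPrime := (Ideal.span_singleton_prime hf.ne_zero).2 hf.prime
  let Q := MvPolynomial (Fin 2) k ⧸ Ideal.span {f}
  have : IsDomain Q := Ideal.Quotient.isDomain _
  let v : Fin 2 → FractionRing Q := fun i => algebraMap Q _ (Ideal.Quotient.mk _ (X i))
  have hv : ∀ q, aeval v q = algebraMap Q (FractionRing Q) (Ideal.Quotient.mk _ q) := by
    intro q
    have : aeval v = (IsScalarTower.toAlgHom k Q (FractionRing Q)).comp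
        (Ideal.Quotient.mkₐ k (Ideal.span {f})) := by
      ext i; simp [v]; rfl
    rw [this]; rfl
  refine ⟨FractionRing Q, inferInstance, inferInstance, v, ?_, ?_, ?_⟩
  · rw [hv, Ideal.Quotient.eq_zero_iff_mem.2 (Ideal.mem_span_singleton_self f), map_zero]
  · intro e
    obtain ⟨p, q, _, rfl⟩ := IsFractionRing.div_surjective (A := Q) e
    obtain ⟨p, rfl⟩ := Ideal.Quotient.mk_surjective p
    obtain ⟨q, rfl⟩ := Ideal.Quotient.mk_surjective q
    exact ⟨p, q, by rw [hv, hv]⟩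
  · intro Ω _ _ w h0 h
    have hk := gen_ker hf w h0 h
    let ψ : Q →ₐ[k] Ω := Ideal.Quotient.liftₐ (Ideal.span {f}) (aeval w) (by
      intro a ha; rw [← hk] at ha; exact ha)
    have hψ : Function.Injective ψ := by
      rw [injective_iff_map_eq_zero]
      intro a
      obtain ⟨a, rfl⟩ := Ideal.Quotient.mk_surjective a
      intro ha
      rw [Ideal.Quotient.eq_zero_iff_mem, ← hk]
      exact ha
    refine ⟨IsFractionRing.liftAlgHom hψ, fun i => ?_⟩
    show IsFractionRing.liftAlgHom hψ (algebraMap Q _ _) = _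
    rw [IsFractionRing.liftAlgHom_apply, IsFractionRing.lift_algebraMap]
    show aeval w (X i) = _
    simp

/-- the slope of the tangent of `f` at `v` -/
noncomputable def slp {k E : Type*} [Field k] [Field E] [Algebra k E] (f : MvPolynomial (Fin 2) k)
    (v : Fin 2 → E) : E := -(aeval v (pderiv 0 f)) / aeval v (pderiv 1 f)

/-- the intercept of the tangent of `f` at `v` -/
noncomputable def icp {k E : Type*} [Field k] [Field E] [Algebra k E] (f : MvPolynomial (Fin 2) k)
    (v : Fin 2 → E) : E := v 1 - slp f v * v 0

section
variable {k E E' : Type*} [Field k] [Field E] [Algebra k E] [Field E'] [Algebra k E']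
  (f : MvPolynomial (Fin 2) k) (φ : E →ₐ[k] E') (v : Fin 2 → E)

theorem aeval_comp' (q : MvPolynomial (Fin 2) k) : aeval (fun i => φ (v i)) q = φ (aeval v q) := by
  rw [← AlgHom.comp_apply, comp_aeval]

theorem slp_map : slp f (fun i => φ (v i)) = φ (slp f v) := by
  simp [slp, aeval_comp']

theorem icp_map : icp f (fun i => φ (v i)) = φ (icp f v) := by
  simp [icp, slp_map]
end

/-- A generic point in a differential field. -/
theorem exists_N.{u} {k : Type u} [Field k] [Infinite k] {f : MvPolynomial (Fin 2) k}
    {F : MvPolynomial (Fin 3) k} {d : ℕ} (g : Good f F d) :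
    ∃ (N : Type u) (_ : Field N) (_ : Algebra k N) (D : Derivation k N N) (v : Fin 2 → N),
      aeval v f = 0 ∧ (¬ ∀ i, IsAlgebraic k (v i)) ∧ D (v 0) ≠ 0 ∧ D (v 1) = slp f v * D (v 0) := by
  obtain ⟨α, hu⟩ := g.exists_alpha
  obtain ⟨N, _, _, _, T, D, hT, hDT⟩ := exists_deriv_field k
  have hsep := PP_sep g α hT
  obtain ⟨ξ, hξ⟩ := IsSepClosed.exists_root (PP α F (1 : N) T) (by
    intro h
    have h1 := (PP_natDegree α F g.hom hu (1 : N) T).1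
    have h2 : (PP α F (1 : N) T).natDegree = 0 := Polynomial.natDegree_eq_of_degree_eq_some h
    have := g.two_le
    omega) hsep
  rw [Polynomial.IsRoot, PP_eval, g.Ff] at hξ
  have hgen := gen_of_sub (ξ := ξ) α hT
  have hx := gen_ne_zero g.irr _ hξ hgen (g.not_dvd_polar 0 1 (Or.inr one_ne_zero))
  have e1 := deriv_aeval D ![T + algebraMap k N α * ξ, ξ] f
  rw [hξ, map_zero, Fin.sum_univ_two] at e1
  rw [map_add, map_mul, map_mul, algHom_C, algHom_C, map_zero, map_one, zero_mul, zero_add,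
    one_mul] at hx
  refine ⟨N, _, _, D, _, hξ, hgen, ?_, ?_⟩
  · intro h0
    rw [h0] at e1
    have h1 : D ξ = 0 := by
      have := e1.symm
      simpa [hx] using this
    simp [hDT, h1] at h0
  · unfold slp
    rw [div_mul_eq_mul_div, eq_div_iff hx]
    linear_combination -e1

section
variable {k N : Type*} [Field k] [Field N] [Algebra k N] {f : MvPolynomial (Fin 2) k}

theorem slp_deriv (D : Derivation k N N) (v : Fin 2 → N) (hx : aeval v (pderiv 1 f) ≠ 0)
    (h1 : D (v 1) = slp f v * D (v 0)) :
    D (slp f v) * aeval v (pderiv 1 f) ^ 3 = - aeval v (hess f) * D (v 0) := by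
  set b := aeval v (pderiv 1 f) with hb
  set a := aeval v (pderiv 0 f) with ha
  set m := slp f v with hm
  have hmb : m * b = - a := by
    rw [hm, slp, div_mul_cancel₀ _ hx]
  have e2 : D a = aeval v (pderiv 0 (pderiv 0 f)) * D (v 0) +
      aeval v (pderiv 1 (pderiv 0 f)) * D (v 1) := by
    rw [ha, deriv_aeval, Fin.sum_univ_two]
  have e3 : D b = aeval v (pderiv 1 (pderiv 0 f)) * D (v 0) +
      aeval v (pderiv 1 (pderiv 1 f)) * D (v 1) := by
    rw [hb, deriv_aeval, Fin.sum_univ_two, pderiv_pderiv_comm 1 0]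
  have e4 : aeval v (hess f) = aeval v (pderiv 0 (pderiv 0 f)) * b ^ 2 -
      2 * aeval v (pderiv 1 (pderiv 0 f)) * a * b +
      aeval v (pderiv 1 (pderiv 1 f)) * a ^ 2 := by
    unfold hess
    simp [map_add, map_sub, map_mul, map_pow, ← ha, ← hb]
  have e5 := congrArg D hmb
  rw [Derivation.leibniz, map_neg, smul_eq_mul, smul_eq_mul, e2, e3, h1] at e5
  have ea : a = - (m * b) := by rw [hmb, neg_neg]
  rw [e4, ea]
  linear_combination b ^ 2 * e5
end

section
universe u
variable {k : Type u} [Field k] [IsAlgClosed k] {f : MvPolynomial (Fin 2) k}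
    {F : MvPolynomial (Fin 3) k} {d : ℕ} {E : Type u} [Field E] [Algebra k E]

theorem gen_fx (g : Good f F d) (v : Fin 2 → E) (h0 : aeval v f = 0)
    (hv : ¬ ∀ i, IsAlgebraic k (v i)) : aeval v (pderiv 1 f) ≠ 0 := by
  have hinf : Infinite k := IsAlgClosed.instInfinite
  have := gen_ne_zero g.irr _ h0 hv (g.not_dvd_polar 0 1 (Or.inr one_ne_zero))
  simpa using this

theorem gen_hess (g : Good f F d) (v : Fin 2 → E) (h0 : aeval v f = 0)
    (hv : ¬ ∀ i, IsAlgebraic k (v i)) : aeval v (hess f) ≠ 0 := gen_ne_zero g.irr _ h0 hv g.not_dvd_hess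

theorem slp_trans (g : Good f F d) (v : Fin 2 → E) (h0 : aeval v f = 0)
    (hv : ¬ ∀ i, IsAlgebraic k (v i)) : Transcendental k (slp f v) := by
  intro halg
  have hinf : Infinite k := IsAlgClosed.instInfinite
  obtain ⟨N, _, _, D, w, hw0, hw, hD0, hD1⟩ := exists_N g
  obtain ⟨E', _, _, y, hy0, _, hE⟩ := exists_FF g.irr
  obtain ⟨φ, hφ⟩ := hE E v h0 hv
  obtain ⟨ψ, hψ⟩ := hE N w hw0 hw
  have e1 : slp f v = φ (slp f y) := by rw [← slp_map]; congr 1; ext i; rw [hφ]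
  have e2 : slp f w = ψ (slp f y) := by rw [← slp_map]; congr 1; ext i; rw [hψ]
  rw [e1, isAlgebraic_algHom_iff φ φ.injective] at halg
  have h3 : IsAlgebraic k (slp f w) := by rw [e2]; exact halg.algHom ψ
  obtain ⟨c, hc⟩ := alg_elt h3
  have e3 := slp_deriv D _ (gen_fx g _ hw0 hw) hD1
  rw [← hc, Derivation.map_algebraMap, zero_mul] at e3
  exact mul_ne_zero (neg_ne_zero.2 (gen_hess g _ hw0 hw)) hD0 e3.symm

theorem tan_deriv (g : Good f F d) (v : Fin 2 → E) (h0 : aeval v f = 0)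
    (hv : ¬ ∀ i, IsAlgebraic k (v i))
    (H : MvPolynomial (Fin 2) k) (hH : aeval ![slp f v, icp f v] H = 0) :
    aeval ![slp f v, icp f v] (pderiv 0 H) = v 0 * aeval ![slp f v, icp f v] (pderiv 1 H) := by
  have hinf : Infinite k := IsAlgClosed.instInfinite
  obtain ⟨N, _, _, D, w, hw0, hw, hD0, hD1⟩ := exists_N g
  obtain ⟨E', _, _, y, hy0, _, hE⟩ := exists_FF g.irr
  obtain ⟨φ, hφ⟩ := hE E v h0 hv
  obtain ⟨ψ, hψ⟩ := hE N w hw0 hw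
  obtain rfl : (fun i => φ (y i)) = v := funext hφ
  obtain rfl : (fun i => ψ (y i)) = w := funext hψ
  have key : ∀ {B : Type u} [Field B] [Algebra k B] (θ : E' →ₐ[k] B) (q : MvPolynomial (Fin 2) k),
      aeval ![slp f (fun i => θ (y i)), icp f (fun i => θ (y i))] q =
        θ (aeval ![slp f y, icp f y] q) := by
    intro B _ _ θ q
    rw [← aeval_comp', slp_map, icp_map]
    congr 2
    ext i; fin_cases i <;> rfl
  rw [key, map_eq_zero] at hH
  rw [key, key, ← map_mul]
  congr 1
  refine ψ.injective ?_
  show ψ _ = ψ _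
  rw [map_mul, ← key, ← key]
  have hH' := congrArg ψ hH
  rw [← key, map_zero] at hH'
  have hx := gen_fx g _ hw0 hw
  have e1 := slp_deriv D _ hx hD1
  have hne : D (slp f fun i => ψ (y i)) ≠ 0 := by
    intro h
    rw [h, zero_mul] at e1
    exact mul_ne_zero (neg_ne_zero.2 (gen_hess g _ hw0 hw)) hD0 e1.symm
  have e2 := deriv_aeval D ![slp f (fun i => ψ (y i)), icp f (fun i => ψ (y i))] H
  rw [hH', map_zero, Fin.sum_univ_two] at e2
  have e3 : D (icp f (fun i => ψ (y i))) = - ψ (y 0) * D (slp f (fun i => ψ (y i))) := by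
    unfold icp
    rw [map_sub, Derivation.leibniz, hD1, smul_eq_mul, smul_eq_mul]
    ring
  simp only [Matrix.cons_val_zero, Matrix.cons_val_one] at e2
  rw [e3] at e2
  apply mul_right_cancel₀ hne
  linear_combination -e2

end
end

section
theorem pth_root {k : Type*} [Field k] [IsAlgClosed k] (p : ℕ) [CharP k p] (hp : p.Prime)
    (H : MvPolynomial (Fin 2) k) (h : ∀ i, pderiv i H = 0) : ∃ H', H = H' ^ p := by
  have := Fact.mk hp
  have : CharP (MvPolynomial (Fin 2) k) p := inferInstance
  have hdiv : ∀ m ∈ H.support, ∀ i, p ∣ m i := by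
    intro m hm i
    by_cases h0 : m i = 0
    · rw [h0]; exact dvd_zero _
    have h1 := congrArg (coeff (m - Finsupp.single i 1)) (h i)
    rw [coeff_pderiv, coeff_zero] at h1
    have h2 : m - Finsupp.single i 1 + Finsupp.single i 1 = m := by
      ext j
      simp only [Finsupp.add_apply, Finsupp.tsub_apply, Finsupp.single_apply]
      split_ifs with hj
      · subst hj; omega
      · omega
    rw [h2] at h1
    have h3 := (mul_eq_zero.1 h1).resolve_left (mem_support_iff.1 hm)
    have h4 : ((m i : ℕ) : k) = 0 := by
      have h5 : (m - Finsupp.single i 1 : Fin 2 →₀ ℕ) i + 1 = m i := by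
        simp; omega
      rw [← h5]; push_cast; exact_mod_cast h3
    exact (CharP.cast_eq_zero_iff k p _).1 h4
  have hr : ∀ c : k, ∃ b : k, b ^ p = c := fun c =>
    IsAlgClosed.exists_pow_nat_eq c hp.pos
  choose r hr using hr
  refine ⟨∑ m ∈ H.support, monomial (m.mapRange (· / p) (by simp)) (r (coeff m H)), ?_⟩
  rw [sum_pow_char]
  conv_lhs => rw [H.as_sum]
  refine Finset.sum_congr rfl fun m hm => ?_
  rw [monomial_pow, hr]
  congr 2
  ext i
  exact (Nat.mul_div_cancel' (hdiv m hm i)).symm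

theorem exists_sep_rel {k E : Type*} [Field k] [IsAlgClosed k] [Field E] [Algebra k E]
    (a : Fin 2 → E) (ha : ¬ AlgebraicIndependent k a) :
    ∃ H : MvPolynomial (Fin 2) k, aeval a H = 0 ∧ ∃ i, aeval a (pderiv i H) ≠ 0 := by
  have hex : ∃ n, ∃ H : MvPolynomial (Fin 2) k, H ≠ 0 ∧ aeval a H = 0 ∧ H.totalDegree = n := by
    rw [algebraicIndependent_iff] at ha
    push Not at ha
    obtain ⟨H, h1, h2⟩ := ha
    exact ⟨_, H, h2, h1, rfl⟩
  classical
  obtain ⟨H, hH0, hHa, hHd⟩ := Nat.find_spec hex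
  have hmin : ∀ G : MvPolynomial (Fin 2) k, G.totalDegree < H.totalDegree → aeval a G = 0 →
      G = 0 := by
    intro G hG hGa
    by_contra hne
    rw [hHd] at hG
    exact Nat.find_min hex hG ⟨G, hne, hGa, rfl⟩
  have hdeg : H.totalDegree ≠ 0 := by
    intro h
    rw [totalDegree_eq_zero_iff_eq_C] at h
    rw [h, algHom_C, map_eq_zero] at hHa
    rw [hHa, map_zero] at h
    exact hH0 h
  refine ⟨H, hHa, ?_⟩
  by_contra hcon
  push Not at hcon
  have hp0 : ∀ i, pderiv i H = 0 := fun i =>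
    hmin _ (Good.totalDegree_pderiv_lt H hdeg i) (hcon i)
  obtain ⟨p, hp⟩ := CharP.exists k
  rcases CharP.char_is_prime_or_zero k p with hpp | hpp
  · obtain ⟨H', hH'⟩ := pth_root p hpp H hp0
    have h1 : aeval a H' = 0 := by
      rw [hH', map_pow] at hHa
      exact eq_zero_of_pow_eq_zero hHa
    have hne : H' ≠ 0 := by
      rintro rfl
      rw [zero_pow hpp.ne_zero] at hH'
      exact hH0 hH'
    have h2 : H.totalDegree = p * H'.totalDegree := by
      have hq : ∀ n, (H' ^ n).totalDegree = n * H'.totalDegree := by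
        intro n
        induction n with
        | zero => simp
        | succ n ih =>
          rw [pow_succ, totalDegree_mul_of_isDomain (pow_ne_zero _ hne) hne, ih]; ring
      rw [hH', hq]
    refine hne (hmin H' ?_ h1)
    have : H'.totalDegree ≠ 0 := by
      intro h; rw [h] at h2; simp at h2; exact hdeg h2
    have := hpp.two_le
    rw [h2]
    nlinarith [Nat.pos_of_ne_zero ‹H'.totalDegree ≠ 0›]
  · subst hpp
    have : CharZero k := CharP.charP_to_charZero k
    apply hdeg
    rw [totalDegree_eq_zero_iff]
    intro m hm i
    by_contra h0
    have h1 := congrArg (coeff (m - Finsupp.single i 1)) (hp0 i)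
    rw [coeff_pderiv, coeff_zero] at h1
    have h2 : m - Finsupp.single i 1 + Finsupp.single i 1 = m := by
      ext j
      simp only [Finsupp.add_apply, Finsupp.tsub_apply, Finsupp.single_apply]
      split_ifs with hj
      · subst hj; omega
      · omega
    rw [h2] at h1
    have h3 := (mul_eq_zero.1 h1).resolve_left (mem_support_iff.1 hm)
    exact Nat.cast_add_one_ne_zero _ h3

section
universe u
variable {k : Type u} [Field k] [IsAlgClosed k] {f : MvPolynomial (Fin 2) k}
    {F : MvPolynomial (Fin 3) k} {d : ℕ}

theorem slp_icp_dep (hf : f ≠ 0) {E : Type u} [Field E] [Algebra k E]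
    (v : Fin 2 → E) (h0 : aeval v f = 0) : ¬ AlgebraicIndependent k ![slp f v, icp f v] := by
  intro h
  have hm : ∀ q : MvPolynomial (Fin 2) k, IsAlgebraic (Algebra.adjoin k (Set.range v)) (aeval v q) := by
    intro q
    have : aeval v q ∈ Algebra.adjoin k (Set.range v) := by
      rw [Algebra.adjoin_range_eq_range_aeval]; exact ⟨q, rfl⟩
    exact isAlgebraic_algebraMap (⟨_, this⟩ : Algebra.adjoin k (Set.range v))
  have hv : ∀ i, IsAlgebraic (Algebra.adjoin k (Set.range v)) (v i) := by
    intro i; simpa using hm (X i)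
  have hs : IsAlgebraic (Algebra.adjoin k (Set.range v)) (slp f v) := by
    unfold slp
    rw [div_eq_mul_inv]
    exact (hm _).neg.mul (hm _).inv
  have := exch (v := v) h (by
    intro i
    fin_cases i
    · exact hs
    · exact (hv 1).sub (hs.mul (hv 0)))
  rw [algebraicIndependent_iff] at this
  exact hf (this f h0)

/-- Key: the tangent line at a generic point is tangent nowhere else, to no other curve. -/
theorem no_other_tangent (g : Good f F d) {f' : MvPolynomial (Fin 2) k}
    {F' : MvPolynomial (Fin 3) k} {d' : ℕ} (g' : Good f' F' d')
    {E : Type u} [Field E] [Algebra k E]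
    (v : Fin 2 → E) (h0 : aeval v f = 0) (hv : ¬ ∀ i, IsAlgebraic k (v i))
    (w : Fin 2 → E) (hw : w 1 = slp f v * w 0 + icp f v) (hw0 : aeval w f' = 0)
    (hwt : aeval w (pderiv 0 f') + slp f v * aeval w (pderiv 1 f') = 0) :
    w = v ∧ Associated f f' := by
  have hgen : ¬ ∀ i, IsAlgebraic k (w i) := by
    intro hall
    choose c hc using fun i => alg_elt (hall i)
    obtain rfl : (fun i => algebraMap k E (c i)) = w := funext hc
    have hev : ∀ q : MvPolynomial (Fin 2) k, aeval (fun i => algebraMap k E (c i)) q =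
        algebraMap k E (eval c q) := by
      intro q
      have := aeval_algebraMap_apply E c q
      rw [aeval_eq_eval] at this
      exact this
    rw [hev, map_eq_zero] at hw0
    rw [hev, hev] at hwt
    by_cases hx : eval c (pderiv 1 f') = 0
    · rw [hx, map_zero, mul_zero, add_zero, map_eq_zero] at hwt
      have hcc2 : ![c 0, c 1] = c := by ext i; fin_cases i <;> rfl
      have e0 : eval ![1, c 0, c 1] F' = 0 := by
        have := g'.Ff (c 0) (c 1)
        rw [aeval_eq_eval, aeval_eq_eval] at this
        conv at this => rhs; rw [hcc2]
        exact this.trans hw0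
      have e1 : eval ![1, c 0, c 1] (pderiv 1 F') = 0 := by
        have := g'.F1 (c 0) (c 1)
        rw [aeval_eq_eval, aeval_eq_eval] at this
        conv at this => rhs; rw [hcc2]
        exact this.trans hwt
      have e2 : eval ![1, c 0, c 1] (pderiv 2 F') = 0 := by
        have := g'.F2 (c 0) (c 1)
        rw [aeval_eq_eval, aeval_eq_eval] at this
        conv at this => rhs; rw [hcc2]
        exact this.trans hx
      have e3 : eval ![1, c 0, c 1] (pderiv 0 F') = 0 := by
        have := g'.euler ![1, c 0, c 1]
        simpa [aeval_eq_eval, e0, e1, e2] using this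
      obtain ⟨j, hj⟩ := g'.smooth ![1, c 0, c 1] (by
        intro h; simpa using congrFun h 0) e0
      fin_cases j
      · exact hj e3
      · exact hj e1
      · exact hj e2
    · apply slp_trans g v h0 hv
      have : slp f v = algebraMap k E (- eval c (pderiv 0 f') / eval c (pderiv 1 f')) := by
        rw [map_div₀, map_neg, eq_div_iff (by simpa using hx)]
        linear_combination hwt
      rw [this]
      exact isAlgebraic_algebraMap _
  have hx := gen_fx g' w hw0 hgen
  have es : slp f' w = slp f v := by
    rw [slp, div_eq_iff hx]
    linear_combination -hwt
  have ei : icp f' w = icp f v := by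
    unfold icp
    rw [es, hw]
    unfold icp
    ring
  obtain ⟨H, hH, hi⟩ := exists_sep_rel _ (slp_icp_dep g.irr.ne_zero v h0)
  have t1 := tan_deriv g v h0 hv H hH
  have t2 := tan_deriv g' w hw0 hgen H (by rw [es, ei]; exact hH)
  rw [es, ei] at t2
  have hne : aeval ![slp f v, icp f v] (pderiv 1 H) ≠ 0 := by
    intro h
    rw [h, mul_zero] at t1
    obtain ⟨i, hi⟩ := hi
    fin_cases i
    · exact hi t1
    · exact hi h
  have e0 : w 0 = v 0 := mul_right_cancel₀ hne (t2.symm.trans t1)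
  have e1 : w 1 = v 1 := by
    rw [hw, e0]; unfold icp; ring
  have ewv : w = v := by
    ext i; fin_cases i
    · exact e0
    · exact e1
  refine ⟨ewv, ?_⟩
  subst ewv
  have k1 := gen_ker g.irr _ h0 hv
  have k2 := gen_ker g'.irr _ hw0 hv
  rw [k1] at k2
  exact Ideal.span_singleton_eq_span_singleton.1 k2

end
end

section
theorem isAlg_transfer {R S A : Type*} [CommRing R] [CommRing S] [CommRing A] [Algebra R A]
    [Algebra S A] (j : R →+* S) (hj : Function.Injective j)
    (hc : ∀ r, algebraMap S A (j r) = algebraMap R A r) {z : A} (h : IsAlgebraic R z) :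
    IsAlgebraic S z := by
  obtain ⟨p, hp, hz⟩ := h
  refine ⟨p.map j, by rwa [Ne, Polynomial.map_eq_zero_iff hj], ?_⟩
  have : (algebraMap S A).comp j = algebraMap R A := RingHom.ext hc
  rw [Polynomial.aeval_def, Polynomial.eval₂_map, this]
  exact hz

theorem lift_hom {E S M : Type*} [Field E] [Field S] [Field M] [IsAlgClosed M] (e : E →+* S)
    (e' : E →+* M) (h : letI := e.toAlgebra; ∀ z : S, IsAlgebraic E z) :
    ∃ σ : S →+* M, ∀ x, σ (e x) = e' x := by
  letI := e.toAlgebra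
  letI := e'.toAlgebra
  have : Algebra.IsAlgebraic E S := ⟨h⟩
  let σ : S →ₐ[E] M := IsAlgClosed.lift
  exact ⟨σ.toRingHom, fun x => σ.commutes x⟩

section
universe u
variable {k : Type u} [Field k] {f : MvPolynomial (Fin 2) k}
    {F : MvPolynomial (Fin 3) k} {d : ℕ} {Ω : Type u} [Field Ω] [Algebra k Ω]
    {A : Fin 2 → Ω}

/-- the generic line section -/
noncomputable def gline (f : MvPolynomial (Fin 2) k) (A : Fin 2 → Ω) : Polynomial Ω :=
  lineSub (map (algebraMap k Ω) f) (A 0) (A 1)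

theorem gline_eval (τ : Ω) : (gline f A).eval τ = aeval ![τ, A 0 * τ + A 1] f := by
  rw [gline, lineSub_eval, eval_map, aeval_def]

theorem gline_derivative_eval (τ : Ω) : (gline f A).derivative.eval τ =
    aeval ![τ, A 0 * τ + A 1] (pderiv 0 f) + A 0 * aeval ![τ, A 0 * τ + A 1] (pderiv 1 f) := by
  rw [gline, lineSub_derivative, pderiv_map, pderiv_map, Polynomial.eval_add, Polynomial.eval_mul,
    Polynomial.eval_C, lineSub_eval, lineSub_eval, eval_map, eval_map, aeval_def, aeval_def]

theorem alg_range {v : Fin 2 → Ω} (q : MvPolynomial (Fin 2) k) :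
    IsAlgebraic (Algebra.adjoin k (Set.range v)) (aeval v q) := by
  have : aeval v q ∈ Algebra.adjoin k (Set.range v) := by
    rw [Algebra.adjoin_range_eq_range_aeval]; exact ⟨q, rfl⟩
  exact isAlgebraic_algebraMap (⟨_, this⟩ : Algebra.adjoin k (Set.range v))

variable [IsAlgClosed k]

theorem gline_pt (hA : AlgebraicIndependent k A) (τ : Ω) :
    ¬ ∀ i, IsAlgebraic k (![τ, A 0 * τ + A 1] i) := by
  intro h
  obtain ⟨c, hc⟩ := alg_elt (h 0)
  obtain ⟨c', hc'⟩ := alg_elt (h 1)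
  simp at hc hc'
  rw [algebraicIndependent_iff] at hA
  have := hA (X 0 * C c + X 1 - C c') (by
    rw [map_sub, map_add, map_mul, algHom_C, algHom_C, aeval_X, aeval_X, hc, hc', sub_self])
  have h1 := congrArg (coeff (Finsupp.single 1 1)) this
  rw [mul_comm] at h1
  have h3 : ¬ ((0 : Fin 2 →₀ ℕ) = Finsupp.single 1 1) := by
    intro h2
    have h2 := DFunLike.congr_fun h2 1
    simp at h2
  simp [coeff_C_mul, coeff_X, coeff_C, Finsupp.single_eq_single_iff, h3] at h1

theorem gline_natDegree (g : Good f F d) (hA : AlgebraicIndependent k A) :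
    (gline f A).natDegree = d :=
  lineSub_natDegree f g.irr.ne_zero g.tdeg (A 0) (A 1) (hA.transcendental 0)

theorem gline_simple (g : Good f F d) (hA : AlgebraicIndependent k A) (τ : Ω)
    (h : (gline f A).eval τ = 0) : (gline f A).derivative.eval τ ≠ 0 := by
  intro h1
  rw [gline_eval] at h
  rw [gline_derivative_eval] at h1
  have hx := gen_fx g _ h (gline_pt hA τ)
  have e1 : slp f ![τ, A 0 * τ + A 1] = A 0 := by
    rw [slp, div_eq_iff hx]
    linear_combination -h1
  have e2 : icp f ![τ, A 0 * τ + A 1] = A 1 := by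
    rw [icp, e1]; simp
  apply slp_icp_dep g.irr.ne_zero _ h
  rw [e1, e2]
  convert hA using 1
  ext i; fin_cases i <;> rfl

theorem gline_sep [IsAlgClosed Ω] (g : Good f F d) (hA : AlgebraicIndependent k A) :
    (gline f A).Separable := by
  rw [Polynomial.Separable, Polynomial.isCoprime_iff_aeval_ne_zero_of_isAlgClosed Ω Ω]
  intro τ
  rw [Polynomial.coe_aeval_eq_eval]
  by_cases h : (gline f A).eval τ = 0
  · exact Or.inr (gline_simple g hA τ h)
  · exact Or.inl h

theorem second_gen (g : Good f F d) (hA : AlgebraicIndependent k A) {τ₁ τ₂ : Ω} (hne : τ₁ ≠ τ₂)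
    (h1 : (gline f A).eval τ₁ = 0)
    {E : Type u} [Field E] [Algebra k E] [Algebra E Ω] [IsScalarTower k E Ω] (y : Fin 2 → E)
    (hy : ∀ i, algebraMap E Ω (y i) = ![τ₁, A 0 * τ₁ + A 1] i)
    (hE : ∀ e : E, ∃ p q : MvPolynomial (Fin 2) k, e = aeval y p / aeval y q) :
    ¬ ∀ i, IsAlgebraic E (![τ₂, A 0 * τ₂ + A 1] i) := by
  intro hall
  set v := ![τ₁, A 0 * τ₁ + A 1] with hv
  have hyv : (fun i => IsScalarTower.toAlgHom k E Ω (y i)) = v := funext hy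
  have hE' : ∀ e : E, IsAlgebraic (Algebra.adjoin k (Set.range v)) (algebraMap E Ω e) := by
    intro e
    obtain ⟨p, q, rfl⟩ := hE e
    have : ∀ q : MvPolynomial (Fin 2) k, algebraMap E Ω (aeval y q) = aeval v q := by
      intro q
      rw [← hyv, aeval_comp']; rfl
    rw [map_div₀, this, this, div_eq_mul_inv]
    exact (alg_range p).mul (alg_range q).inv
  have key : ∀ z : Ω, IsAlgebraic E z → IsAlgebraic (Algebra.adjoin k (Set.range v)) z := by
    intro z hz
    have hz1 : IsAlgebraic (Algebra.adjoin k (Set.range (algebraMap E Ω))) z := by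
      refine isAlg_transfer ((algebraMap E Ω).codRestrict (Algebra.adjoin k (Set.range (algebraMap E Ω)))
        fun x => Algebra.subset_adjoin ⟨x, rfl⟩) ?_ ?_ hz
      · intro a b hab
        exact (algebraMap E Ω).injective (congrArg Subtype.val hab)
      · intro r; rfl
    exact hz1.adjoin_of_forall_isAlgebraic (by
      rintro x ⟨⟨e, rfl⟩, -⟩
      exact hE' e)
  have ht1 : IsAlgebraic E τ₁ := by
    rw [show τ₁ = algebraMap E Ω (y 0) from (hy 0).symm]; exact isAlgebraic_algebraMap _
  have hx1 : IsAlgebraic E (A 0 * τ₁ + A 1) := by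
    rw [show A 0 * τ₁ + A 1 = algebraMap E Ω (y 1) from (hy 1).symm]; exact isAlgebraic_algebraMap _
  have ht2 : IsAlgebraic E τ₂ := hall 0
  have hx2 : IsAlgebraic E (A 0 * τ₂ + A 1) := hall 1
  have hA0 : IsAlgebraic E (A 0) := by
    have : A 0 = (A 0 * τ₂ + A 1 - (A 0 * τ₁ + A 1)) * (τ₂ - τ₁)⁻¹ := by
      rw [eq_mul_inv_iff_mul_eq₀ (sub_ne_zero.2 hne.symm)]; ring
    rw [this]
    exact (hx2.sub hx1).mul (ht2.sub ht1).inv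
  have hA1 : IsAlgebraic E (A 1) := by
    have : A 1 = A 0 * τ₁ + A 1 - A 0 * τ₁ := by ring
    rw [this]
    exact hx1.sub (hA0.mul ht1)
  have := exch (v := v) hA (by
    intro i
    fin_cases i
    · exact key _ hA0
    · exact key _ hA1)
  rw [algebraicIndependent_iff] at this
  rw [gline_eval] at h1
  exact g.irr.ne_zero (this f h1)

theorem pair_univ (g : Good f F d) (hA : AlgebraicIndependent k A) :
    ∃ (E : Type u) (_ : Field E) (_ : Algebra k E) (y₁ y₂ : Fin 2 → E),
      ∀ τ₁ τ₂ : Ω, τ₁ ≠ τ₂ → (gline f A).eval τ₁ = 0 → (gline f A).eval τ₂ = 0 →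
        ∃ e : E →ₐ[k] Ω, (∀ i, e (y₁ i) = ![τ₁, A 0 * τ₁ + A 1] i) ∧
          (∀ i, e (y₂ i) = ![τ₂, A 0 * τ₂ + A 1] i) := by
  obtain ⟨E₁, _, _, y, hy0, hfrac, hE₁⟩ := exists_FF g.irr
  obtain ⟨E₂, _, _, z, hz0, -, hE₂⟩ := exists_FF (abs_irr (E := E₁) g.irr)
  letI : Algebra k E₂ := ((algebraMap E₁ E₂).comp (algebraMap k E₁)).toAlgebra
  refine ⟨E₂, inferInstance, inferInstance, fun i => algebraMap E₁ E₂ (y i), z, ?_⟩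
  intro τ₁ τ₂ hne h1 h2
  obtain ⟨φ, hφ⟩ := hE₁ Ω ![τ₁, A 0 * τ₁ + A 1] (by rw [← gline_eval]; exact h1) (gline_pt hA τ₁)
  letI : Algebra E₁ Ω := φ.toRingHom.toAlgebra
  have htow : IsScalarTower k E₁ Ω := IsScalarTower.of_algebraMap_eq fun x => (φ.commutes x).symm
  obtain ⟨ψ, hψ⟩ := hE₂ Ω ![τ₂, A 0 * τ₂ + A 1] (by
    rw [aeval_map_algebraMap, ← gline_eval]; exact h2) (second_gen g hA hne h1 y hφ hfrac)
  refine ⟨{ ψ.toRingHom with commutes' := ?_ }, ?_, ?_⟩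
  · intro r
    show ψ (algebraMap E₁ E₂ (algebraMap k E₁ r)) = _
    rw [ψ.commutes]
    exact φ.commutes r
  · intro i
    show ψ (algebraMap E₁ E₂ _) = _
    rw [ψ.commutes]
    exact hφ i
  · exact hψ

theorem two_trans [IsAlgClosed Ω] (g : Good f F d) (hA : AlgebraicIndependent k A)
    (hΩ : ∀ z : Ω, IsAlgebraic (Algebra.adjoin k (Set.range A)) z)
    {τ₁ τ₂ τ₁' τ₂' : Ω} (hne : τ₁ ≠ τ₂) (hne' : τ₁' ≠ τ₂')
    (h1 : (gline f A).eval τ₁ = 0) (h2 : (gline f A).eval τ₂ = 0)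
    (h1' : (gline f A).eval τ₁' = 0) (h2' : (gline f A).eval τ₂' = 0) :
    ∃ σ : Ω →ₐ[k] Ω, (∀ i, σ (A i) = A i) ∧ σ τ₁ = τ₁' ∧ σ τ₂ = τ₂' := by
  obtain ⟨E, _, _, y₁, y₂, hE⟩ := pair_univ g hA
  obtain ⟨e, he1, he2⟩ := hE τ₁ τ₂ hne h1 h2
  obtain ⟨e', he1', he2'⟩ := hE τ₁' τ₂' hne' h1' h2'
  let B : Fin 2 → E := ![(y₂ 1 - y₁ 1) / (y₂ 0 - y₁ 0),
    y₁ 1 - (y₂ 1 - y₁ 1) / (y₂ 0 - y₁ 0) * y₁ 0]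
  have hB : ∀ (e : E →ₐ[k] Ω) (τ₁ τ₂ : Ω), τ₁ ≠ τ₂ → (∀ i, e (y₁ i) = ![τ₁, A 0 * τ₁ + A 1] i) →
      (∀ i, e (y₂ i) = ![τ₂, A 0 * τ₂ + A 1] i) → ∀ i, e (B i) = A i := by
    intro e τ₁ τ₂ hne he1 he2
    have hn : τ₂ - τ₁ ≠ 0 := sub_ne_zero.2 hne.symm
    have a1 : e (y₁ 0) = τ₁ := he1 0
    have a2 : e (y₁ 1) = A 0 * τ₁ + A 1 := he1 1
    have a3 : e (y₂ 0) = τ₂ := he2 0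
    have a4 : e (y₂ 1) = A 0 * τ₂ + A 1 := he2 1
    have b0 : e ((y₂ 1 - y₁ 1) / (y₂ 0 - y₁ 0)) = A 0 := by
      rw [map_div₀, map_sub, map_sub, a1, a2, a3, a4, div_eq_iff hn]; ring
    intro i
    fin_cases i
    · exact b0
    · show e (y₁ 1 - (y₂ 1 - y₁ 1) / (y₂ 0 - y₁ 0) * y₁ 0) = A 1
      rw [map_sub, map_mul, b0, a1, a2]; ring
  have hBe := hB e τ₁ τ₂ hne he1 he2
  have hBe' := hB e' τ₁' τ₂' hne' he1' he2'
  have hle : Algebra.adjoin k (Set.range A) ≤ e.range := by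
    rw [Algebra.adjoin_le_iff]
    rintro _ ⟨i, rfl⟩
    exact ⟨B i, hBe i⟩
  obtain ⟨σ, hσ⟩ := lift_hom e.toRingHom e'.toRingHom (by
    letI := e.toRingHom.toAlgebra
    intro z
    let j0 : Algebra.adjoin k (Set.range A) →ₐ[k] E :=
      (AlgEquiv.ofInjective e e.injective).symm.toAlgHom.comp (Subalgebra.inclusion hle)
    have hj0 : ∀ r, e (j0 r) = r := by
      intro r
      have := (AlgEquiv.ofInjective e e.injective).apply_symm_apply (Subalgebra.inclusion hle r)
      have h3 := congrArg Subtype.val this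
      exact h3
    refine isAlg_transfer j0.toRingHom ?_ ?_ (hΩ z)
    · intro a b hab
      apply Subtype.ext
      rw [← hj0 a, ← hj0 b]
      exact congrArg e hab
    · intro r
      exact hj0 r)
  have hσ' : ∀ x, σ (e x) = e' x := hσ
  refine ⟨{ σ with commutes' := ?_ }, ?_, ?_, ?_⟩
  · intro r
    show σ _ = _
    exact (congrArg σ (e.commutes r).symm).trans ((hσ' _).trans (e'.commutes r))
  · intro i
    show σ (A i) = A i
    conv_lhs => rw [← hBe i]
    rw [hσ', hBe']
  · show σ τ₁ = _
    rw [show τ₁ = e (y₁ 0) from (he1 0).symm, hσ']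
    exact he1' 0
  · show σ τ₂ = _
    rw [show τ₂ = e (y₂ 0) from (he2 0).symm, hσ']
    exact he2' 0
end
end

section
section
universe u
variable {E : Type u} [Field E]

theorem cc_eval (G : Polynomial (PowerSeries E)) (z : PowerSeries E) :
    PowerSeries.constantCoeff (G.eval z) =
      (G.map (PowerSeries.constantCoeff (R := E))).eval (PowerSeries.constantCoeff z) := by
  rw [Polynomial.eval_map, Polynomial.eval, Polynomial.hom_eval₂, RingHom.comp_id]

theorem hensel_ps (G : Polynomial (PowerSeries E)) (hG : G.Monic) (c : E)
    (h0 : (G.map (PowerSeries.constantCoeff (R := E))).eval c = 0)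
    (h1 : (G.map (PowerSeries.constantCoeff (R := E))).derivative.eval c ≠ 0) :
    ∃ ρ : PowerSeries E, G.eval ρ = 0 ∧ PowerSeries.constantCoeff ρ = c := by
  have hmem : ∀ z : PowerSeries E, z ∈ Ideal.span {(PowerSeries.X : PowerSeries E)} ↔
      PowerSeries.constantCoeff z = 0 := by
    intro z
    rw [Ideal.mem_span_singleton, PowerSeries.X_dvd_iff]
  have := HenselianRing.is_henselian (I := Ideal.span {(PowerSeries.X : PowerSeries E)}) G hG
    (PowerSeries.C c) (by rw [hmem, cc_eval]; simpa using h0) (by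
      apply IsUnit.map
      rw [PowerSeries.isUnit_iff_constantCoeff, cc_eval, ← Polynomial.derivative_map]
      simpa using h1)
  obtain ⟨a, ha, hac⟩ := this
  refine ⟨a, ha, ?_⟩
  rw [hmem] at hac
  simpa [sub_eq_zero] using hac

theorem hensel_factor (G : Polynomial (PowerSeries E)) (hG : G.Monic) (S : Finset E)
    (hS : ∀ c ∈ S, (G.map (PowerSeries.constantCoeff (R := E))).eval c = 0 ∧
      (G.map (PowerSeries.constantCoeff (R := E))).derivative.eval c ≠ 0) :
    ∃ (ρ : E → PowerSeries E) (Q : Polynomial (PowerSeries E)), Q.Monic ∧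
      G = (∏ c ∈ S, (Polynomial.X - Polynomial.C (ρ c))) * Q ∧
      ∀ c ∈ S, PowerSeries.constantCoeff (ρ c) = c := by
  have : ∀ c, ∃ ρ : PowerSeries E, c ∈ S → G.eval ρ = 0 ∧ PowerSeries.constantCoeff ρ = c := by
    intro c
    by_cases h : c ∈ S
    · obtain ⟨ρ, h⟩ := hensel_ps G hG c (hS c h).1 (hS c h).2
      exact ⟨ρ, fun _ => h⟩
    · exact ⟨0, fun h' => absurd h' h⟩
  choose ρ hρ using this
  have hinj : Set.InjOn ρ S := by
    intro a ha b hb hab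
    rw [← (hρ a ha).2, ← (hρ b hb).2, hab]
  have hdvd : (∏ c ∈ S, (Polynomial.X - Polynomial.C (ρ c))) ∣ G := by
    have : (S.val.map ρ) ≤ G.roots := by
      rw [Multiset.le_iff_subset]
      · intro z hz
        rw [Multiset.mem_map] at hz
        obtain ⟨c, hc, rfl⟩ := hz
        rw [Polynomial.mem_roots hG.ne_zero]
        exact (hρ c hc).1
      · exact Multiset.Nodup.map_on (fun a ha b hb h => hinj ha hb h) S.nodup
    have h2 := (Multiset.prod_X_sub_C_dvd_iff_le_roots hG.ne_zero _).2 this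
    rw [Multiset.map_map] at h2
    exact h2
  obtain ⟨Q, hQ⟩ := hdvd
  refine ⟨ρ, Q, ?_, hQ, fun c hc => (hρ c hc).2⟩
  exact Polynomial.Monic.of_mul_monic_left
    (Polynomial.monic_prod_of_monic _ _ fun c _ => Polynomial.monic_X_sub_C _) (hQ ▸ hG)

theorem local_split [IsAlgClosed E] (G : Polynomial (PowerSeries E)) (hG : G.Monic)
    (hs : (G.map (PowerSeries.constantCoeff (R := E))).Separable)
    {M : Type u} [Field M] (ι : PowerSeries E →+* M) (z : M) (hz : (G.map ι).eval z = 0) :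
    ∃ ρ, ι ρ = z := by
  classical
  set Gb := G.map (PowerSeries.constantCoeff (R := E)) with hGb
  have hGbm : Gb.Monic := hG.map _
  obtain ⟨ρ, Q, hQ, hGQ, -⟩ := hensel_factor G hG Gb.roots.toFinset (by
    intro c hc
    rw [Multiset.mem_toFinset, Polynomial.mem_roots hGbm.ne_zero] at hc
    exact ⟨hc, fun h => hs.eval₂_derivative_ne_zero (RingHom.id E) (x := c) hc h⟩)
  have hdeg : Gb.natDegree = Gb.roots.toFinset.card := by
    rw [Multiset.toFinset_card_of_nodup (Polynomial.nodup_roots hs)]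
    exact Polynomial.splits_iff_card_roots.1 (IsAlgClosed.splits Gb) |>.symm
  have h1 : G.natDegree = Gb.roots.toFinset.card + Q.natDegree := by
    conv_lhs => rw [hGQ]
    rw [Polynomial.Monic.natDegree_mul (Polynomial.monic_prod_of_monic _ _
      fun c _ => Polynomial.monic_X_sub_C _) hQ, Polynomial.natDegree_finsetProd_X_sub_C_eq_card]
  have h2 : G.natDegree = Gb.natDegree := (hG.natDegree_map _).symm
  have hQ1 : Q = 1 := hQ.natDegree_eq_zero.1 (by omega)
  rw [hGQ, hQ1, mul_one, Polynomial.map_prod, Polynomial.eval_prod, Finset.prod_eq_zero_iff] at hz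
  obtain ⟨c, -, hc⟩ := hz
  refine ⟨ρ c, ?_⟩
  simp [sub_eq_zero] at hc
  exact hc.symm

theorem quad_part [IsAlgClosed E] (G : Polynomial (PowerSeries E)) (hG : G.Monic) (t : E)
    (h0 : (G.map (PowerSeries.constantCoeff (R := E))).eval t = 0)
    (h1 : (G.map (PowerSeries.constantCoeff (R := E))).derivative.eval t = 0)
    (h2 : (G.map (PowerSeries.constantCoeff (R := E))).derivative.derivative.eval t ≠ 0)
    (hs : ∀ c, (G.map (PowerSeries.constantCoeff (R := E))).eval c = 0 → c ≠ t →
      (G.map (PowerSeries.constantCoeff (R := E))).derivative.eval c ≠ 0)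
    (hno : ∀ ρ, PowerSeries.constantCoeff ρ = t → G.eval ρ ≠ 0) :
    ∃ (S : Finset (PowerSeries E)) (Q : Polynomial (PowerSeries E)), Q.Monic ∧
      G = (∏ c ∈ S, (Polynomial.X - Polynomial.C c)) * Q ∧ Q.natDegree = 2 ∧
      ∀ ρ, Q.eval ρ ≠ 0 := by
  classical
  set Gb := G.map (PowerSeries.constantCoeff (R := E)) with hGb
  have hGbm : Gb.Monic := hG.map _
  obtain ⟨ρ, Q, hQ, hGQ, hρ⟩ := hensel_factor G hG (Gb.roots.toFinset.erase t) (by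
    intro c hc
    rw [Finset.mem_erase, Multiset.mem_toFinset, Polynomial.mem_roots hGbm.ne_zero] at hc
    exact ⟨hc.2, hs c hc.2 hc.1⟩)
  set S := Gb.roots.toFinset.erase t with hS
  have hinj : Set.InjOn ρ S := by
    intro a ha b hb hab
    rw [← hρ a ha, ← hρ b hb, hab]
  set Qb := Q.map (PowerSeries.constantCoeff (R := E)) with hQb
  set P : Polynomial E := ∏ c ∈ S, (Polynomial.X - Polynomial.C c) with hP
  have hPQ : Gb = P * Qb := by
    rw [hGb, hGQ, Polynomial.map_mul, Polynomial.map_prod]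
    congr 1
    refine Finset.prod_congr rfl fun c hc => ?_
    rw [Polynomial.map_sub, Polynomial.map_X, Polynomial.map_C, hρ c hc]
  have hQbm : Qb.Monic := hQ.map _
  have hPt : P.eval t ≠ 0 := by
    rw [hP, Polynomial.eval_prod, Finset.prod_ne_zero_iff]
    intro c hc
    rw [Polynomial.eval_sub, Polynomial.eval_X, Polynomial.eval_C, sub_ne_zero]
    rintro rfl
    exact Finset.notMem_erase _ _ hc
  have hroot : ∀ c, Qb.eval c = 0 → c = t := by
    intro c hc
    by_contra hct
    have hGc : Gb.eval c = 0 := by rw [hPQ, Polynomial.eval_mul, hc, mul_zero]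
    have hcS : c ∈ S := by
      rw [hS, Finset.mem_erase, Multiset.mem_toFinset, Polynomial.mem_roots hGbm.ne_zero]
      exact ⟨hct, hGc⟩
    have hPc : P.eval c = 0 := by
      rw [hP, Polynomial.eval_prod]
      exact Finset.prod_eq_zero hcS (by simp)
    apply hs c hGc hct
    rw [hPQ, Polynomial.derivative_mul, Polynomial.eval_add, Polynomial.eval_mul,
      Polynomial.eval_mul, hc, hPc]
    ring
  have hQpow : Qb = (Polynomial.X - Polynomial.C t) ^ Qb.natDegree := by
    have e1 := (IsAlgClosed.splits Qb).eq_prod_roots_of_monic hQbm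
    have e2 : Qb.roots = Multiset.replicate Qb.natDegree t := by
      rw [Multiset.eq_replicate]
      exact ⟨Polynomial.splits_iff_card_roots.1 (IsAlgClosed.splits Qb), fun b hb =>
        hroot b (by rwa [Polynomial.mem_roots hQbm.ne_zero] at hb)⟩
    rw [e2, Multiset.map_replicate, Multiset.prod_replicate] at e1
    exact e1
  have hdeg : Qb.natDegree = 2 := by
    generalize Qb.natDegree = m at hQpow
    rw [hQpow] at hPQ
    match m with
    | 0 => exact absurd h0 (by rw [hPQ]; simpa using hPt)
    | 1 => exact absurd h1 (by rw [hPQ]; simpa using hPt)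
    | 2 => rfl
    | n + 3 =>
      refine absurd ?_ h2
      rw [hPQ, pow_succ, pow_succ, pow_succ]
      simp
  refine ⟨S.image ρ, Q, hQ, ?_, ?_, ?_⟩
  · rw [Finset.prod_image hinj]; exact hGQ
  · rw [← hdeg]; exact (hQ.natDegree_map _).symm
  · intro z hz
    apply hno z
    · apply hroot
      rw [hQb, ← cc_eval, hz, map_zero]
    · rw [hGQ, Polynomial.eval_mul, hz, mul_zero]

theorem local_transp [IsAlgClosed E] (G : Polynomial (PowerSeries E)) (hG : G.Monic) (t : E)
    (h0 : (G.map (PowerSeries.constantCoeff (R := E))).eval t = 0)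
    (h1 : (G.map (PowerSeries.constantCoeff (R := E))).derivative.eval t = 0)
    (h2 : (G.map (PowerSeries.constantCoeff (R := E))).derivative.derivative.eval t ≠ 0)
    (hs : ∀ c, (G.map (PowerSeries.constantCoeff (R := E))).eval c = 0 → c ≠ t →
      (G.map (PowerSeries.constantCoeff (R := E))).derivative.eval c ≠ 0)
    (hno : ∀ ρ, PowerSeries.constantCoeff ρ = t → G.eval ρ ≠ 0)
    {L M : Type u} [Field L] [Field M] [IsAlgClosed M] [Algebra (PowerSeries E) L]
    [IsFractionRing (PowerSeries E) L] [Algebra L M] [Algebra.IsAlgebraic L M]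
    [Algebra (PowerSeries E) M] [IsScalarTower (PowerSeries E) L M]
    (hsep : (G.map (algebraMap (PowerSeries E) M)).Separable) :
    ∃ (φ : M ≃ₐ[PowerSeries E] M) (ρ ρ' : M), ρ ≠ ρ' ∧
      (G.map (algebraMap (PowerSeries E) M)).eval ρ = 0 ∧
      (G.map (algebraMap (PowerSeries E) M)).eval ρ' = 0 ∧ φ ρ = ρ' ∧ φ ρ' = ρ ∧
      ∀ z, (G.map (algebraMap (PowerSeries E) M)).eval z = 0 → z ≠ ρ → z ≠ ρ' → φ z = z := by
  obtain ⟨S, Q, hQ, hGQ, hQd, hQn⟩ := quad_part G hG t h0 h1 h2 hs hno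
  set QM := Q.map (algebraMap (PowerSeries E) M) with hQM
  set GM := G.map (algebraMap (PowerSeries E) M) with hGM
  have hQMm : QM.Monic := hQ.map _
  have hQMd : QM.natDegree = 2 := (hQ.natDegree_map _).trans hQd
  have hsplit := IsAlgClosed.splits QM
  have hcard := Polynomial.splits_iff_card_roots.1 hsplit
  rw [hQMd, Multiset.card_eq_two] at hcard
  obtain ⟨ρ, ρ', hr⟩ := hcard
  have hQGd : QM ∣ GM := by
    rw [hGM, hGQ, Polynomial.map_mul]; exact dvd_mul_left _ _
  have hQsep : QM.Separable := hsep.of_dvd hQGd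
  have hne : ρ ≠ ρ' := by
    have := Polynomial.nodup_roots hQsep
    rw [hr] at this
    simpa using this
  have hmem : ∀ z, QM.eval z = 0 ↔ z = ρ ∨ z = ρ' := by
    intro z
    have : z ∈ QM.roots ↔ QM.eval z = 0 := Polynomial.mem_roots hQMm.ne_zero
    rw [← this, hr]; simp
  have hGr : ∀ z, QM.eval z = 0 → GM.eval z = 0 := fun z hz => by
    obtain ⟨q, hq⟩ := hQGd
    rw [hq, Polynomial.eval_mul, hz, zero_mul]
  -- irreducibility over L
  set QL := Q.map (algebraMap (PowerSeries E) L) with hQL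
  have hQLm : QL.Monic := hQ.map _
  have hQLM : QL.map (algebraMap L M) = QM := by
    rw [hQL, hQM, Polynomial.map_map, ← IsScalarTower.algebraMap_eq]
  have hirr : Irreducible QL := by
    have hd : QL.natDegree = 2 := (hQ.natDegree_map _).trans hQd
    rw [Polynomial.irreducible_iff_roots_eq_zero_of_degree_le_three (by omega) (by omega)]
    rw [Multiset.eq_zero_iff_forall_notMem]
    intro z hz
    rw [Polynomial.mem_roots hQLm.ne_zero, Polynomial.IsRoot.def, hQL,
      Polynomial.eval_map_algebraMap] at hz
    obtain ⟨y, rfl⟩ := isInteger_of_is_root_of_monic hQ hz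
    rw [Polynomial.aeval_algebraMap_apply, FaithfulSMul.algebraMap_eq_zero_iff] at hz
    exact hQn y hz
  have hmin : ∀ z, QM.eval z = 0 → minpoly L z = QL := by
    intro z hz
    refine (minpoly.eq_of_irreducible_of_monic hirr ?_ hQLm).symm
    rw [← Polynomial.eval_map_algebraMap, hQLM, hz]
  have hρ := (hmem ρ).2 (Or.inl rfl)
  have hρ' := (hmem ρ').2 (Or.inr rfl)
  have hconj : IsConjRoot L ρ' ρ := (hmin ρ' hρ').trans (hmin ρ hρ).symm
  have : IsAlgClosure L M := ⟨inferInstance, inferInstance⟩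
  have : Normal L M := IsAlgClosure.normal L M
  obtain ⟨φ, hφ⟩ := isConjRoot_iff_exists_algEquiv.1 hconj
  have hφQ : ∀ z, QM.eval z = 0 → QM.eval (φ z) = 0 := by
    intro z hz
    rw [← hQLM, Polynomial.eval_map_algebraMap] at hz ⊢
    have h3 := Polynomial.aeval_algHom_apply φ.toAlgHom z QL
    rw [hz, map_zero] at h3
    exact h3
  have hφρ' : φ ρ' = ρ := by
    rcases (hmem _).1 (hφQ ρ' hρ') with h | h
    · exact h
    · exact absurd (φ.injective (hφ.trans h.symm)) hne
  refine ⟨φ.restrictScalars (PowerSeries E), ρ, ρ', hne, hGr _ hρ, hGr _ hρ', hφ, hφρ', ?_⟩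
  intro z hz hz1 hz2
  rw [hGM, hGQ, Polynomial.map_mul, Polynomial.eval_mul, mul_eq_zero] at hz
  rcases hz with hz | hz
  · rw [Polynomial.map_prod, Polynomial.eval_prod, Finset.prod_eq_zero_iff] at hz
    obtain ⟨c, -, hc⟩ := hz
    simp [sub_eq_zero] at hc
    rw [hc]
    exact (φ.restrictScalars (PowerSeries E)).commutes c
  · rcases (hmem z).1 hz with h | h
    · exact absurd h hz1
    · exact absurd h hz2
end
end

section
section
universe u
variable {k : Type u} [Field k] {E : Type u} [Field E] [Algebra k E]

/-- the deformed tangent line section -/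
noncomputable def gps (f : MvPolynomial (Fin 2) k) (a b : E) : Polynomial (PowerSeries E) :=
  lineSub (map (algebraMap k (PowerSeries E)) f) (PowerSeries.C a) (PowerSeries.C b + PowerSeries.X)

theorem gps_red (f : MvPolynomial (Fin 2) k) (a b : E) :
    (gps f a b).map (PowerSeries.constantCoeff (R := E)) = gline f ![a, b] := by
  rw [gps, lineSub_map, gline, map_map]
  have : (PowerSeries.constantCoeff (R := E)).comp (algebraMap k (PowerSeries E)) =
      algebraMap k E := by
    apply RingHom.ext
    intro x
    simp [PowerSeries.algebraMap_apply]
  rw [this]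
  simp

theorem gps_map (f : MvPolynomial (Fin 2) k) (a b : E) {M : Type u} [Field M] [Algebra k M]
    [Algebra (PowerSeries E) M] [IsScalarTower k (PowerSeries E) M] :
    (gps f a b).map (algebraMap (PowerSeries E) M) =
      gline f ![algebraMap (PowerSeries E) M (PowerSeries.C a),
        algebraMap (PowerSeries E) M (PowerSeries.C b + PowerSeries.X)] := by
  rw [gps, lineSub_map, gline, map_map, ← IsScalarTower.algebraMap_eq]
  rfl

theorem trans_C {a : E} (ha : Transcendental k a) : Transcendental k (PowerSeries.C a) := by
  have : Function.Injective (Algebra.algHom k E (PowerSeries E)) := (algebraMap E (PowerSeries E)).injective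
  exact fun h => ha ((isAlgebraic_algHom_iff (Algebra.algHom k E (PowerSeries E)) this).1 h)

theorem ind_ps {a : E} (b : E) (ha : Transcendental k a) :
    AlgebraicIndependent k ![PowerSeries.C a, PowerSeries.C b + (PowerSeries.X : PowerSeries E)] := by
  have h1 : AlgebraicIndependent k ![(PowerSeries.C a : PowerSeries E)] :=
    algebraicIndependent_iff_transcendental.2 (trans_C ha)
  have h2 : Transcendental (Algebra.adjoin k (Set.range ![(PowerSeries.C a : PowerSeries E)]))
      (PowerSeries.C b + (PowerSeries.X : PowerSeries E)) := by
    intro h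
    have hle : Algebra.adjoin k (Set.range ![(PowerSeries.C a : PowerSeries E)]) ≤
        (Algebra.algHom k E (PowerSeries E)).range := by
      rw [Algebra.adjoin_le_iff]
      rintro _ ⟨i, rfl⟩
      fin_cases i
      exact ⟨a, rfl⟩
    have hinj : Function.Injective (Algebra.algHom k E (PowerSeries E)) :=
      (algebraMap E (PowerSeries E)).injective
    let e := AlgEquiv.ofInjective _ hinj
    have h3 : IsAlgebraic E (PowerSeries.C b + (PowerSeries.X : PowerSeries E)) := by
      have hj0 : ∀ r : Algebra.adjoin k (Set.range ![(PowerSeries.C a : PowerSeries E)]),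
          algebraMap E (PowerSeries E) (e.symm (Subalgebra.inclusion hle r)) = r := by
        intro r
        exact congrArg Subtype.val (e.apply_symm_apply (Subalgebra.inclusion hle r))
      refine isAlg_transfer (e.symm.toAlgHom.comp (Subalgebra.inclusion hle)).toRingHom ?_ ?_ h
      · exact e.symm.injective.comp (Subalgebra.inclusion_injective hle)
      · intro r; exact hj0 r
    have h4 : IsAlgebraic E (PowerSeries.X : PowerSeries E) := by
      have := h3.sub (isAlgebraic_algebraMap (R := E) (A := PowerSeries E) b)
      rwa [show algebraMap E (PowerSeries E) b = PowerSeries.C b from rfl, add_sub_cancel_left] at this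
    obtain ⟨p, hp, h5⟩ := h4
    apply hp
    have : ∀ p : Polynomial E,
        Polynomial.aeval (PowerSeries.X : PowerSeries E) p = (p : PowerSeries E) := by
      intro p
      induction p using Polynomial.induction_on' with
      | add p q hp hq => rw [map_add, hp, hq, Polynomial.coe_add]
      | monomial n c =>
        rw [← Polynomial.C_mul_X_pow_eq_monomial, map_mul, map_pow, Polynomial.aeval_X,
          Polynomial.aeval_C, Polynomial.coe_mul, Polynomial.coe_pow, Polynomial.coe_X,
          Polynomial.coe_C]
        rfl
    rw [this] at h5
    exact_mod_cast h5
  have h3 := AlgebraicIndependent.option_iff.2 ⟨h1, h2⟩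
  rw [← algebraicIndependent_equiv (finSuccEquivLast (n := 1))] at h3
  convert h3 using 1
  ext i
  fin_cases i
  · rfl
  · rfl

end

section
universe u
variable {k : Type u} [Field k] [IsAlgClosed k] {f : MvPolynomial (Fin 2) k}
    {F : MvPolynomial (Fin 3) k} {d : ℕ} {f' : MvPolynomial (Fin 2) k}
    {F' : MvPolynomial (Fin 3) k} {d' : ℕ} {E : Type u} [Field E] [Algebra k E]

theorem exists_monic (g : Good f F d) (a b : E) (ha : Transcendental k a) :
    ∃ (G : Polynomial (PowerSeries E)) (c : PowerSeries E), IsUnit c ∧ G.Monic ∧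
      gps f a b = Polynomial.C c * G := by
  have h1 : (gps f a b).natDegree = d := lineSub_natDegree f g.irr.ne_zero g.tdeg _ _ (trans_C ha)
  have h2 : (gline f ![a, b]).natDegree = d :=
    lineSub_natDegree f g.irr.ne_zero g.tdeg _ _ ha
  have h3 : IsUnit (gps f a b).leadingCoeff := by
    rw [PowerSeries.isUnit_iff_constantCoeff, Polynomial.leadingCoeff, h1, ← Polynomial.coeff_map,
      gps_red, ← h2]
    apply IsUnit.mk0
    show (gline f ![a, b]).leadingCoeff ≠ 0
    rw [Ne, Polynomial.leadingCoeff_eq_zero]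
    intro h
    rw [h, Polynomial.natDegree_zero] at h2
    have := g.two_le
    omega
  obtain ⟨c, hc⟩ := h3
  refine ⟨Polynomial.C (↑c⁻¹ : PowerSeries E) * gps f a b, c, c.isUnit, ?_, ?_⟩
  · rw [Polynomial.Monic, Polynomial.leadingCoeff_C_mul_of_isUnit c⁻¹.isUnit, ← hc, Units.inv_mul]
  · rw [← mul_assoc, ← Polynomial.C_mul, Units.mul_inv, Polynomial.C_1, one_mul]

/-- other curves split -/
theorem other_curve [IsAlgClosed E] (g : Good f F d) (g' : Good f' F' d') (hna : ¬ Associated f f')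
    (v : Fin 2 → E) (h0 : aeval v f = 0) (hv : ¬ ∀ i, IsAlgebraic k (v i))
    {M : Type u} [Field M] [Algebra (PowerSeries E) M] (z : M)
    (hz : ((gps f' (slp f v) (icp f v)).map (algebraMap (PowerSeries E) M)).eval z = 0) :
    ∃ ρ, algebraMap (PowerSeries E) M ρ = z := by
  obtain ⟨G, c, hc, hG, hGc⟩ := exists_monic g' (slp f v) (icp f v) (slp_trans g v h0 hv)
  have hred := gps_red f' (slp f v) (icp f v)
  refine local_split G hG ?_ (algebraMap (PowerSeries E) M) z ?_
  · have : (gline f' ![slp f v, icp f v]).Separable := by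
      rw [Polynomial.Separable, Polynomial.isCoprime_iff_aeval_ne_zero_of_isAlgClosed E E]
      intro τ
      rw [Polynomial.coe_aeval_eq_eval]
      by_contra! hcon
      rw [gline_eval, gline_derivative_eval] at hcon
      exact hna (no_other_tangent g g' v h0 hv _ rfl hcon.1 hcon.2).2
    rw [← hred, hGc, Polynomial.map_mul] at this
    exact this.of_mul_right
  · rw [hGc, Polynomial.map_mul, Polynomial.eval_mul, Polynomial.map_C, Polynomial.eval_C,
      mul_eq_zero] at hz
    exact hz.resolve_left (hc.map (algebraMap (PowerSeries E) M)).ne_zero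

theorem no_lift (g : Good f F d) 
    (v : Fin 2 → E) (h0 : aeval v f = 0) (hv : ¬ ∀ i, IsAlgebraic k (v i))
    (ρ : PowerSeries E) (hρ : PowerSeries.constantCoeff ρ = v 0) :
    (gps f (slp f v) (icp f v)).eval ρ ≠ 0 := by
  intro h
  have hx := gen_fx g v h0 hv
  rw [gps, lineSub_eval, eval_map, ← aeval_def] at h
  set w : Fin 2 → PowerSeries E := ![ρ, PowerSeries.C (slp f v) * ρ +
    (PowerSeries.C (icp f v) + PowerSeries.X)] with hw
  let D : Derivation k (PowerSeries E) (PowerSeries E) := (PowerSeries.derivative E).restrictScalars k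
  have hD := deriv_aeval D w f
  rw [h, map_zero, Fin.sum_univ_two] at hD
  have e0 : D (w 0) = PowerSeries.derivative E ρ := rfl
  have e1 : D (w 1) = PowerSeries.C (slp f v) * PowerSeries.derivative E ρ + 1 := by
    show PowerSeries.derivative E (PowerSeries.C (slp f v) * ρ +
      (PowerSeries.C (icp f v) + PowerSeries.X)) = _
    simp
  have hcc : ∀ q : MvPolynomial (Fin 2) k, PowerSeries.constantCoeff (aeval w q) = aeval v q := by
    intro q
    let π : PowerSeries E →ₐ[k] E := { PowerSeries.constantCoeff (R := E) with
      commutes' := fun r => by simp [PowerSeries.algebraMap_apply] }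
    have : (fun i => π (w i)) = v := by
      ext i
      fin_cases i
      · exact hρ
      · show PowerSeries.constantCoeff (PowerSeries.C (slp f v) * ρ +
          (PowerSeries.C (icp f v) + PowerSeries.X)) = v 1
        simp [hρ, icp]
    have h2 : π (aeval w q) = aeval (fun i => π (w i)) q := by
      rw [← AlgHom.comp_apply, comp_aeval]
    rw [this] at h2
    exact h2
  have h3 := congrArg PowerSeries.constantCoeff hD
  rw [e0, e1] at h3
  simp only [map_add, map_mul, map_zero, map_one, hcc, PowerSeries.constantCoeff_C] at h3
  have h4 : slp f v * aeval v (pderiv 1 f) = - aeval v (pderiv 0 f) := by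
    rw [slp, div_mul_cancel₀ _ hx]
  apply hx
  linear_combination -h3 - PowerSeries.constantCoeff (PowerSeries.derivative E ρ) * h4

/-- the transposition at a simple tangent -/
theorem own_curve [IsAlgClosed E] (g : Good f F d)
    (v : Fin 2 → E) (h0 : aeval v f = 0) (hv : ¬ ∀ i, IsAlgebraic k (v i))
    {L M : Type u} [Field L] [Field M] [IsAlgClosed M] [Algebra (PowerSeries E) L]
    [IsFractionRing (PowerSeries E) L] [Algebra L M] [Algebra.IsAlgebraic L M]
    [Algebra (PowerSeries E) M] [IsScalarTower (PowerSeries E) L M]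
    (hsep : ((gps f (slp f v) (icp f v)).map (algebraMap (PowerSeries E) M)).Separable) :
    ∃ (φ : M ≃ₐ[PowerSeries E] M) (ρ ρ' : M), ρ ≠ ρ' ∧
      ((gps f (slp f v) (icp f v)).map (algebraMap (PowerSeries E) M)).eval ρ = 0 ∧
      ((gps f (slp f v) (icp f v)).map (algebraMap (PowerSeries E) M)).eval ρ' = 0 ∧
      φ ρ = ρ' ∧ φ ρ' = ρ ∧
      ∀ z, ((gps f (slp f v) (icp f v)).map (algebraMap (PowerSeries E) M)).eval z = 0 →
        z ≠ ρ → z ≠ ρ' → φ z = z := by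
  obtain ⟨G, c, hc, hG, hGc⟩ := exists_monic g (slp f v) (icp f v) (slp_trans g v h0 hv)
  have hred := gps_red f (slp f v) (icp f v)
  set c0 := PowerSeries.constantCoeff c with hc0
  have hc0n : c0 ≠ 0 := ((PowerSeries.isUnit_iff_constantCoeff).1 hc).ne_zero
  set Gb := G.map (PowerSeries.constantCoeff (R := E)) with hGb
  have hg : gline f ![slp f v, icp f v] = Polynomial.C c0 * Gb := by
    rw [← hred, hGc, Polynomial.map_mul, Polynomial.map_C]
  have ev0 : ∀ z : M, ((gps f (slp f v) (icp f v)).map (algebraMap (PowerSeries E) M)).eval z = 0 ↔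
      (G.map (algebraMap (PowerSeries E) M)).eval z = 0 := by
    intro z
    rw [hGc, Polynomial.map_mul, Polynomial.eval_mul, Polynomial.map_C, Polynomial.eval_C,
      mul_eq_zero, or_iff_right (hc.map (algebraMap (PowerSeries E) M)).ne_zero]
  have gb0 : ∀ z, Gb.eval z = 0 ↔ aeval ![z, slp f v * z + icp f v] f = 0 := by
    intro z
    have : (gline f ![slp f v, icp f v]).eval z = c0 * Gb.eval z := by rw [hg]; simp
    rw [gline_eval] at this
    change aeval ![z, slp f v * z + icp f v] f = _ at this
    rw [this, mul_eq_zero, or_iff_right hc0n]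
  have gb1 : ∀ z, Gb.derivative.eval z = 0 ↔ aeval ![z, slp f v * z + icp f v] (pderiv 0 f) +
      slp f v * aeval ![z, slp f v * z + icp f v] (pderiv 1 f) = 0 := by
    intro z
    have : (gline f ![slp f v, icp f v]).derivative.eval z = c0 * Gb.derivative.eval z := by
      rw [hg]; simp
    rw [gline_derivative_eval] at this
    change aeval ![z, slp f v * z + icp f v] (pderiv 0 f) +
      slp f v * aeval ![z, slp f v * z + icp f v] (pderiv 1 f) = _ at this
    rw [this, mul_eq_zero, or_iff_right hc0n]
  have hvv : ![v 0, slp f v * v 0 + icp f v] = v := by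
    ext i; fin_cases i
    · rfl
    · show slp f v * v 0 + (v 1 - slp f v * v 0) = v 1
      ring
  have hx := gen_fx g v h0 hv
  have h4 : slp f v * aeval v (pderiv 1 f) = - aeval v (pderiv 0 f) := by
    rw [slp, div_mul_cancel₀ _ hx]
  simp only [ev0]
  refine local_transp (L := L) G hG (v 0) ?_ ?_ ?_ ?_ ?_ ?_
  · rw [gb0, hvv, h0]
  · rw [gb1, hvv, h4]; ring
  · intro h
    have e : (gline f ![slp f v, icp f v]).derivative.derivative.eval (v 0) = 0 := by
      rw [hg]; simp only [Polynomial.derivative_C_mul, Polynomial.eval_mul, hGb, h, mul_zero]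
    have e2 : (gline f ![slp f v, icp f v]).derivative =
        gline (pderiv 0 f) ![slp f v, icp f v] +
          Polynomial.C (slp f v) * gline (pderiv 1 f) ![slp f v, icp f v] := by
      rw [gline, lineSub_derivative, pderiv_map, pderiv_map]; rfl
    rw [e2, Polynomial.derivative_add, Polynomial.derivative_C_mul, Polynomial.eval_add,
      Polynomial.eval_mul, Polynomial.eval_C, gline_derivative_eval, gline_derivative_eval] at e
    change aeval ![v 0, slp f v * v 0 + icp f v] (pderiv 0 (pderiv 0 f)) +
      slp f v * aeval ![v 0, slp f v * v 0 + icp f v] (pderiv 1 (pderiv 0 f)) +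
      slp f v * (aeval ![v 0, slp f v * v 0 + icp f v] (pderiv 0 (pderiv 1 f)) +
      slp f v * aeval ![v 0, slp f v * v 0 + icp f v] (pderiv 1 (pderiv 1 f))) = 0 at e
    rw [hvv, pderiv_pderiv_comm 0 1] at e
    apply gen_hess g v h0 hv
    rw [hess]
    simp only [map_add, map_sub, map_mul, map_pow, map_ofNat]
    have h5 : aeval v (pderiv 0 f) = - (slp f v * aeval v (pderiv 1 f)) := by rw [h4, neg_neg]
    rw [h5]
    linear_combination (aeval v (pderiv 1 f)) ^ 2 * e
  · intro z hz hzv h1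
    rw [gb0] at hz
    rw [gb1] at h1
    exact hzv (congrFun (no_other_tangent g g v h0 hv _ rfl hz h1).1 0)
  · intro ρ hρ h
    apply no_lift g v h0 hv ρ hρ
    rw [hGc, Polynomial.eval_mul, h, mul_zero]
  · rw [hGc, Polynomial.map_mul] at hsep
    exact hsep.of_mul_right
end
end

section
section
universe u
variable {k : Type u} [Field k] {f : MvPolynomial (Fin 2) k}
    {F : MvPolynomial (Fin 3) k} {d : ℕ} {Ω : Type u} [Field Ω] [Algebra k Ω]
    {A : Fin 2 → Ω}

theorem gline_map {M : Type u} [Field M] [Algebra k M] (σ : Ω →ₐ[k] M) (f : MvPolynomial (Fin 2) k)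
    (A : Fin 2 → Ω) : (gline f A).map σ.toRingHom = gline f (fun i => σ (A i)) := by
  rw [gline, lineSub_map, gline, map_map]
  have : σ.toRingHom.comp (algebraMap k Ω) = algebraMap k M := RingHom.ext σ.commutes
  rw [this]
  rfl

theorem gline_hom {M : Type u} [Field M] [Algebra k M] (σ : Ω →ₐ[k] M) {f : MvPolynomial (Fin 2) k}
    {A : Fin 2 → Ω} (z : Ω) : (gline f (fun i => σ (A i))).eval (σ z) = σ ((gline f A).eval z) := by
  rw [← gline_map, Polynomial.eval_map]
  exact Polynomial.eval₂_at_apply σ.toRingHom z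

theorem lift_A {M : Type u} [Field M] [Algebra k M] [IsAlgClosed M]
    (hA : AlgebraicIndependent k A)
    (hΩ : ∀ z : Ω, IsAlgebraic (Algebra.adjoin k (Set.range A)) z)
    {A' : Fin 2 → M} (hA' : AlgebraicIndependent k A') :
    ∃ σ : Ω →ₐ[k] M, ∀ i, σ (A i) = A' i := by
  let P := MvPolynomial (Fin 2) k
  let Fr := FractionRing P
  let e : Fr →+* Ω := IsFractionRing.lift (A := P) (g := (aeval (R := k) A).toRingHom) hA
  let e' : Fr →+* M := IsFractionRing.lift (A := P) (g := (aeval (R := k) A').toRingHom) hA'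
  have he : ∀ p : P, e (algebraMap P Fr p) = aeval A p := fun p => IsFractionRing.lift_algebraMap hA p
  have he' : ∀ p : P, e' (algebraMap P Fr p) = aeval A' p :=
    fun p => IsFractionRing.lift_algebraMap hA' p
  obtain ⟨σ, hσ⟩ := lift_hom e e' (by
    let _ := e.toAlgebra
    intro z
    let q := hA.aevalEquiv
    refine isAlg_transfer ((algebraMap P Fr).comp q.symm.toRingHom) ?_ ?_ (hΩ z)
    · exact (IsFractionRing.injective P Fr).comp q.symm.injective
    · intro r
      show e (algebraMap P Fr (q.symm r)) = r
      rw [he]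
      have := hA.algebraMap_aevalEquiv (q.symm r)
      rw [← this]
      exact congrArg Subtype.val (q.apply_symm_apply r))
  have h : ∀ p : P, σ (aeval A p) = aeval A' p := fun p => by rw [← he, hσ, he']
  refine ⟨{ σ with commutes' := fun r => ?_ }, fun i => ?_⟩
  · have := h (C r)
    rwa [algHom_C, algHom_C] at this
  · have := h (X i)
    rwa [aeval_X, aeval_X] at this

theorem pull_back {M : Type u} [Field M] [Algebra k M] [IsAlgClosed Ω]
    (hΩ : ∀ z : Ω, IsAlgebraic (Algebra.adjoin k (Set.range A)) z)
    (σ : Ω →ₐ[k] M) (φ : M →ₐ[k] M) (hφ : ∀ i, φ (σ (A i)) = σ (A i)) :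
    ∃ s : Ω →ₐ[k] Ω, ∀ x, σ (s x) = φ (σ x) := by
  have hfix : ∀ c ∈ Algebra.adjoin k (Set.range A), φ (σ c) = σ c := by
    have : Algebra.adjoin k (Set.range A) ≤ AlgHom.equalizer (φ.comp σ) σ := by
      rw [Algebra.adjoin_le_iff]
      rintro _ ⟨i, rfl⟩
      exact hφ i
    exact fun c hc => this hc
  let _ : Algebra Ω M := σ.toRingHom.toAlgebra
  have hy : ∀ x, ∃ y, σ y = φ (σ x) := by
    intro x
    apply alg_elt (k := Ω)
    obtain ⟨p, hp, hpx⟩ := hΩ x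
    refine ⟨p.map (algebraMap _ Ω), ?_, ?_⟩
    · rwa [Ne, Polynomial.map_eq_zero_iff]
      exact Subtype.val_injective
    · rw [Polynomial.aeval_def, Polynomial.eval₂_map]
      have e : (algebraMap Ω M).comp (algebraMap (Algebra.adjoin k (Set.range A)) Ω) =
          (φ.comp σ).toRingHom.comp (algebraMap (Algebra.adjoin k (Set.range A)) Ω) := by
        apply RingHom.ext
        intro c
        exact (hfix c c.2).symm
      rw [e]
      have := Polynomial.hom_eval₂ p (algebraMap (Algebra.adjoin k (Set.range A)) Ω)
        (φ.comp σ).toRingHom x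
      rw [← Polynomial.aeval_def, hpx, map_zero] at this
      exact this.symm
  choose s hs using hy
  have inj : ∀ a b, σ a = σ b → a = b := fun a b h => σ.injective h
  let s0 : Ω →+* Ω := RingHom.mk' ⟨⟨s, ?_⟩, ?_⟩ ?_
  refine ⟨{ s0 with commutes' := ?_ }, hs⟩
  · intro r; apply inj; show σ (s _) = _; rw [hs]; simp
  · apply inj; rw [hs]; simp
  · intro x y; apply inj; simp only [map_mul, hs]
  · intro x y; apply inj; show σ (s _) = σ (s _ + s _); simp only [map_add, hs]
end

section
universe u
variable {k : Type u} [Field k] [IsAlgClosed k] {f : MvPolynomial (Fin 2) k}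
    {F : MvPolynomial (Fin 3) k} {d : ℕ} {Ω : Type u} [Field Ω] [Algebra k Ω]
    {A : Fin 2 → Ω}

theorem transp_aux [IsAlgClosed Ω] (g : Good f F d) (hA : AlgebraicIndependent k A)
    (hΩ : ∀ z : Ω, IsAlgebraic (Algebra.adjoin k (Set.range A)) z)
    (L M : Type u) [Field L] [Field M] [IsAlgClosed M] [Algebra (PowerSeries Ω) L]
    [IsFractionRing (PowerSeries Ω) L] [Algebra L M] [Algebra.IsAlgebraic L M]
    [Algebra (PowerSeries Ω) M] [IsScalarTower (PowerSeries Ω) L M] [Algebra k M]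
    [IsScalarTower k (PowerSeries Ω) M] :
    ∃ (s : Ω →ₐ[k] Ω) (ρ ρ' : Ω), (∀ i, s (A i) = A i) ∧ ρ ≠ ρ' ∧ (gline f A).eval ρ = 0 ∧
      (gline f A).eval ρ' = 0 ∧ s ρ = ρ' ∧ s ρ' = ρ ∧
      (∀ z, (gline f A).eval z = 0 → z ≠ ρ → z ≠ ρ' → s z = z) ∧
      ∀ f' F' d', Good f' F' d' → ¬ Associated f f' → ∀ z, (gline f' A).eval z = 0 → s z = z := by
  obtain ⟨τ, hτ⟩ : ∃ τ, (gline f A).eval τ = 0 := by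
    apply IsAlgClosed.exists_root
    intro h
    have h3 := Polynomial.natDegree_eq_of_degree_eq_some (n := 0) h
    rw [gline_natDegree g hA] at h3
    have := g.two_le
    omega
  set v : Fin 2 → Ω := ![τ, A 0 * τ + A 1] with hvdef
  have h0 : aeval v f = 0 := by rw [← gline_eval]; exact hτ
  have hv : ¬ ∀ i, IsAlgebraic k (v i) := gline_pt hA τ
  have hinj : Function.Injective (algebraMap (PowerSeries Ω) M) := by
    rw [IsScalarTower.algebraMap_eq (PowerSeries Ω) L M]
    exact (algebraMap L M).injective.comp (IsFractionRing.injective _ L)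
  set A' : Fin 2 → M := ![algebraMap (PowerSeries Ω) M (PowerSeries.C (slp f v)),
        algebraMap (PowerSeries Ω) M (PowerSeries.C (icp f v) + PowerSeries.X)] with hA'def
  have hA' : AlgebraicIndependent k A' := by
    have := (ind_ps (icp f v) (slp_trans g v h0 hv)).map' (f := IsScalarTower.toAlgHom k (PowerSeries Ω) M) hinj
    convert this using 1
    ext i; fin_cases i <;> rfl
  have hmap : ∀ f' : MvPolynomial (Fin 2) k, (gps f' (slp f v) (icp f v)).map
      (algebraMap (PowerSeries Ω) M) = gline f' A' := fun f' => gps_map f' _ _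
  obtain ⟨φ, ρ, ρ', hne, hρ, hρ', hφρ, hφρ', hfix⟩ := own_curve (L := L) (M := M) g v h0 hv (by
    rw [hmap]; exact gline_sep g hA')
  simp only [hmap] at hρ hρ' hfix
  obtain ⟨σ, hσ⟩ := lift_A hA hΩ hA'
  have hσA : (fun i => σ (A i)) = A' := funext hσ
  let φk : M →ₐ[k] M := (φ.restrictScalars k).toAlgHom
  have hφι : ∀ r, φ (algebraMap (PowerSeries Ω) M r) = algebraMap (PowerSeries Ω) M r := φ.commutes
  obtain ⟨s, hs⟩ := pull_back hΩ σ φk (by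
    intro i
    rw [hσ]
    show φ (A' i) = A' i
    fin_cases i
    · exact hφι _
    · exact hφι _)
  replace hs : ∀ x, σ (s x) = φ (σ x) := hs
  have inj : ∀ a b, σ a = σ b → a = b := fun a b h => σ.injective h
  have hev : ∀ (f' : MvPolynomial (Fin 2) k) z, (gline f' A').eval (σ z) = 0 ↔
      (gline f' A).eval z = 0 := by
    intro f' z
    rw [← hσA, gline_hom]
    exact map_eq_zero_iff σ σ.injective
  have hdes : ∀ z, (gline f A').eval z = 0 → ∃ y, σ y = z := by
    intro z hz
    let _ : Algebra Ω M := σ.toRingHom.toAlgebra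
    apply alg_elt (k := Ω)
    refine ⟨gline f A, ?_, ?_⟩
    · intro h
      have := gline_natDegree g hA
      rw [h, Polynomial.natDegree_zero] at this
      have := g.two_le
      omega
    · rw [← Polynomial.eval_map_algebraMap]
      show ((gline f A).map σ.toRingHom).eval z = 0
      rw [gline_map, hσA, hz]
  obtain ⟨r, rfl⟩ := hdes ρ hρ
  obtain ⟨r', rfl⟩ := hdes ρ' hρ'
  refine ⟨s, r, r', ?_, ?_, ?_, ?_, ?_, ?_, ?_, ?_⟩
  · intro i
    apply inj
    rw [hs, hσ]
    fin_cases i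
    · exact hφι _
    · exact hφι _
  · rintro rfl; exact hne rfl
  · exact (hev _ _).1 hρ
  · exact (hev _ _).1 hρ'
  · apply inj; rw [hs, hφρ]
  · apply inj; rw [hs, hφρ']
  · intro z hz h1 h2
    apply inj
    rw [hs]
    exact hfix _ ((hev _ _).2 hz) (fun h => h1 (inj _ _ h)) (fun h => h2 (inj _ _ h))
  · intro f' F' d' g' hna z hz
    apply inj
    rw [hs]
    obtain ⟨y, hy⟩ := other_curve g g' hna v h0 hv (σ z) (by rw [hmap]; exact (hev _ _).2 hz)
    rw [← hy, hφι]

theorem transp [IsAlgClosed Ω] (g : Good f F d) (hA : AlgebraicIndependent k A)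
    (hΩ : ∀ z : Ω, IsAlgebraic (Algebra.adjoin k (Set.range A)) z) :
    ∃ (s : Ω →ₐ[k] Ω) (ρ ρ' : Ω), (∀ i, s (A i) = A i) ∧ ρ ≠ ρ' ∧ (gline f A).eval ρ = 0 ∧
      (gline f A).eval ρ' = 0 ∧ s ρ = ρ' ∧ s ρ' = ρ ∧
      (∀ z, (gline f A).eval z = 0 → z ≠ ρ → z ≠ ρ' → s z = z) ∧
      ∀ f' F' d', Good f' F' d' → ¬ Associated f f' → ∀ z, (gline f' A).eval z = 0 → s z = z := by
  let L := FractionRing (PowerSeries Ω)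
  let M := AlgebraicClosure L
  exact transp_aux g hA hΩ L M
end
end

section
section
universe u
variable {k : Type u} [Field k] [IsAlgClosed k] {Ω : Type u} [Field Ω] [Algebra k Ω]
    {A : Fin 2 → Ω}

theorem gal_full [IsAlgClosed Ω] {r : ℕ} {f : Fin r → MvPolynomial (Fin 2) k}
    {F : Fin r → MvPolynomial (Fin 3) k} {d : Fin r → ℕ} (g : ∀ i, Good (f i) (F i) (d i))
    (hna : ∀ i j, i ≠ j → ¬ Associated (f i) (f j)) (hA : AlgebraicIndependent k A)
    (hΩ : ∀ z : Ω, IsAlgebraic (Algebra.adjoin k (Set.range A)) z)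
    (t : ∀ i, Fin (d i) → Ω) (hti : ∀ i, Function.Injective (t i))
    (htr : ∀ i j, (gline (f i) A).eval (t i j) = 0)
    (hex : ∀ i z, (gline (f i) A).eval z = 0 → ∃ j, t i j = z)
    (π : ∀ i, Equiv.Perm (Fin (d i))) :
    ∃ s : Ω →ₐ[k] Ω, (∀ l, s (A l) = A l) ∧ ∀ i j, s (t i j) = t i (π i j) := by
  let H : Submonoid (∀ i, Equiv.Perm (Fin (d i))) :=
    { carrier := {π | ∃ s : Ω →ₐ[k] Ω, (∀ l, s (A l) = A l) ∧ ∀ i j, s (t i j) = t i (π i j)}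
      one_mem' := ⟨AlgHom.id k Ω, fun _ => rfl, fun _ _ => rfl⟩
      mul_mem' := by
        rintro π π' ⟨s, hs, hs'⟩ ⟨q, hq, hq'⟩
        refine ⟨s.comp q, fun l => ?_, fun i j => ?_⟩
        · rw [AlgHom.comp_apply, hq, hs]
        · rw [AlgHom.comp_apply, hq', hs']; rfl }
  have hinv : ∀ π ∈ H, π⁻¹ ∈ H := by
    intro π hπ
    have : π⁻¹ = π ^ (orderOf π - 1) := by
      apply inv_eq_of_mul_eq_one_left
      rw [← pow_succ, Nat.sub_add_cancel (orderOf_pos π), pow_orderOf_eq_one]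
    rw [this]
    exact H.pow_mem hπ _
  have hind : ∀ s : Ω →ₐ[k] Ω, (∀ l, s (A l) = A l) → ∃ π ∈ H, ∀ i j, s (t i j) = t i (π i j) := by
    intro s hs
    have h1 : ∀ i j, ∃ j', t i j' = s (t i j) := by
      intro i j
      apply hex
      have := gline_hom s (f := f i) (A := A) (t i j)
      rwa [funext hs, htr, map_zero] at this
    choose p hp using h1
    have hinj : ∀ i, Function.Injective (p i) := by
      intro i a b hab
      apply hti i
      apply s.injective
      show s (t i a) = s (t i b)
      rw [← hp, ← hp, hab]
    let π : ∀ i, Equiv.Perm (Fin (d i)) := fun i =>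
      Equiv.ofBijective (p i) (Finite.injective_iff_bijective.1 (hinj i))
    have : ∀ i j, s (t i j) = t i (π i j) := fun i j => (hp i j).symm
    exact ⟨π, ⟨s, hs, this⟩, this⟩
  suffices h : ∀ i σ, Pi.mulSingle i σ ∈ H from Submonoid.pi_mem_of_mulSingle_mem π fun i => h i _
  intro i
  -- one transposition
  have hone : ∃ a b : Fin (d i), a ≠ b ∧ Pi.mulSingle i (Equiv.swap a b) ∈ H := by
    obtain ⟨s, ρ, ρ', hsA, hne, hρ, hρ', h1, h2, h3, h4⟩ := transp (g i) hA hΩ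
    obtain ⟨a, rfl⟩ := hex i ρ hρ
    obtain ⟨b, rfl⟩ := hex i ρ' hρ'
    refine ⟨a, b, fun h => hne (by rw [h]), s, hsA, fun j c => ?_⟩
    by_cases hj : j = i
    · subst hj
      rw [Pi.mulSingle_eq_same]
      by_cases hca : c = a
      · rw [hca, Equiv.swap_apply_left, h1]
      · by_cases hcb : c = b
        · rw [hcb, Equiv.swap_apply_right, h2]
        · rw [Equiv.swap_apply_of_ne_of_ne hca hcb]
          exact h3 _ (htr _ _) (fun h => hca (hti _ h)) (fun h => hcb (hti _ h))
    · rw [Pi.mulSingle_eq_of_ne hj]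
      exact h4 _ _ _ (g j) (hna i j (Ne.symm hj)) _ (htr j c)
  obtain ⟨a, b, hab, hH⟩ := hone
  have hswap : ∀ c e : Fin (d i), c ≠ e → Pi.mulSingle i (Equiv.swap c e) ∈ H := by
    intro c e hce
    obtain ⟨s, hs, hs1, hs2⟩ := two_trans (g i) hA hΩ (fun h => hab (hti i h))
      (fun h => hce (hti i h)) (htr i a) (htr i b) (htr i c) (htr i e)
    obtain ⟨π, hπ, hπs⟩ := hind s hs
    have e1 : π i a = c := by apply hti i; rw [← hπs, hs1]
    have e2 : π i b = e := by apply hti i; rw [← hπs, hs2]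
    have : (Pi.mulSingle i (Equiv.swap c e) : ∀ i, Equiv.Perm (Fin (d i))) =
        π * Pi.mulSingle i (Equiv.swap a b) * π⁻¹ := by
      funext j
      by_cases hj : j = i
      · subst hj
        rw [Pi.mul_apply, Pi.mul_apply, Pi.mulSingle_eq_same, Pi.mulSingle_eq_same, Pi.inv_apply,
          ← e1, ← e2, Equiv.swap_apply_apply]
      · rw [Pi.mul_apply, Pi.mul_apply, Pi.mulSingle_eq_of_ne hj, Pi.mulSingle_eq_of_ne hj,
          Pi.inv_apply]
        simp
    rw [this]
    exact H.mul_mem (H.mul_mem hπ hH) (hinv π hπ)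
  intro σ
  induction σ using Equiv.Perm.swap_induction_on with
  | one => rw [Pi.mulSingle_one]; exact H.one_mem
  | swap_mul σ x y hxy ih =>
    rw [Pi.mulSingle_mul]
    exact H.mul_mem (hswap x y hxy) ih
end
end

section
theorem exists_gen.{u} (k : Type u) [Field k] : ∃ (Ω : Type u) (_ : Field Ω) (_ : IsAlgClosed Ω)
    (_ : Algebra k Ω) (A : Fin 2 → Ω), AlgebraicIndependent k A ∧
      ∀ z : Ω, IsAlgebraic (Algebra.adjoin k (Set.range A)) z := by
  let P := MvPolynomial (Fin 2) k
  let Fr := FractionRing P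
  let Ω := AlgebraicClosure Fr
  let A : Fin 2 → Ω := fun i => algebraMap Fr Ω (algebraMap P Fr (X i))
  let φ : P →ₐ[k] Ω := (IsScalarTower.toAlgHom k Fr Ω).comp (IsScalarTower.toAlgHom k P Fr)
  have hφ : ∀ p, aeval A p = φ p := by
    intro p
    have : aeval A = φ := by
      apply algHom_ext
      intro i
      rw [aeval_X]; rfl
    rw [this]
  have hinj : Function.Injective φ :=
    (algebraMap Fr Ω).injective.comp (IsFractionRing.injective P Fr)
  have hA : AlgebraicIndependent k A := by
    intro p q h
    exact hinj (by rw [← hφ, ← hφ]; exact h)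
  refine ⟨Ω, inferInstance, inferInstance, inferInstance, A, hA, ?_⟩
  intro z
  have h1 : IsAlgebraic Fr z := Algebra.IsAlgebraic.isAlgebraic z
  have h2 : IsAlgebraic P z := (IsFractionRing.isAlgebraic_iff P Fr Ω).2 h1
  refine isAlg_transfer hA.aevalEquiv.toAlgHom.toRingHom hA.aevalEquiv.injective ?_ h2
  intro p
  exact (hA.algebraMap_aevalEquiv p).trans (hφ p)

theorem exists_min {K L : Type*} [Field K] [Field L] [Algebra K L] [IsGalois K L] {d : ℕ}
    (hd : 2 ≤ d) (h : Module.finrank K L = d) :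
    ∃ m : Polynomial K, m.Monic ∧ m.Separable ∧ Irreducible m ∧ m.natDegree = d := by
  have : FiniteDimensional K L := Module.finite_of_finrank_pos (by omega)
  obtain ⟨α, hα⟩ := Field.exists_primitive_element K L
  have hi : IsIntegral K α := Algebra.IsIntegral.isIntegral α
  exact ⟨minpoly K α, minpoly.monic hi, Algebra.IsSeparable.isSeparable K α, minpoly.irreducible hi,
    by rw [← h]; exact (Field.primitive_element_iff_minpoly_natDegree_eq K α).1 hα⟩

theorem mk_good {K : Type*} [Field K] (p : ℕ) [CharP K p] {f : MvPolynomial (Fin 2) K}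
    {F : MvPolynomial (Fin 3) K} {d : ℕ} (hdeg : f.totalDegree = d) (hd2 : 2 ≤ d)
    (hp : ¬ (p ∣ d * (d - 1))) (hirr : AbsolutelyIrreducible f) (hsm : IsSmoothHomogenization F f d) :
    Good (map (algebraMap K (AlgebraicClosure K)) f) (map (algebraMap K (AlgebraicClosure K)) F) d where
  irr := hirr
  tdeg := by
    rw [← hdeg, totalDegree, totalDegree, support_map_of_injective _ (algebraMap K _).injective]
  hom := hsm.1.map _
  deh := by
    rw [← hsm.2.1]
    generalize F = F
    induction F using MvPolynomial.induction_on with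
    | C a => simp
    | add p q hp hq => simp only [map_add, hp, hq]
    | mul_X p n hp =>
      simp only [map_mul, hp, map_X, aeval_X]
      congr 1
      fin_cases n <;> simp
  smooth := by
    intro x hx h0
    obtain ⟨j, hj⟩ := hsm.2.2 x hx h0
    exact ⟨j, by rwa [pderiv_map]⟩
  two_le := hd2
  dk := by
    intro h
    rw [← map_natCast (algebraMap K (AlgebraicClosure K)), map_eq_zero, CharP.cast_eq_zero_iff K p] at h
    exact hp (h.mul_right _)
  dk1 := by
    intro h
    rw [← map_natCast (algebraMap K (AlgebraicClosure K)), map_eq_zero, CharP.cast_eq_zero_iff K p] at h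
    exact hp (h.mul_left _)

theorem main_na.{u} (K : Type u) [Field K] (p : ℕ)
    [CharP K p] (hPAC : IsPAC K)
    (r : ℕ) (f : Fin r → MvPolynomial (Fin 2) K) (d : Fin r → ℕ)
    (hdeg : ∀ i, (f i).totalDegree = d i)
    (hd2 : ∀ i, 2 ≤ d i)
    (hp : ∀ i, ¬ (p ∣ d i * (d i - 1)))
    (hirr : ∀ i, AbsolutelyIrreducible (f i))
    (hsm : ∀ i, ∃ F : MvPolynomial (Fin 3) K, IsSmoothHomogenization F (f i) (d i))
    (hL : ∀ i, ∃ (L : Type u) (_ : Field L) (_ : Algebra K L),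
      IsGalois K L ∧ Module.finrank K L = d i)
    (hna : ∀ i j, i ≠ j → ¬ Associated (map (algebraMap K (AlgebraicClosure K)) (f i))
      (map (algebraMap K (AlgebraicClosure K)) (f j)))
    (h : MvPolynomial (Fin 2) K) (hh : h ≠ 0) :
      ∃ a : Fin 2 → K, MvPolynomial.eval a h ≠ 0 ∧
        ∀ i, Irreducible (lineSub (f i) (a 0) (a 1)) := by
  choose F hF using hsm
  have hm : ∀ i, ∃ m : Polynomial K, m.Monic ∧ m.Separable ∧ Irreducible m ∧ m.natDegree = d i := by
    intro i
    obtain ⟨L, _, _, hG, hr⟩ := hL i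
    exact exists_min (hd2 i) hr
  choose m hmm hms hmi hmd using hm
  have g := fun i => mk_good p (hdeg i) (hd2 i) (hp i) (hirr i) (hF i)
  obtain ⟨Ω, _, _, _, A, hA, hΩ⟩ := exists_gen (AlgebraicClosure K)
  let _ : Algebra K Ω := ((algebraMap (AlgebraicClosure K) Ω).comp
    (algebraMap K (AlgebraicClosure K))).toAlgebra
  have : IsScalarTower K (AlgebraicClosure K) Ω := IsScalarTower.of_algebraMap_eq fun _ => rfl
  choose t hti htr hex using fun i => exists_root_enum (k := Ω) _ (gline_sep (g i) hA)
    (gline_natDegree (g i) hA)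
  simp only [Polynomial.coe_aeval_eq_eval] at htr hex
  let G : Fin r → Polynomial (MvPolynomial (Fin 2) K) := fun i =>
    lineSub (map (algebraMap K (MvPolynomial (Fin 2) K)) (f i)) (X 0) (X 1)
  have hf0 : ∀ i, f i ≠ 0 := by
    intro i h0
    have := hdeg i
    rw [h0, totalDegree_zero] at this
    have := hd2 i
    omega
  have hGΩ : ∀ i, (G i).map (aeval (R := K) A).toRingHom =
      gline (map (algebraMap K (AlgebraicClosure K)) (f i)) A := by
    intro i
    rw [gline, map_map, ← IsScalarTower.algebraMap_eq, lineSub_map, map_map]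
    have e1 : (aeval (R := K) A).toRingHom.comp (algebraMap K (MvPolynomial (Fin 2) K)) =
        algebraMap K Ω := RingHom.ext (aeval (R := K) A).commutes
    have e2 : ∀ l, (aeval (R := K) A).toRingHom (X l) = A l := fun l => aeval_X _ _
    rw [e1, e2, e2]
  obtain ⟨a, ha, hai⟩ := pac_step K hPAC (d := d) (fun i => by have := hd2 i; omega) G
    (fun i => lineSub_natDegree (f i) (hf0 i) (hdeg i) _ _ (transcendental_X K 0))
    m hmm hms hmi hmd h hh Ω A hA t hti
    (fun i j => by rw [hGΩ]; exact htr i j) (gal_full g hna hA hΩ t hti htr hex)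
  refine ⟨a, ha, fun i => ?_⟩
  have := hai i
  rw [lineSub_map, map_map] at this
  have e1 : (eval a).comp (algebraMap K (MvPolynomial (Fin 2) K)) = RingHom.id K :=
    RingHom.ext fun x => eval_C _
  rw [e1, map_id, eval_X, eval_X] at this
  exact this

theorem irr_of_assoc {K : Type*} [Field K] {f f' : MvPolynomial (Fin 2) K} (h0 : f ≠ 0)
    (h : Associated (map (algebraMap K (AlgebraicClosure K)) f)
      (map (algebraMap K (AlgebraicClosure K)) f')) (a b : K) (hi : Irreducible (lineSub f a b)) :
    Irreducible (lineSub f' a b) := by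
  obtain ⟨u, hu⟩ := h
  obtain ⟨c, hc, hcu⟩ := MvPolynomial.isUnit_iff_eq_C_of_isReduced.1 u.isUnit
  rw [hcu] at hu
  obtain ⟨m, hm⟩ := MvPolynomial.ne_zero_iff.1 h0
  have hco : ∀ n, algebraMap K (AlgebraicClosure K) (coeff n f) * c =
      algebraMap K (AlgebraicClosure K) (coeff n f') := by
    intro n
    rw [← coeff_map, ← coeff_map, ← hu, mul_comm (map _ f), coeff_C_mul, mul_comm]
  set e := coeff m f' / coeff m f with he
  have hec : algebraMap K (AlgebraicClosure K) e = c := by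
    rw [he, map_div₀, ← hco, mul_div_cancel_left₀]
    simpa using hm
  have hff : f' = C e * f := by
    ext n
    rw [coeff_C_mul]
    apply (algebraMap K (AlgebraicClosure K)).injective
    rw [← hco, map_mul, hec, mul_comm]
  have he0 : e ≠ 0 := by
    rintro h
    rw [h, map_zero] at hec
    exact hc.ne_zero hec.symm
  have : lineSub f' a b = Polynomial.C e * lineSub f a b := by
    rw [hff, lineSub, map_mul, algHom_C]; rfl
  rw [this]
  exact (irreducible_isUnit_mul (Polynomial.isUnit_C.2 (IsUnit.mk0 _ he0))).2 hi

theorem pac_dense_irreducible_line_substitutions'.{u} (K : Type u) [Field K] (p : ℕ)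
    [CharP K p] (hPAC : IsPAC K)
    (r : ℕ) (f : Fin r → MvPolynomial (Fin 2) K) (d : Fin r → ℕ)
    (hdeg : ∀ i, (f i).totalDegree = d i)
    (hd2 : ∀ i, 2 ≤ d i)
    (hp : ∀ i, ¬ (p ∣ d i * (d i - 1)))
    (hirr : ∀ i, AbsolutelyIrreducible (f i))
    (hsm : ∀ i, ∃ F : MvPolynomial (Fin 3) K, IsSmoothHomogenization F (f i) (d i))
    (hL : ∀ i, ∃ (L : Type u) (_ : Field L) (_ : Algebra K L),
      IsGalois K L ∧ Module.finrank K L = d i) :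
    ∀ h : MvPolynomial (Fin 2) K, h ≠ 0 →
      ∃ a₁ a₂ : K, MvPolynomial.eval ![a₁, a₂] h ≠ 0 ∧
        ∀ i, Irreducible (lineSub (f i) a₁ a₂) := by
  classical
  intro h hh
  let fk : Fin r → MvPolynomial (Fin 2) (AlgebraicClosure K) := fun i =>
    map (algebraMap K (AlgebraicClosure K)) (f i)
  let q : Fin r → Associates (MvPolynomial (Fin 2) (AlgebraicClosure K)) := fun i =>
    Associates.mk (fk i)
  let Q := Set.range q
  have : Fintype Q := Fintype.ofFinite _
  let e : Q ≃ Fin (Fintype.card Q) := Fintype.equivFin Q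
  have hrep : ∀ x : Q, ∃ i, q i = x := fun x => x.2
  choose rep hrep using hrep
  let ρ : Fin (Fintype.card Q) → Fin r := fun n => rep (e.symm n)
  obtain ⟨a, ha, hai⟩ := main_na K p hPAC _ (fun n => f (ρ n)) (fun n => d (ρ n)) (fun n => hdeg _)
    (fun n => hd2 _) (fun n => hp _) (fun n => hirr _) (fun n => hsm _) (fun n => hL _) (by
      intro m n hmn has
      apply hmn
      have h1 : q (ρ m) = q (ρ n) := Associates.mk_eq_mk_iff_associated.2 has
      rw [hrep, hrep] at h1
      exact e.symm.injective (Subtype.ext h1)) h hh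
  refine ⟨a 0, a 1, ?_, fun i => ?_⟩
  · convert ha using 2
    congr 1
    ext l; fin_cases l <;> rfl
  · have h1 : q (ρ (e ⟨q i, i, rfl⟩)) = q i := by
      show q (rep (e.symm _)) = _
      rw [hrep, Equiv.symm_apply_apply]
    refine irr_of_assoc ?_ (Associates.mk_eq_mk_iff_associated.1 h1) _ _ (hai (e ⟨q i, i, rfl⟩))
    intro h0
    have := hdeg (ρ (e ⟨q i, i, rfl⟩))
    rw [h0, totalDegree_zero] at this
    have := hd2 (ρ (e ⟨q i, i, rfl⟩))
    omega
end

universe u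

/-- let `K` be a PAC field of characteristic `p` and let
`f₁, …, f_r ∈ K[T,X]` be absolutely irreducible polynomials with total degrees
`d_i ≥ 2`, `p ∤ d_i(d_i − 1)` and smooth homogenizations.  If for each `i` the field
`K` has a Galois field extension of degree `d_i`, then the set of pairs
`(a₁,a₂) ∈ K²` with all `f_i(T, a₁T + a₂)` irreducible in `K[T]` is Zariski-dense in
the affine plane: every nonzero `h ∈ K[A₁,A₂]` is nonzero at some such pair. -/
theorem pac_dense_irreducible_line_substitutions (K : Type u) [Field K] (p : ℕ)
    [CharP K p] (hPAC : IsPAC K)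
    (r : ℕ) (f : Fin r → MvPolynomial (Fin 2) K) (d : Fin r → ℕ)
    (hdeg : ∀ i, (f i).totalDegree = d i)
    (hd2 : ∀ i, 2 ≤ d i)
    (hp : ∀ i, ¬ (p ∣ d i * (d i - 1)))
    (hirr : ∀ i, AbsolutelyIrreducible (f i))
    (hsm : ∀ i, ∃ F : MvPolynomial (Fin 3) K, IsSmoothHomogenization F (f i) (d i))
    (hL : ∀ i, ∃ (L : Type u) (_ : Field L) (_ : Algebra K L),
      IsGalois K L ∧ Module.finrank K L = d i) :
    ∀ h : MvPolynomial (Fin 2) K, h ≠ 0 →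
      ∃ a₁ a₂ : K, MvPolynomial.eval ![a₁, a₂] h ≠ 0 ∧
        ∀ i, Irreducible (lineSub (f i) a₁ a₂) := by
  exact pac_dense_irreducible_line_substitutions' K p hPAC r f d hdeg hd2 hp hirr hsm hL
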